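/- arXiv:1506.08169 — 2 statements merged into one kernel-verified Lean document; each statement's English description precedes it below -/
import Mathlib

section
/- If G is a finite group of odd order, then the number of conjugacy classes of G consisting of elements of prime power order equals the number of Q_pp-valued irreducible characters of G. -/
open scoped Classical

noncomputable section

/-- `Qfield p` is the subfield of `ℂ` obtained by adjoining to `ℚ` all `p^a`-th
roots of unity for all positive integers `a` (any subfield of `ℂ` contains `ℚ`). -/
def Qfield (p : ℕ) : Subfield ℂ :=
  Subfield.closure {x : ℂ | ∃ a : ℕ, 0 < a ∧ x ^ p ^ a = 1}

/-- `χ : G → ℂ` is an irreducible (ordinary, complex) character of `G` if it is the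
character of some simple finite-dimensional complex representation of `G`. -/
def IsIrreducibleCharacter (G : Type) [Group G] (χ : G → ℂ) : Prop :=
  ∃ V : FDRep ℂ G, CategoryTheory.Simple V ∧ χ = fun g => V.character g

/-- The set of `Q_pp`-valued irreducible characters of `G`: irreducible characters all
of whose values lie in `Qfield p` for some prime `p`. -/
def QppValuedIrrChars (G : Type) [Group G] : Set (G → ℂ) :=
  {χ | IsIrreducibleCharacter G χ ∧ ∃ p : ℕ, p.Prime ∧ ∀ g, χ g ∈ Qfield p}

/-- The set of conjugacy classes of `G` consisting of elements of prime power order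
(the identity, of order `p ^ 0 = 1`, is included). -/
def PrimePowerClasses (G : Type) [Group G] : Set (ConjClasses G) :=
  {c | ∃ g : G, c = ConjClasses.mk g ∧ ∃ p k : ℕ, p.Prime ∧ orderOf g = p ^ k}

theorem sum_eq_sum_fixed_of_two_eq_zero {F U : Type*} [CommRing F] (h2 : (2 : F) = 0)
    [Fintype U] [DecidableEq U] {u : U → U} (hu : Function.Involutive u) (f : U → F)
    (hf : ∀ c, f (u c) = f c) : ∑ c, f c = ∑ c : {c // u c = c}, f c := by
  rw [← Finset.sum_filter_add_sum_filter_not Finset.univ (fun c => u c = c) f,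
    Finset.sum_involution (s := Finset.univ.filter fun c => ¬ u c = c) (fun c _ => u c),
    add_zero]
  · exact (Finset.sum_subtype _ (by simp) _)
  · intro c _
    rw [hf, ← two_mul, h2, zero_mul]
  · intro c hc _
    simpa using hc
  · intro c hc
    simpa [hu c, eq_comm] using hc
  · intro c _
    exact hu c

theorem card_fixed_eq_and_separates {F I U : Type*} [CommRing F] [Nontrivial F] (h2 : (2 : F) = 0)
    [Fintype I] [DecidableEq I] [Fintype U] [DecidableEq U] {M : Matrix I U F} {N : Matrix U I F}
    (hMN : M * N = 1) (hNM : N * M = 1) {t : I → I} {u : U → U} (ht : Function.Involutive t)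
    (hu : Function.Involutive u) (hM : ∀ i c, M (t i) c = M i (u c)) :
    Fintype.card {i // t i = i} = Fintype.card {c // u c = c} ∧
      ∀ i j, t i = i → t j = j → (∀ c, u c = c → M i c = M j c) → i = j := by
  have hM' : M.submatrix t u = M := by
    ext i c
    rw [Matrix.submatrix_apply, hM, hu]
  have hN' : N.submatrix u t = N := by
    have h1 : M * N.submatrix u t = 1 := by
      have := Matrix.submatrix_mul_equiv M N t hu.toPerm t
      rw [hMN, Matrix.submatrix_one _ ht.injective] at this
      simpa [hM'] using this
    rw [← Matrix.one_mul (N.submatrix u t), ← hNM, Matrix.mul_assoc, h1, Matrix.mul_one]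
  have hN (c i) : N (u c) (t i) = N c i := congrFun (congrFun hN' c) i
  let M' : Matrix {i // t i = i} {c // u c = c} F := M.submatrix (↑) (↑)
  let N' : Matrix {c // u c = c} {i // t i = i} F := N.submatrix (↑) (↑)
  have h1 : M' * N' = 1 := by
    ext i j
    have := congrFun (congrFun hMN i) j
    rw [Matrix.mul_apply, sum_eq_sum_fixed_of_two_eq_zero h2 hu] at this
    · rw [Matrix.mul_apply]
      exact this.trans (by simp [Matrix.one_apply, Subtype.ext_iff])
    · intro c
      rw [← hM, i.2]
      nth_rw 1 [← j.2]
      rw [hN]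
  have h2 : N' * M' = 1 := by
    ext c d
    have := congrFun (congrFun hNM c) d
    rw [Matrix.mul_apply, sum_eq_sum_fixed_of_two_eq_zero h2 ht] at this
    · rw [Matrix.mul_apply]
      exact this.trans (by simp [Matrix.one_apply, Subtype.ext_iff])
    · intro i
      rw [hM, d.2]
      nth_rw 1 [← c.2]
      rw [hN]
  refine ⟨Matrix.square_of_invertible M' N' h1 h2, fun i j hi hj h => ?_⟩
  by_contra hij
  have h3 := congrFun (congrFun h1 ⟨i, hi⟩) ⟨i, hi⟩
  have h4 := congrFun (congrFun h1 ⟨j, hj⟩) ⟨i, hi⟩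
  have h5 : (M' * N') ⟨i, hi⟩ ⟨i, hi⟩ = (M' * N') ⟨j, hj⟩ ⟨i, hi⟩ := by
    simp only [Matrix.mul_apply]
    exact Finset.sum_congr rfl fun c _ => congrArg (· * _) (h c c.2)
  rw [h3, h4, Matrix.one_apply_eq, Matrix.one_apply_ne (by simpa [eq_comm] using hij)] at h5
  exact one_ne_zero h5

theorem exists_ringHom_comp_eq {R L M : Type*} [CommRing R] [Field L] [Field M] [IsAlgClosed M]
    (f : R →+* L) (φ : R →+* M) (hf : Function.Injective f) (hφ : Function.Injective φ)
    (h : ∀ x : L, ∃ P : Polynomial R, P ≠ 0 ∧ P.eval₂ f x = 0) :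
    ∃ s : L →+* M, s.comp f = φ := by
  let := f.toAlgebra
  let := φ.toAlgebra
  have : FaithfulSMul R L := (faithfulSMul_iff_algebraMap_injective R L).2 hf
  have : FaithfulSMul R M := (faithfulSMul_iff_algebraMap_injective R M).2 hφ
  have : IsDomain R := Function.Injective.isDomain f hf
  have : Module.IsTorsionFree R M := Module.isTorsionFree_iff_algebraMap_injective.2 hφ
  have : Algebra.IsAlgebraic R L := ⟨fun x => h x⟩
  exact ⟨(IsAlgClosed.lift (R := R) (S := L) (M := M)).toRingHom,
    RingHom.ext fun x => (IsAlgClosed.lift (R := R) (S := L) (M := M)).commutes x⟩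

theorem exists_algHom_comp_eq {k K M : Type} [Field k] [Field K] [Field M] [Algebra k K]
    [Algebra k M] [IsAlgClosed M] [Algebra.IsAlgebraic k K] (i φ : K →ₐ[k] M) :
    ∃ s : M →ₐ[k] M, s.comp i = φ := by
  obtain ⟨B, hB⟩ := exists_isTranscendenceBasis k M
  have inj (ψ : K →ₐ[k] M) :
      Function.Injective (MvPolynomial.eval₂Hom (ψ : K →+* M) ((↑) : B → M)) := by
    let := ψ.toRingHom.toAlgebra
    have : IsScalarTower k K M := IsScalarTower.of_algebraMap_eq fun x => (ψ.commutes x).symm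
    exact hB.1.extendScalars K
  obtain ⟨s, hs⟩ := exists_ringHom_comp_eq _ _ (inj i) (inj φ) (by
    intro x
    have := hB.isAlgebraic
    obtain ⟨P, hP, hPx⟩ := Algebra.IsAlgebraic.isAlgebraic
      (R := Algebra.adjoin k (Set.range ((↑) : B → M))) x
    let e := hB.1.aevalEquiv
    let e' : Algebra.adjoin k (Set.range ((↑) : B → M)) →+* MvPolynomial B k :=
      RingHomClass.toRingHom e.symm
    let j : MvPolynomial B k →+* MvPolynomial B K := MvPolynomial.map (algebraMap k K)
    refine ⟨P.map (j.comp e'), ?_, ?_⟩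
    · refine (Polynomial.map_ne_zero_iff ?_).2 hP
      exact (MvPolynomial.map_injective _ (algebraMap k K).injective).comp e.symm.injective
    · rw [Polynomial.eval₂_map]
      rw [Polynomial.aeval_def] at hPx
      have hcomp : (MvPolynomial.eval₂Hom (i : K →+* M) ((↑) : B → M)).comp
          (j.comp e') = algebraMap _ M :=
        RingHom.ext fun y => by
          obtain ⟨q, rfl⟩ := e.surjective y
          have h1 : algebraMap _ M (e q) = MvPolynomial.aeval ((↑) : B → M) q := by
            simp [e]
          have h2 : e' (e q) = q := e.symm_apply_apply q
          rw [h1, RingHom.comp_apply, RingHom.comp_apply, h2]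
          simp [j, MvPolynomial.aeval_def]
      rw [hcomp]
      exact hPx)
  have hs' (x : K) : s (i x) = φ x := by
    have := DFunLike.congr_fun hs (MvPolynomial.C x)
    simpa using this
  refine ⟨{ s with commutes' := fun c => ?_ }, AlgHom.ext hs'⟩
  have := hs' (algebraMap k K c)
  simpa using this

theorem exists_ringHom_pow {N k : ℕ} [NeZero N] (hk : k.Coprime N) :
    ∃ s : ℂ →+* ℂ, ∀ z : ℂ, z ^ N = 1 → s z = z ^ k := by
  have hirr := Polynomial.cyclotomic.irreducible_rat (NeZero.pos N)
  have : Fact (Irreducible (Polynomial.cyclotomic N ℚ)) := ⟨hirr⟩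
  have hζ := Complex.isPrimitiveRoot_exp N (NeZero.ne N)
  set ζ := Complex.exp (2 * Real.pi * Complex.I / N)
  have hroot {z : ℂ} (hz : IsPrimitiveRoot z N) :
      Polynomial.eval₂ (algebraMap ℚ ℂ) z (Polynomial.cyclotomic N ℚ) = 0 := by
    rw [← Polynomial.eval_map, Polynomial.map_cyclotomic]
    exact hz.isRoot_cyclotomic (NeZero.pos N)
  have : Module.Finite ℚ (AdjoinRoot (Polynomial.cyclotomic N ℚ)) :=
    (AdjoinRoot.powerBasis hirr.ne_zero).finite
  obtain ⟨s, hs⟩ := exists_algHom_comp_eq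
    (AdjoinRoot.liftAlgHom _ (Algebra.ofId ℚ ℂ) ζ (hroot hζ))
    (AdjoinRoot.liftAlgHom _ (Algebra.ofId ℚ ℂ) (ζ ^ k) (hroot (hζ.pow_of_coprime k hk)))
  have hsζ : s ζ = ζ ^ k := by
    have h1 := DFunLike.congr_fun hs (AdjoinRoot.root _)
    rw [AlgHom.comp_apply] at h1
    erw [AdjoinRoot.liftAlgHom_root, AdjoinRoot.liftAlgHom_root] at h1
    exact h1
  refine ⟨s, fun z hz => ?_⟩
  obtain ⟨j, -, rfl⟩ := hζ.eq_pow_of_pow_eq_one hz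
  change s _ = _
  rw [map_pow, hsζ, ← pow_mul, ← pow_mul, mul_comm]

theorem mem_of_forall_ringHom (K : Subfield ℂ) {x : ℂ} (hx : IsAlgebraic K x)
    (h : ∀ s : ℂ →+* ℂ, (∀ y ∈ K, s y = y) → s x = x) : x ∈ K := by
  let E := algebraicClosure K ℂ
  have : IsAlgClosure K E := inferInstance
  have : IsGalois K E := {}
  have hxE : x ∈ E := mem_algebraicClosure_iff.2 hx
  have : (⟨x, hxE⟩ : E) ∈ (⊥ : IntermediateField K E) := by
    rw [InfiniteGalois.mem_bot_iff_fixed]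
    intro τ
    obtain ⟨s, hs⟩ := exists_algHom_comp_eq E.val (E.val.comp τ)
    have h1 := h s fun y hy => s.commutes ⟨y, hy⟩
    have h2 := DFunLike.congr_fun hs (⟨x, hxE⟩ : E)
    apply Subtype.ext
    exact h2.symm.trans h1
  obtain ⟨y, hy⟩ := IntermediateField.mem_bot.1 this
  have h3 : (y : ℂ) = x := congrArg Subtype.val hy
  exact h3 ▸ y.2

theorem exists_forall_ringHom_fixes {p : ℕ} {x : ℂ} (hx : x ∈ Qfield p) :
    ∃ a₀, ∀ a, a₀ ≤ a → ∀ s : ℂ →+* ℂ, (∀ z : ℂ, z ^ p ^ a = 1 → s z = z) → s x = x := by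
  induction hx using Subfield.closure_induction with
  | mem x hx =>
    obtain ⟨b, -, hb⟩ := hx
    exact ⟨b, fun a ha s hs => hs x (orderOf_dvd_iff_pow_eq_one.1
      ((orderOf_dvd_of_pow_eq_one hb).trans (pow_dvd_pow p ha)))⟩
  | one => exact ⟨0, fun a _ s _ => map_one s⟩
  | add x y _ _ hx hy =>
    obtain ⟨a, ha⟩ := hx
    obtain ⟨b, hb⟩ := hy
    exact ⟨max a b, fun c hc s hs => by
      rw [map_add, ha c (le_of_max_le_left hc) s hs, hb c (le_of_max_le_right hc) s hs]⟩
  | mul x y _ _ hx hy =>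
    obtain ⟨a, ha⟩ := hx
    obtain ⟨b, hb⟩ := hy
    exact ⟨max a b, fun c hc s hs => by
      rw [map_mul, ha c (le_of_max_le_left hc) s hs, hb c (le_of_max_le_right hc) s hs]⟩
  | neg x _ hx =>
    obtain ⟨a, ha⟩ := hx
    exact ⟨a, fun c hc s hs => by rw [map_neg, ha c hc s hs]⟩
  | inv x _ hx =>
    obtain ⟨a, ha⟩ := hx
    exact ⟨a, fun c hc s hs => by rw [map_inv₀, ha c hc s hs]⟩

theorem nontrivial_integralClosure_quotient_two :
    Nontrivial (integralClosure ℤ ℂ ⧸ Ideal.span {(2 : integralClosure ℤ ℂ)}) := by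
  rw [Ideal.Quotient.nontrivial_iff, Ne, Ideal.span_singleton_eq_top]
  intro h
  obtain ⟨y, hy⟩ := h.exists_right_inv
  have h1 : IsIntegral ℤ ((1 / 2 : ℚ)) := by
    rw [← isIntegral_algebraMap_iff (algebraMap ℚ ℂ).injective]
    have : algebraMap ℚ ℂ (1 / 2) = y := by
      have := congrArg Subtype.val hy
      rw [map_div₀, map_one, eq_comm, eq_div_iff (by simp), mul_comm]
      simp only [map_ofNat]
      exact this
    rw [this]
    exact y.2
  obtain ⟨m, hm⟩ := IsIntegrallyClosed.isIntegral_iff.1 h1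
  have : (m : ℚ) = 1 / 2 := hm
  field_simp at this
  norm_cast at this
  omega

theorem exists_trace_pow_eq_sum {V : Type} [AddCommGroup V] [Module ℂ V] [FiniteDimensional ℂ V]
    {n : ℕ} [NeZero n] {ω : ℂ} (hω : IsPrimitiveRoot ω n) {A : Module.End ℂ V} (hA : A ^ n = 1) :
    ∃ m : ℕ → ℕ, ∀ k : ℕ,
      LinearMap.trace ℂ V (A ^ k) = ∑ i ∈ Finset.range n, (m i : ℂ) * (ω ^ i) ^ k := by
  have hn : (n : ℂ) ≠ 0 := NeZero.ne _
  have hω0 : ω ≠ 0 := hω.ne_zero (NeZero.ne n)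
  let S (i : ℕ) : Module.End ℂ V := ∑ j ∈ Finset.range n, ((ω ^ i)⁻¹ • A) ^ j
  let P (i : ℕ) : Module.End ℂ V := (n : ℂ)⁻¹ • S i
  have hBS (i : ℕ) : ((ω ^ i)⁻¹ • A) * S i = S i := by
    have := mul_geom_sum ((ω ^ i)⁻¹ • A) n
    rw [smul_pow, hA, inv_pow, ← pow_mul, mul_comm i, pow_mul, hω.pow_eq_one] at this
    simpa [sub_mul, sub_eq_zero] using this
  have hBP (i j : ℕ) : ((ω ^ i)⁻¹ • A) ^ j * P i = P i := by
    induction j with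
    | zero => simp
    | succ j ih => rw [pow_succ, mul_assoc, mul_smul_comm, hBS, ih]
  have hAP (i k : ℕ) : A ^ k * P i = (ω ^ i) ^ k • P i := by
    have := congrArg ((ω ^ i) ^ k • ·) (hBP i k)
    simpa [smul_pow, smul_smul, hω0] using this
  have hPP (i : ℕ) : IsIdempotentElem (P i) := by
    change ((n : ℂ)⁻¹ • S i) * P i = P i
    rw [smul_mul_assoc, Finset.sum_mul, Finset.sum_congr rfl fun j _ => hBP i j]
    simp [← Nat.cast_smul_eq_nsmul ℂ, smul_smul, hn]
  have hsum : ∑ i ∈ Finset.range n, P i = 1 := by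
    simp only [P, S, ← Finset.smul_sum]
    rw [Finset.sum_comm, Finset.sum_eq_single_of_mem 0 (by simpa using NeZero.pos n)]
    · simp [← Nat.cast_smul_eq_nsmul ℂ, smul_smul, hn]
    · intro j hj hj0
      simp only [smul_pow, ← Finset.sum_smul]
      have h1 : ω⁻¹ ^ j ≠ 1 := hω.inv.pow_ne_one_of_pos_of_lt hj0 (Finset.mem_range.1 hj)
      have h2 := mul_geom_sum (ω⁻¹ ^ j) n
      rw [← pow_mul, mul_comm j, pow_mul, hω.inv.pow_eq_one, one_pow, sub_self, mul_eq_zero,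
        or_iff_right (sub_ne_zero.2 h1)] at h2
      convert zero_smul ℂ _
      rw [← h2]
      refine Finset.sum_congr rfl fun i _ => ?_
      rw [inv_pow, inv_pow, inv_pow, ← pow_mul, ← pow_mul, mul_comm]
  refine ⟨fun i => Module.finrank ℂ (LinearMap.range (P i)), fun k => ?_⟩
  rw [← mul_one (A ^ k), ← hsum, Finset.mul_sum, map_sum]
  refine Finset.sum_congr rfl fun i _ => ?_
  rw [hAP, map_smul, (LinearMap.IsIdempotentElem.isProj_range _ (hPP i)).trace, smul_eq_mul,
    mul_comm]

section CharacterTheory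

variable {G : Type} [Group G]

theorem isIrreducibleCharacter_of_norm_one [Fintype G] {V : Type} [AddCommGroup V] [Module ℂ V]
    [FiniteDimensional ℂ V] (ρ : Representation ℂ G V)
    (h : ∑ g : G, ρ.character g * ρ.character g⁻¹ = Nat.card G) :
    IsIrreducibleCharacter G ρ.character :=
  ⟨FDRep.of ρ, (FDRep.simple_iff_char_is_norm_one _).2 h, rfl⟩

theorem isIrreducibleCharacter_of_isIrreducible [Fintype G] {V : Type} [AddCommGroup V]
    [Module ℂ V] [FiniteDimensional ℂ V] (ρ : Representation ℂ G V) [ρ.IsIrreducible] :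
    IsIrreducibleCharacter G ρ.character := by
  have := invertibleOfNonzero (NeZero.ne (Nat.card G : ℂ))
  apply isIrreducibleCharacter_of_norm_one
  have h := Representation.char_orthonormal ρ ρ
  rw [if_pos ⟨Representation.Equiv.refl ρ⟩] at h
  rwa [inv_mul_eq_one₀ (NeZero.ne _), eq_comm] at h

theorem ofModule'_apply (M : Type) [AddCommGroup M] [Module ℂ M] [Module (MonoidAlgebra ℂ G) M]
    [IsScalarTower ℂ (MonoidAlgebra ℂ G) M] (g : G) (x : M) :
    Representation.ofModule' (k := ℂ) (G := G) M g x =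
      (MonoidAlgebra.single g (1 : ℂ)) • x := by
  simp [Representation.ofModule']

theorem isIrreducible_ofModule' (M : Type) [AddCommGroup M] [Module ℂ M]
    [Module (MonoidAlgebra ℂ G) M] [IsScalarTower ℂ (MonoidAlgebra ℂ G) M]
    [IsSimpleModule (MonoidAlgebra ℂ G) M] :
    (Representation.ofModule' (k := ℂ) (G := G) M).IsIrreducible := by
  have : Nontrivial M := IsSimpleModule.nontrivial (MonoidAlgebra ℂ G) M
  let N (σ : Subrepresentation (Representation.ofModule' (k := ℂ) (G := G) M)) :
      Submodule (MonoidAlgebra ℂ G) M :=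
    { σ.toSubmodule with
      smul_mem' := fun a x hx => by
        induction a using MonoidAlgebra.induction_linear with
        | zero => simp
        | add a b ha hb =>
          rw [add_smul]
          exact σ.toSubmodule.add_mem ha hb
        | single g c =>
          rw [← mul_one c, ← smul_eq_mul, ← MonoidAlgebra.smul_single, smul_assoc,
            ← ofModule'_apply]
          exact σ.toSubmodule.smul_mem _ (σ.apply_mem_toSubmodule g hx) }
  refine { exists_pair_ne := ⟨⊥, ⊤, fun h => ?_⟩, eq_bot_or_eq_top := fun σ => ?_ }
  · exact bot_ne_top (congrArg Subrepresentation.toSubmodule h : (⊥ : Submodule ℂ M) = ⊤)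
  · refine (eq_bot_or_eq_top (N σ)).imp (fun h => ?_) fun h => ?_
    · apply Subrepresentation.toSubmodule_injective
      ext x
      exact SetLike.ext_iff.1 h x
    · apply Subrepresentation.toSubmodule_injective
      ext x
      exact SetLike.ext_iff.1 h x

namespace IsIrreducibleCharacter

theorem sum_mul_inv [Fintype G] {χ ψ : G → ℂ} (hχ : IsIrreducibleCharacter G χ)
    (hψ : IsIrreducibleCharacter G ψ) :
    ∑ g : G, χ g * ψ g⁻¹ = if χ = ψ then (Nat.card G : ℂ) else 0 := by
  have := invertibleOfNonzero (NeZero.ne (Nat.card G : ℂ))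
  obtain ⟨V, hV, rfl⟩ := hχ
  obtain ⟨W, hW, rfl⟩ := hψ
  split_ifs with h
  · have h' : ∀ g, V.character g = W.character g := congrFun h
    simp only [← h']
    exact (FDRep.simple_iff_char_is_norm_one V).1 hV
  · have h1 := FDRep.char_orthonormal V W
    rw [if_neg] at h1
    · exact (mul_eq_zero.1 h1).resolve_left (inv_ne_zero (NeZero.ne _))
    · rintro ⟨i⟩
      exact h (FDRep.char_iso i)

theorem map_conj {χ : G → ℂ} (hχ : IsIrreducibleCharacter G χ) (g h : G) :
    χ (h * g * h⁻¹) = χ g := by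
  obtain ⟨V, -, rfl⟩ := hχ
  exact V.char_conj g h

theorem comp_ringHom [Fintype G] {χ : G → ℂ} (hχ : IsIrreducibleCharacter G χ) (s : ℂ →+* ℂ) :
    IsIrreducibleCharacter G (s ∘ χ) := by
  have hn := hχ.sum_mul_inv hχ
  obtain ⟨V, hV, rfl⟩ := hχ
  let b := Module.finBasis ℂ V
  let ρ : Representation ℂ G (Fin (Module.finrank ℂ V) → ℂ) :=
    ((Matrix.toLinAlgEquiv' : Matrix _ _ ℂ ≃ₐ[ℂ] _).toAlgHom.toMonoidHom.comp
      (s.mapMatrix.toMonoidHom.comp (LinearMap.toMatrixAlgEquiv b).toAlgHom.toMonoidHom)).comp V.ρ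
  have hρ : ρ.character = s ∘ fun g => V.character g := by
    ext g
    change LinearMap.trace ℂ _ (Matrix.toLin' (s.mapMatrix (LinearMap.toMatrix b b (V.ρ g)))) = _
    rw [Matrix.trace_toLin'_eq, Function.comp, FDRep.character, LinearMap.trace_eq_matrix_trace ℂ b]
    exact (AddMonoidHom.map_trace s _).symm
  rw [← hρ]
  apply isIrreducibleCharacter_of_norm_one
  rw [hρ]
  have := congrArg s hn
  simpa using this

theorem exists_eq_sum_pow {χ : G → ℂ} (hχ : IsIrreducibleCharacter G χ)
    {n : ℕ} [NeZero n] {g : G} (hg : g ^ n = 1) {ω : ℂ} (hω : IsPrimitiveRoot ω n) :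
    ∃ m : ℕ → ℕ, ∀ k : ℕ, χ (g ^ k) = ∑ i ∈ Finset.range n, (m i : ℂ) * (ω ^ i) ^ k := by
  obtain ⟨V, -, rfl⟩ := hχ
  have hA : V.ρ g ^ n = 1 := by rw [← map_pow, hg, map_one]
  obtain ⟨m, hm⟩ := exists_trace_pow_eq_sum hω hA
  exact ⟨m, fun k => by simp only [FDRep.character, map_pow, hm]⟩

end IsIrreducibleCharacter

theorem eq_zero_of_forall_sum_mul_eq_zero [Fintype G] (f : G → ℂ)
    (hf : ∀ g h, f (h * g * h⁻¹) = f g)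
    (h0 : ∀ χ, IsIrreducibleCharacter G χ → ∑ g, f g * χ g = 0) : f = 0 := by
  let z : MonoidAlgebra ℂ G := ∑ g, MonoidAlgebra.single g (f g)
  have hz : ∀ a, z * a = a * z := by
    intro a
    induction a using MonoidAlgebra.induction_linear with
    | zero => simp
    | add a b ha hb => rw [mul_add, add_mul, ha, hb]
    | single h c =>
      simp only [z, Finset.sum_mul, Finset.mul_sum, MonoidAlgebra.single_mul_single]
      refine Fintype.sum_equiv (MulAut.conj h⁻¹).toEquiv _ _ fun g => ?_
      have := hf g h⁻¹
      simp_all [mul_comm, mul_assoc]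
  have key : ∀ S : Submodule (MonoidAlgebra ℂ G) (MonoidAlgebra ℂ G),
      IsSimpleModule (MonoidAlgebra ℂ G) S → ∀ x ∈ S, z • x = 0 := by
    intro S hS x hx
    have : FiniteDimensional ℂ S := Module.Finite.trans (MonoidAlgebra ℂ G) _
    have hirr := isIrreducible_ofModule' (G := G) S
    let T : Module.End (MonoidAlgebra ℂ G) S :=
      { toFun := fun x => z • x
        map_add' := smul_add z
        map_smul' := fun a x => by simp [← mul_smul, hz] }
    obtain ⟨c, hc⟩ := (IsSimpleModule.algebraMap_end_bijective_of_isAlgClosed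
      (A := MonoidAlgebra ℂ G) (V := S) ℂ).2 T
    have hc' : ∀ y : S, c • y = z • y := fun y => DFunLike.congr_fun hc y
    have htr := h0 _ (isIrreducibleCharacter_of_isIrreducible (Representation.ofModule' (G := G) S))
    have h2 : ∑ g, f g • (Representation.ofModule' (k := ℂ) (G := G) S) g = c • LinearMap.id := by
      ext y : 1
      simp only [LinearMap.sum_apply, LinearMap.smul_apply, LinearMap.id_apply, hc', z,
        Finset.sum_smul]
      refine Finset.sum_congr rfl fun g _ => ?_
      rw [ofModule'_apply, ← smul_assoc]
      simp
    have h3 := congrArg (LinearMap.trace ℂ S) h2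
    simp only [map_sum, map_smul, smul_eq_mul, LinearMap.trace_id] at h3
    change ∑ g, f g * (Representation.ofModule' (k := ℂ) (G := G) S).character g = _ at h3
    have : Nontrivial S := IsSimpleModule.nontrivial (MonoidAlgebra ℂ G) S
    rw [htr, eq_comm, mul_eq_zero, or_iff_left
      (Nat.cast_ne_zero.2 (Module.finrank_pos (R := ℂ) (M := S)).ne')] at h3
    have := hc' ⟨x, hx⟩
    rw [h3, zero_smul] at this
    exact congrArg Subtype.val this.symm
  have hz0 : z • (1 : MonoidAlgebra ℂ G) = 0 := by
    have h1 : (1 : MonoidAlgebra ℂ G) ∈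
        sSup {m : Submodule (MonoidAlgebra ℂ G) (MonoidAlgebra ℂ G) |
          IsSimpleModule (MonoidAlgebra ℂ G) m} := by
      rw [IsSemisimpleModule.sSup_simples_eq_top]; trivial
    rw [sSup_eq_iSup'] at h1
    refine Submodule.iSup_induction _ (motive := fun x => z • x = 0) h1
      (fun i x hx => key i i.2 x hx) (smul_zero z) fun x y hx hy => ?_
    rw [smul_add, hx, hy, add_zero]
  ext g
  have h4 : z.coeff g = 0 := by
    rw [smul_eq_mul, mul_one] at hz0
    rw [hz0]; rfl
  simpa [z, Finsupp.single_apply] using h4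

namespace IsIrreducibleCharacter

theorem map_isConj {χ : G → ℂ} (hχ : IsIrreducibleCharacter G χ) {g h : G} (hgh : IsConj g h) :
    χ g = χ h := by
  obtain ⟨c, rfl⟩ := isConj_iff.1 hgh
  exact (hχ.map_conj g c).symm

theorem map_out_mk {χ : G → ℂ} (hχ : IsIrreducibleCharacter G χ) (g : G) :
    χ (Quotient.out (ConjClasses.mk g)) = χ g :=
  hχ.map_isConj (ConjClasses.mk_eq_mk_iff_isConj.1 (Quotient.out_eq (ConjClasses.mk g)))

theorem map_inv_out_mk {χ : G → ℂ} (hχ : IsIrreducibleCharacter G χ) (g : G) :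
    χ (Quotient.out (ConjClasses.mk g))⁻¹ = χ g⁻¹ := by
  refine hχ.map_isConj ?_
  obtain ⟨c, hc⟩ := isConj_iff.1
    (ConjClasses.mk_eq_mk_iff_isConj.1 (Quotient.out_eq (ConjClasses.mk g)))
  exact isConj_iff.2 ⟨c, by rw [← conj_inv, hc]⟩

theorem isIntegral [Fintype G] {χ : G → ℂ} (hχ : IsIrreducibleCharacter G χ) (g : G) :
    IsIntegral ℤ (χ g) := by
  have hω := Complex.isPrimitiveRoot_exp (Fintype.card G) Fintype.card_ne_zero
  obtain ⟨m, hm⟩ := hχ.exists_eq_sum_pow (pow_card_eq_one (x := g)) hω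
  have h1 := hm 1
  rw [pow_one] at h1
  rw [h1]
  refine IsIntegral.sum _ fun i _ => IsIntegral.mul ?_ (IsIntegral.pow (IsIntegral.pow ?_ _) _)
  · exact_mod_cast isIntegral_algebraMap (R := ℤ) (A := ℂ) (x := (m i : ℤ))
  · exact hω.isIntegral Fintype.card_pos

end IsIrreducibleCharacter

theorem finite_setOf_isIrreducibleCharacter [Fintype G] :
    {χ | IsIrreducibleCharacter G χ}.Finite := by
  have : LinearIndependent ℂ ((↑) : {χ | IsIrreducibleCharacter G χ} → G → ℂ) := by
    rw [linearIndependent_iff']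
    intro s c h χ hχ
    have h1 : ∑ g, (∑ i ∈ s, c i • (i : G → ℂ)) g * χ.1 g⁻¹ = 0 := by
      simp only [h, Pi.zero_apply, zero_mul, Finset.sum_const_zero]
    simp only [Finset.sum_apply, Pi.smul_apply, smul_eq_mul, Finset.sum_mul] at h1
    rw [Finset.sum_comm] at h1
    simp only [mul_assoc, ← Finset.mul_sum] at h1
    rw [Finset.sum_congr rfl fun i _ => by rw [i.2.sum_mul_inv χ.2],
      Finset.sum_eq_single_of_mem χ hχ, if_pos rfl, mul_eq_zero] at h1
    · exact h1.resolve_right (NeZero.ne _)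
    · intro i _ hi
      rw [if_neg (fun h => hi (Subtype.ext h)), mul_zero]
  exact this.setFinite

variable (G) in
/-- The number of elements of a conjugacy class, as an algebraic integer. -/
def classSize [Fintype G] (c : ConjClasses G) : integralClosure ℤ ℂ :=
  ((Finset.univ.filter fun g : G => ConjClasses.mk g = c).card : ℕ)

theorem sum_conjClasses [Fintype G] (f : ConjClasses G → ℂ) :
    ∑ c, (classSize G c : ℂ) * f c = ∑ g, f (ConjClasses.mk g) := by
  rw [← Finset.sum_fiberwise (M := ℂ) (Finset.univ : Finset G) ConjClasses.mk]
  refine Finset.sum_congr rfl fun c _ => ?_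
  rw [Finset.sum_congr rfl fun g hg => congrArg f (Finset.mem_filter.1 hg).2]
  simp [classSize]

theorem classSize_ne_zero [Fintype G] (c : ConjClasses G) : (classSize G c : ℂ) ≠ 0 := by
  obtain ⟨g, rfl⟩ := ConjClasses.exists_rep c
  have : (Finset.univ.filter fun h : G => ConjClasses.mk h = ConjClasses.mk g).card ≠ 0 :=
    Finset.card_ne_zero_of_mem (a := g) (by simp)
  exact Nat.cast_ne_zero.2 this

variable (G) in
/-- The character table, with entries in the ring of algebraic integers. -/
def charTable [Fintype G] :
    Matrix {χ | IsIrreducibleCharacter G χ} (ConjClasses G) (integralClosure ℤ ℂ) :=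
  fun χ c => ⟨χ.1 (Quotient.out c), χ.2.isIntegral _⟩

variable (G) in
/-- The inverse of the character table, up to the scalar `|G|`. -/
def charTableAdj [Fintype G] :
    Matrix (ConjClasses G) {χ | IsIrreducibleCharacter G χ} (integralClosure ℤ ℂ) :=
  fun c χ => classSize G c * ⟨χ.1 (Quotient.out c)⁻¹, χ.2.isIntegral _⟩

theorem charTable_mul_charTableAdj [Fintype G] :
    charTable G * charTableAdj G = (Fintype.card G : Matrix _ _ (integralClosure ℤ ℂ)) := by
  ext χ ψ
  rw [Matrix.mul_apply]
  have h1 := χ.2.sum_mul_inv ψ.2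
  have h2 := sum_conjClasses fun c : ConjClasses G =>
    χ.1 (Quotient.out c) * ψ.1 (Quotient.out c)⁻¹
  simp only [χ.2.map_out_mk, ψ.2.map_inv_out_mk, h1] at h2
  rw [AddSubmonoidClass.coe_finsetSum]
  refine (Finset.sum_congr rfl fun c _ => ?_).trans (h2.trans ?_)
  · change χ.1 (Quotient.out c) * ((classSize G c : ℂ) * ψ.1 (Quotient.out c)⁻¹) = _
    ring
  · rw [Matrix.natCast_apply]
    by_cases h : χ = ψ
    · simp [h]
    · rw [if_neg h, if_neg fun h' => h (Subtype.ext h')]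
      simp

theorem charTableAdj_mul_charTable [Fintype G] [Fintype {χ | IsIrreducibleCharacter G χ}] :
    charTableAdj G * charTable G = (Fintype.card G : Matrix _ _ (integralClosure ℤ ℂ)) := by
  rw [← sub_eq_zero]
  set D := charTableAdj G * charTable G - (Fintype.card G : Matrix _ _ (integralClosure ℤ ℂ))
    with hD
  have h0 : charTable G * D = 0 := by
    rw [hD, Matrix.mul_sub, ← Matrix.mul_assoc, charTable_mul_charTableAdj, sub_eq_zero]
    ext χ c
    rw [← Matrix.diagonal_natCast, ← Matrix.diagonal_natCast, Matrix.diagonal_mul,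
      Matrix.mul_diagonal, mul_comm]
  ext c d
  have h1 := eq_zero_of_forall_sum_mul_eq_zero
    (fun g : G => (D (ConjClasses.mk g) d : ℂ) / classSize G (ConjClasses.mk g)) (fun g h => by
      have : ConjClasses.mk (h * g * h⁻¹) = ConjClasses.mk g :=
        ConjClasses.mk_eq_mk_iff_isConj.2 (isConj_iff.2 ⟨h, rfl⟩).symm
      simp only [this]) (fun χ hχ => by
      have h2 := congrArg Subtype.val (congrFun (congrFun h0 ⟨χ, hχ⟩) d)
      have h3 := sum_conjClasses fun c : ConjClasses G =>
        (D c d : ℂ) / classSize G c * χ (Quotient.out c)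
      simp only [hχ.map_out_mk] at h3
      rw [← h3]
      rw [Matrix.mul_apply, AddSubmonoidClass.coe_finsetSum] at h2
      refine (Finset.sum_congr rfl fun c _ => ?_).trans h2
      have := classSize_ne_zero c
      change _ = χ (Quotient.out c) * (D c d : ℂ)
      field_simp)
  obtain ⟨g, rfl⟩ := ConjClasses.exists_rep c
  exact (div_eq_zero_iff.1 (congrFun h1 g)).resolve_right (classSize_ne_zero _)

theorem pow_mul_self_eq [Fintype G] {k : ℕ} (hk : k * k ≡ 1 [MOD Fintype.card G]) (g : G) :
    (g ^ k) ^ k = g := by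
  rw [← pow_mul]
  nth_rw 2 [← pow_one g]
  exact pow_eq_pow_iff_modEq.2 (hk.of_dvd (orderOf_dvd_card))

theorem coprime_of_mul_self_modEq_one {k n : ℕ} (hk : k * k ≡ 1 [MOD n]) : k.Coprime n :=
  Nat.Coprime.coprime_mul_left (m := k) (by
    rw [Nat.Coprime, hk.gcd_eq, Nat.gcd_one_left])

theorem exists_coprime_of_ringHom {n : ℕ} [NeZero n] (s : ℂ →+* ℂ) :
    ∃ k : ℕ, k.Coprime n ∧ ∀ z : ℂ, z ^ n = 1 → s z = z ^ k := by
  have hω := Complex.isPrimitiveRoot_exp n (NeZero.ne n)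
  obtain ⟨k, -, hk⟩ := hω.eq_pow_of_pow_eq_one (ξ := s (Complex.exp (2 * Real.pi * Complex.I / n)))
    (by rw [← map_pow, hω.pow_eq_one, map_one])
  refine ⟨k, ?_, fun z hz => ?_⟩
  · exact (hω.pow_iff_coprime (NeZero.pos n) k).1 (hk ▸ hω.map_of_injective s.injective)
  · obtain ⟨j, -, rfl⟩ := hω.eq_pow_of_pow_eq_one hz
    rw [map_pow, ← hk, ← pow_mul, ← pow_mul, mul_comm k]

namespace IsIrreducibleCharacter

theorem map_ringHom {χ : G → ℂ} (hχ : IsIrreducibleCharacter G χ) {n k : ℕ} [NeZero n]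
    {s : ℂ →+* ℂ} (hs : ∀ z : ℂ, z ^ n = 1 → s z = z ^ k) {g : G} (hg : g ^ n = 1) :
    s (χ g) = χ (g ^ k) := by
  have hω := Complex.isPrimitiveRoot_exp n (NeZero.ne n)
  obtain ⟨m, hm⟩ := hχ.exists_eq_sum_pow hg hω
  rw [hm, ← pow_one g, hm, map_sum]
  refine Finset.sum_congr rfl fun i _ => ?_
  rw [map_mul, map_natCast, pow_one, hs _ (by rw [← pow_mul, mul_comm i, pow_mul, hω.pow_eq_one,
    one_pow])]

theorem comp_pow [Fintype G] {χ : G → ℂ} (hχ : IsIrreducibleCharacter G χ) {k : ℕ}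
    (hk : k.Coprime (Fintype.card G)) : IsIrreducibleCharacter G fun g => χ (g ^ k) := by
  obtain ⟨s, hs⟩ := exists_ringHom_pow hk
  convert hχ.comp_ringHom s using 1
  ext g
  exact (hχ.map_ringHom hs pow_card_eq_one).symm

end IsIrreducibleCharacter

theorem ncard_fixed_eq_and_separates [Fintype G] (hG : Odd (Fintype.card G)) {k : ℕ}
    (hk : k * k ≡ 1 [MOD Fintype.card G]) :
    {χ | IsIrreducibleCharacter G χ ∧ ∀ g, χ (g ^ k) = χ g}.ncard =
        {c : ConjClasses G | ∃ g, c = ConjClasses.mk g ∧ IsConj g (g ^ k)}.ncard ∧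
      ∀ χ ψ, IsIrreducibleCharacter G χ → IsIrreducibleCharacter G ψ →
        (∀ g, χ (g ^ k) = χ g) → (∀ g, ψ (g ^ k) = ψ g) →
        (∀ g, IsConj g (g ^ k) → χ g = ψ g) → χ = ψ := by
  have := (finite_setOf_isIrreducibleCharacter (G := G)).fintype
  have := nontrivial_integralClosure_quotient_two
  let π := Ideal.Quotient.mk (Ideal.span {(2 : integralClosure ℤ ℂ)})
  have h2 : (2 : integralClosure ℤ ℂ ⧸ Ideal.span {(2 : integralClosure ℤ ℂ)}) = 0 := by
    rw [← map_ofNat π 2]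
    exact Ideal.Quotient.eq_zero_iff_mem.2 (Ideal.mem_span_singleton_self _)
  have hn : (Fintype.card G : integralClosure ℤ ℂ ⧸ Ideal.span {(2 : integralClosure ℤ ℂ)}) = 1 := by
    obtain ⟨m, hm⟩ := hG
    rw [hm]
    push_cast
    rw [h2, zero_mul, zero_add]
  have hnπ {J : Type} [Fintype J] [DecidableEq J] :
      (Fintype.card G : Matrix J J (integralClosure ℤ ℂ)).map π = 1 := by
    ext i j
    rw [Matrix.map_apply, Matrix.natCast_apply, Matrix.one_apply, map_natCast]
    split_ifs
    · exact hn
    · exact Nat.cast_zero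
  have hMN : (charTable G).map π * (charTableAdj G).map π = 1 := by
    rw [← Matrix.map_mul, charTable_mul_charTableAdj, hnπ]
  have hNM : (charTableAdj G).map π * (charTable G).map π = 1 := by
    rw [← Matrix.map_mul, charTableAdj_mul_charTable, hnπ]
  let t (χ : {χ | IsIrreducibleCharacter G χ}) : {χ | IsIrreducibleCharacter G χ} :=
    ⟨fun g => χ.1 (g ^ k), χ.2.comp_pow (coprime_of_mul_self_modEq_one hk)⟩
  have ht : Function.Involutive t := fun χ => Subtype.ext (funext fun g => by
    simp only [t, pow_mul_self_eq hk])
  let u : ConjClasses G → ConjClasses G := Quotient.map (· ^ k) fun _ _ h => h.pow k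
  have hu_mk (g : G) : u (ConjClasses.mk g) = ConjClasses.mk (g ^ k) := rfl
  have hu : Function.Involutive u := fun c => by
    obtain ⟨g, rfl⟩ := ConjClasses.exists_rep c
    rw [hu_mk, hu_mk, pow_mul_self_eq hk]
  have htu (χ c) : charTable G (t χ) c = charTable G χ (u c) := by
    obtain ⟨g, rfl⟩ := ConjClasses.exists_rep c
    apply Subtype.ext
    change (t χ).1 (Quotient.out _) = χ.1 (Quotient.out _)
    rw [hu_mk, χ.2.map_out_mk, (t χ).2.map_out_mk]
  have ht_iff (χ) : t χ = χ ↔ ∀ g, χ.1 (g ^ k) = χ.1 g := by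
    rw [Subtype.ext_iff, funext_iff]
  have hu_iff (g : G) : u (ConjClasses.mk g) = ConjClasses.mk g ↔ IsConj g (g ^ k) := by
    rw [hu_mk, ConjClasses.mk_eq_mk_iff_isConj, isConj_comm]
  obtain ⟨hcard, hsep⟩ := card_fixed_eq_and_separates h2 hMN hNM ht hu
    (fun χ c => congrArg π (htu χ c))
  constructor
  · rw [← Nat.card_coe_set_eq, ← Nat.card_coe_set_eq]
    rw [← Nat.card_eq_fintype_card, ← Nat.card_eq_fintype_card] at hcard
    refine (Nat.card_congr ?_).trans (hcard.trans (Nat.card_congr ?_))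
    · exact (Equiv.subtypeSubtypeEquivSubtypeInter _ _).symm.trans
        (Equiv.subtypeEquivRight ht_iff).symm
    · refine Equiv.subtypeEquivRight fun c => ?_
      obtain ⟨g, rfl⟩ := ConjClasses.exists_rep c
      constructor
      · exact fun h => ⟨g, rfl, (hu_iff g).1 h⟩
      · rintro ⟨h, hh, hc⟩
        rw [hh]
        exact (hu_iff h).2 hc
  · intro χ ψ hχ hψ hχk hψk h
    refine congrArg Subtype.val (hsep ⟨χ, hχ⟩ ⟨ψ, hψ⟩ ((ht_iff _).2 hχk) ((ht_iff _).2 hψk) ?_)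
    intro c hc
    obtain ⟨g, rfl⟩ := ConjClasses.exists_rep c
    refine congrArg π (Subtype.ext ?_)
    change χ (Quotient.out _) = ψ (Quotient.out _)
    rw [hχ.map_out_mk, hψ.map_out_mk]
    exact h g ((hu_iff g).1 hc)

theorem exists_modEq_one_and_dvd_add_one {u v : ℕ} (huv : u.Coprime v) (hv : v ≠ 0) :
    ∃ k, k ≡ 1 [MOD u] ∧ v ∣ k + 1 := by
  obtain ⟨k, hk1, hk2⟩ := Nat.chineseRemainder huv 1 (v - 1)
  refine ⟨k, hk1, ?_⟩
  have := hk2.add_right 1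
  rw [Nat.sub_add_cancel (Nat.one_le_iff_ne_zero.2 hv)] at this
  exact (this.dvd_iff dvd_rfl).2 dvd_rfl

theorem mul_self_modEq_one {u v k : ℕ} (huv : u.Coprime v) (hu : k ≡ 1 [MOD u])
    (hv : v ∣ k + 1) : k * k ≡ 1 [MOD u * v] := by
  refine (Nat.modEq_and_modEq_iff_modEq_mul huv).1 ⟨hu.mul hu, Nat.ModEq.symm ?_⟩
  rw [Nat.modEq_iff_dvd]
  have h : (v : ℤ) ∣ k + 1 := by exact_mod_cast hv
  exact (h.mul_right (k - 1)).trans (dvd_of_eq (by push_cast; ring))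

theorem pow_eq_self_of_isConj [Fintype G] (hG : Odd (Fintype.card G)) {k : ℕ}
    (hk : k * k ≡ 1 [MOD Fintype.card G]) {g : G} (h : IsConj g (g ^ k)) : g ^ k = g := by
  obtain ⟨x, hx⟩ := isConj_iff.1 h
  have h2 : Commute (x ^ 2) g := by
    have : x * (x * g * x⁻¹) * x⁻¹ = g := by
      rw [hx, ← conj_pow, hx, pow_mul_self_eq hk]
    rw [commute_iff_eq]
    nth_rw 2 [← this]
    simp only [sq, mul_assoc, inv_mul_cancel_left, inv_mul_cancel, mul_one]
  obtain ⟨m, hm⟩ := hG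
  have h3 : (x ^ 2) ^ (m + 1) = x := by
    rw [← pow_mul, show 2 * (m + 1) = Fintype.card G + 1 by omega, pow_succ, pow_card_eq_one,
      one_mul]
  have h4 : Commute x g := h3 ▸ h2.pow_left (m + 1)
  rw [← hx, h4.eq, mul_inv_cancel_right]

theorem isConj_pow_iff [Fintype G] (hG : Odd (Fintype.card G)) {u v k : ℕ}
    (huv : u.Coprime v) (hn : u * v = Fintype.card G) (hu : k ≡ 1 [MOD u]) (hv : v ∣ k + 1) (g : G) :
    IsConj g (g ^ k) ↔ orderOf g ∣ u := by
  constructor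
  · intro h
    have h1 := pow_eq_self_of_isConj hG (hn ▸ mul_self_modEq_one huv hu hv) h
    nth_rw 2 [← pow_one g] at h1
    rw [pow_eq_pow_iff_modEq] at h1
    have hd : orderOf g ∣ u * v := hn ▸ orderOf_dvd_card
    refine Nat.Coprime.dvd_of_dvd_mul_right ?_ hd
    have h2 : Nat.gcd (orderOf g) v ∣ 2 := by
      have h3 := (h1.of_dvd (Nat.gcd_dvd_left (orderOf g) v)).add_right 1
      exact (h3.dvd_iff dvd_rfl).1 ((Nat.gcd_dvd_right _ _).trans hv)
    refine ((Nat.dvd_prime Nat.prime_two).1 h2).resolve_right fun h3 => ?_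
    have h4 : 2 ∣ Fintype.card G := (h3 ▸ Nat.gcd_dvd_left (orderOf g) v).trans orderOf_dvd_card
    exact Nat.not_even_iff_odd.2 hG (even_iff_two_dvd.2 h4)
  · intro h
    have : g ^ k = g := by
      nth_rw 2 [← pow_one g]
      exact pow_eq_pow_iff_modEq.2 (hu.of_dvd h)
    rw [this]

namespace IsIrreducibleCharacter

theorem map_pow_of_mem_Qfield [Fintype G] {χ : G → ℂ} (hχ : IsIrreducibleCharacter G χ) {p : ℕ}
    (hp : p.Prime) {g : G} (hg : χ g ∈ Qfield p) {k : ℕ} (hk : k.Coprime (Fintype.card G))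
    (hk1 : k ≡ 1 [MOD ordProj[p] (Fintype.card G)]) : χ (g ^ k) = χ g := by
  obtain ⟨b, hb⟩ := exists_forall_ringHom_fixes hg
  have hn := Nat.ordProj_mul_ordCompl_eq_self (Fintype.card G) p
  have hcop := Nat.coprime_ordCompl hp (Fintype.card_ne_zero (α := G))
  have hm : ordCompl[p] (Fintype.card G) ∣ Fintype.card G := Nat.ordCompl_dvd _ p
  set m := ordCompl[p] (Fintype.card G)
  set a := (Fintype.card G).factorization p
  obtain ⟨k', h1, h2⟩ := Nat.chineseRemainder (hcop.pow_left (max a b)) 1 k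
  have hN : p ^ max a b * m ≠ 0 := mul_ne_zero (pow_ne_zero _ hp.ne_zero)
    (fun h => Fintype.card_ne_zero (α := G) (by rw [← hn, h, mul_zero]))
  have : NeZero (p ^ max a b * m) := ⟨hN⟩
  have hk' : k'.Coprime (p ^ max a b * m) := Nat.Coprime.mul_right
    (by rw [Nat.Coprime, h1.gcd_eq, Nat.gcd_one_left])
    (by rw [Nat.Coprime, h2.gcd_eq]; exact hk.coprime_dvd_right hm)
  obtain ⟨s, hs⟩ := exists_ringHom_pow hk'
  have hdvd : Fintype.card G ∣ p ^ max a b * m := by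
    rw [← hn]
    exact mul_dvd_mul_right (pow_dvd_pow p (le_max_left a b)) m
  have hkk' : k' ≡ k [MOD Fintype.card G] := by
    rw [← hn]
    exact (Nat.modEq_and_modEq_iff_modEq_mul (hcop.pow_left a)).1
      ⟨(h1.of_dvd (pow_dvd_pow p (le_max_left a b))).trans hk1.symm, h2⟩
  have h3 := hb _ (le_max_right a b) s fun z hz => by
    rw [hs z (by rw [pow_mul, hz, one_pow])]
    exact (pow_eq_pow_of_modEq h1 hz).trans (pow_one z)
  rw [hχ.map_ringHom hs (orderOf_dvd_iff_pow_eq_one.1 (orderOf_dvd_card.trans hdvd))] at h3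
  rw [← h3]
  congr 1
  exact pow_eq_pow_iff_modEq.2 (hkk'.symm.of_dvd orderOf_dvd_card)

theorem forall_mem_Qfield [Fintype G] (hG : Odd (Fintype.card G)) {χ : G → ℂ}
    (hχ : IsIrreducibleCharacter G χ) {p : ℕ} (hp : p.Prime) {k : ℕ}
    (hu : k ≡ 1 [MOD ordProj[p] (Fintype.card G)]) (hv : ordCompl[p] (Fintype.card G) ∣ k + 1)
    (h : ∀ g, χ (g ^ k) = χ g) (g : G) : χ g ∈ Qfield p := by
  have hn := Nat.ordProj_mul_ordCompl_eq_self (Fintype.card G) p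
  have hcop : (ordProj[p] (Fintype.card G)).Coprime _ :=
    (Nat.coprime_ordCompl hp (Fintype.card_ne_zero (α := G))).pow_left _
  refine mem_of_forall_ringHom _ ((hχ.isIntegral g).tower_top.isAlgebraic) fun s hs => ?_
  obtain ⟨l, hl, hsl⟩ := exists_coprime_of_ringHom (n := Fintype.card G) s
  have hl1 : l ≡ 1 [MOD ordProj[p] (Fintype.card G)] := by
    obtain ⟨η, hη⟩ : ∃ η : ℂ, IsPrimitiveRoot η (ordProj[p] (Fintype.card G)) :=
      ⟨_, Complex.isPrimitiveRoot_exp _ (Nat.ordProj_pos _ _).ne'⟩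
    have h1 := hs η (Subfield.subset_closure ⟨(Fintype.card G).factorization p + 1,
      Nat.succ_pos _, by rw [pow_succ, pow_mul, hη.pow_eq_one, one_pow]⟩)
    rw [hsl η (orderOf_dvd_iff_pow_eq_one.1 (hη.eq_orderOf ▸ Nat.ordProj_dvd _ _))] at h1
    have hη0 : η ≠ 0 := hη.ne_zero (Nat.ordProj_pos _ _).ne'
    have h2 : Units.mk0 η hη0 ^ l = Units.mk0 η hη0 ^ 1 := Units.ext (by simpa using h1)
    rwa [pow_eq_pow_iff_modEq, ← orderOf_units, Units.val_mk0, ← hη.eq_orderOf] at h2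
  rw [hχ.map_ringHom hsl pow_card_eq_one]
  have hsep := (ncard_fixed_eq_and_separates hG (hn ▸ mul_self_modEq_one hcop hu hv)).2
    (fun g => χ (g ^ l)) χ (hχ.comp_pow hl) hχ (fun g => by
      rw [← pow_mul, mul_comm, pow_mul, h]) h fun g hg => by
      have := (isConj_pow_iff hG hcop hn hu hv g).1 hg
      congr 1
      nth_rw 2 [← pow_one g]
      exact pow_eq_pow_iff_modEq.2 (hl1.of_dvd this)
  exact congrFun hsep g

end IsIrreducibleCharacter

theorem isIrreducibleCharacter_one [Fintype G] : IsIrreducibleCharacter G fun _ => 1 := by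
  have h : (Representation.trivial ℂ G ℂ).character = fun _ => 1 := by
    ext g
    simp [Representation.character, Representation.trivial]
  rw [← h]
  apply isIrreducibleCharacter_of_norm_one
  simp [h]

theorem ncard_primePowerOrder_eq [Fintype G] (hG : Odd (Fintype.card G)) {p : ℕ} (hp : p.Prime) :
    {c : ConjClasses G | ∃ g, c = ConjClasses.mk g ∧ ∃ j, orderOf g = p ^ j}.ncard =
      {χ | IsIrreducibleCharacter G χ ∧ ∀ g, χ g ∈ Qfield p}.ncard := by
  have hn := Nat.ordProj_mul_ordCompl_eq_self (Fintype.card G) p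
  have hcop : (ordProj[p] (Fintype.card G)).Coprime _ :=
    (Nat.coprime_ordCompl hp (Fintype.card_ne_zero (α := G))).pow_left _
  obtain ⟨k, hu, hv⟩ := exists_modEq_one_and_dvd_add_one hcop
    (Nat.ordCompl_pos p (Fintype.card_ne_zero (α := G))).ne'
  have hk := hn ▸ mul_self_modEq_one hcop hu hv
  refine Eq.trans ?_ ((ncard_fixed_eq_and_separates hG hk).1.symm.trans ?_)
  · congr 1
    ext c
    refine exists_congr fun g => and_congr_right fun _ => ?_
    rw [isConj_pow_iff hG hcop hn hu hv, Nat.dvd_prime_pow hp]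
    refine ⟨fun ⟨j, hj⟩ => ⟨j, ?_, hj⟩, fun ⟨j, _, hj⟩ => ⟨j, hj⟩⟩
    exact (hp.pow_dvd_iff_le_factorization Fintype.card_ne_zero).1 (hj ▸ orderOf_dvd_card)
  · congr 1
    ext χ
    refine and_congr_right fun hχ => ⟨fun h => hχ.forall_mem_Qfield hG hp hu hv h, fun h g => ?_⟩
    exact hχ.map_pow_of_mem_Qfield hp (h g) (coprime_of_mul_self_modEq_one hk) hu

theorem eq_one_of_forall_mem_Qfield [Fintype G] (hG : Odd (Fintype.card G)) {p q : ℕ}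
    (hp : p.Prime) (hq : q.Prime) (hpq : p ≠ q) {χ : G → ℂ} (hχ : IsIrreducibleCharacter G χ)
    (h₁ : ∀ g, χ g ∈ Qfield p) (h₂ : ∀ g, χ g ∈ Qfield q) : χ = fun _ => 1 := by
  have hn := Nat.ordProj_mul_ordCompl_eq_self (Fintype.card G) p
  have hcop : (ordProj[p] (Fintype.card G)).Coprime _ :=
    (Nat.coprime_ordCompl hp (Fintype.card_ne_zero (α := G))).pow_left _
  obtain ⟨k, hu, hv⟩ := exists_modEq_one_and_dvd_add_one hcop
    (Nat.ordCompl_pos p (Fintype.card_ne_zero (α := G))).ne'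
  obtain ⟨l, hu', hv'⟩ := exists_modEq_one_and_dvd_add_one hcop.symm (Nat.ordProj_pos _ p).ne'
  have hk : k * k ≡ 1 [MOD Fintype.card G] := hn ▸ mul_self_modEq_one hcop hu hv
  have hl : l * l ≡ 1 [MOD Fintype.card G] := by
    have := mul_self_modEq_one hcop.symm hu' hv'
    rwa [mul_comm (ordCompl[p] _), hn] at this
  have hq_dvd : ordProj[q] (Fintype.card G) ∣ ordCompl[p] (Fintype.card G) := by
    refine Nat.Coprime.dvd_of_dvd_mul_left
      (Nat.Coprime.pow _ _ ((Nat.coprime_primes hq hp).2 hpq.symm))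
      (m := ordProj[p] (Fintype.card G)) ?_
    rw [hn]
    exact Nat.ordProj_dvd _ _
  have hkl : Fintype.card G ∣ k * l + 1 := by
    rw [← hn]
    refine hcop.mul_dvd_of_dvd_of_dvd ?_ ?_
    · exact (((hu.mul_right l).add_right 1).dvd_iff dvd_rfl).2 (by rwa [one_mul])
    · exact (((hu'.mul_left k).add_right 1).dvd_iff dvd_rfl).2 (by rwa [mul_one])
  have hfix (g : G) : χ (g ^ (k * l)) = χ g := by
    rw [pow_mul, hχ.map_pow_of_mem_Qfield hq (h₂ _) (coprime_of_mul_self_modEq_one hl)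
      (hu'.of_dvd hq_dvd), hχ.map_pow_of_mem_Qfield hp (h₁ _) (coprime_of_mul_self_modEq_one hk) hu]
  have hcard := (ncard_fixed_eq_and_separates hG (k := k * l) (by
    rw [mul_mul_mul_comm]
    exact hk.mul hl)).1
  have hclass : {c : ConjClasses G | ∃ g, c = ConjClasses.mk g ∧ IsConj g (g ^ (k * l))} =
      {ConjClasses.mk 1} := by
    ext c
    constructor
    · rintro ⟨g, rfl, hg⟩
      rw [isConj_pow_iff hG (Nat.coprime_one_left _) (one_mul _) Nat.modEq_one hkl, Nat.dvd_one,
        orderOf_eq_one_iff] at hg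
      rw [hg]; rfl
    · rintro rfl
      exact ⟨1, rfl, by rw [one_pow]⟩
  rw [hclass, Set.ncard_singleton, Set.ncard_eq_one] at hcard
  obtain ⟨ψ, hψ⟩ := hcard
  have h3 : χ ∈ ({ψ} : Set (G → ℂ)) := hψ ▸ ⟨hχ, hfix⟩
  have h4 : (fun _ => 1) ∈ ({ψ} : Set (G → ℂ)) := hψ ▸ ⟨isIrreducibleCharacter_one, fun _ => rfl⟩
  exact Eq.trans h3 h4.symm

theorem nonempty_iUnion_equiv_sigma_sum {ι γ : Type*} [Nonempty ι] {C : ι → Set γ} {c : γ}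
    (hc : ∀ i, c ∈ C i) (hC : ∀ i j, i ≠ j → C i ∩ C j ⊆ {c}) :
    Nonempty ((⋃ i, C i : Set γ) ≃ (Σ i, (C i \ {c} : Set γ)) ⊕ PUnit.{1}) := by
  have h : ⋃ i, C i = insert c (⋃ i, C i \ {c}) := by
    rw [← Set.iUnion_sdiff, Set.insert_sdiff_singleton, Set.insert_eq_of_mem]
    exact Set.mem_iUnion.2 ⟨Classical.arbitrary ι, hc _⟩
  rw [h]
  refine ⟨(Equiv.Set.insert (by simp)).trans (Equiv.sumCongr
    (Set.unionEqSigmaOfDisjoint fun i j hij => Set.disjoint_left.2 ?_) Equiv.punitEquivPUnit)⟩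
  exact fun x hx hx' => hx.2 (hC i j hij ⟨hx.1, hx'.1⟩)

theorem ncard_iUnion_eq_of_inter_subset_singleton {ι α β : Type*} [Nonempty ι] {A : ι → Set α}
    {B : ι → Set β} {a : α} {b : β} (ha : ∀ i, a ∈ A i) (hb : ∀ i, b ∈ B i)
    (hA : ∀ i j, i ≠ j → A i ∩ A j ⊆ {a}) (hB : ∀ i j, i ≠ j → B i ∩ B j ⊆ {b})
    (hAf : ∀ i, (A i).Finite) (hBf : ∀ i, (B i).Finite)
    (h : ∀ i, (A i).ncard = (B i).ncard) : (⋃ i, A i).ncard = (⋃ i, B i).ncard := by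
  obtain ⟨e⟩ := nonempty_iUnion_equiv_sigma_sum ha hA
  obtain ⟨f⟩ := nonempty_iUnion_equiv_sigma_sum hb hB
  have hi (i) : Nonempty ((A i \ {a} : Set α) ≃ (B i \ {b} : Set β)) := by
    have := ((hAf i).subset (Set.sdiff_subset (t := {a}))).to_subtype
    have := ((hBf i).subset (Set.sdiff_subset (t := {b}))).to_subtype
    rw [← Finite.card_eq, Nat.card_coe_set_eq, Nat.card_coe_set_eq,
      Set.ncard_sdiff_singleton_of_mem (ha i),
      Set.ncard_sdiff_singleton_of_mem (hb i), h]
  rw [← Nat.card_coe_set_eq, ← Nat.card_coe_set_eq]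
  exact Nat.card_congr (e.trans (((Equiv.sigmaCongrRight fun i => (hi i).some).sumCongr
    (Equiv.refl _)).trans f.symm))

theorem primePowerClasses_eq_iUnion :
    PrimePowerClasses G = ⋃ p : Nat.Primes,
      {c : ConjClasses G | ∃ g, c = ConjClasses.mk g ∧ ∃ j, orderOf g = (p : ℕ) ^ j} := by
  ext c
  simp only [PrimePowerClasses, Set.mem_ofPred_eq, Set.mem_iUnion]
  constructor
  · rintro ⟨g, hg, p, j, hp, hj⟩
    exact ⟨⟨p, hp⟩, g, hg, j, hj⟩
  · rintro ⟨p, g, hg, j, hj⟩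
    exact ⟨g, hg, p, j, p.2, hj⟩

theorem QppValuedIrrChars_eq_iUnion :
    QppValuedIrrChars G = ⋃ p : Nat.Primes,
      {χ | IsIrreducibleCharacter G χ ∧ ∀ g, χ g ∈ Qfield p} := by
  ext χ
  simp only [QppValuedIrrChars, Set.mem_ofPred_eq, Set.mem_iUnion]
  constructor
  · rintro ⟨hχ, p, hp, h⟩
    exact ⟨⟨p, hp⟩, hχ, h⟩
  · rintro ⟨p, hχ, h⟩
    exact ⟨hχ, p, p.2, h⟩

end CharacterTheory

/-- If `G` is a finite group of odd order, then the number of conjugacy classes of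
elements of prime power order equals the number of `Q_pp`-valued irreducible
characters. -/
theorem primePowerClasses_eq_QppValuedIrrChars_of_odd (G : Type) [Group G] [Fintype G]
    (hG : Odd (Fintype.card G)) :
    (PrimePowerClasses G).ncard = (QppValuedIrrChars G).ncard := by
  rw [primePowerClasses_eq_iUnion, QppValuedIrrChars_eq_iUnion]
  have : Nonempty Nat.Primes := ⟨⟨2, Nat.prime_two⟩⟩
  refine ncard_iUnion_eq_of_inter_subset_singleton (a := ConjClasses.mk 1) (b := fun _ => 1)
    (fun p => ⟨1, rfl, 0, by simp⟩)
    (fun p => ⟨isIrreducibleCharacter_one, fun _ => one_mem _⟩) ?_ ?_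
    (fun p => Set.toFinite _)
    (fun p => finite_setOf_isIrreducibleCharacter.subset fun χ hχ => hχ.1)
    (fun p => ncard_primePowerOrder_eq hG p.2)
  · rintro p q hpq c ⟨⟨g, rfl, i, hi⟩, h, hgh, j, hj⟩
    obtain ⟨x, hx⟩ := isConj_iff.1 (ConjClasses.mk_eq_mk_iff_isConj.1 hgh)
    have hord : orderOf g = orderOf h := by
      rw [← hx]
      exact (orderOf_injective (MulAut.conj x).toMonoidHom (MulAut.conj x).injective g).symm
    have h1 : (orderOf g).Coprime (orderOf g) := by
      nth_rw 2 [hord]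
      rw [hi, hj]
      exact Nat.Coprime.pow _ _ ((Nat.coprime_primes p.2 q.2).2 fun h => hpq (Subtype.ext h))
    rw [Nat.coprime_self, orderOf_eq_one_iff] at h1
    rw [h1]
    rfl
  · rintro p q hpq χ ⟨⟨hχ, h₁⟩, -, h₂⟩
    exact eq_one_of_forall_mem_Qfield hG p.2 q.2 (fun h => hpq (Subtype.ext h)) hχ h₁ h₂
end
end

section
/- Let p be a prime and let G be a finite p-solvable group. Then the number of conjugacy classes of G consisting of p-elements is less than or equal to the number of Q_p-valued irreducible characters of G. -/
open scoped Classical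

noncomputable section

/-- The set of `Q_p`-valued irreducible characters of `G`. -/
def QpValuedIrrChars (p : ℕ) (G : Type) [Group G] : Set (G → ℂ) :=
  {χ | IsIrreducibleCharacter G χ ∧ ∀ g, χ g ∈ Qfield p}

/-- The set of conjugacy classes of `G` consisting of `p`-elements, i.e. elements of
`p`-power order (the identity is included). -/
def PElementClasses (p : ℕ) (G : Type) [Group G] : Set (ConjClasses G) :=
  {c | ∃ g : G, c = ConjClasses.mk g ∧ ∃ k : ℕ, orderOf g = p ^ k}

/-- A group `G` is `p`-solvable if it has a subnormal series in which every factor is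
either a `p`-group or a group of order coprime to `p` (factors are expressed via the
cardinality of the corresponding coset spaces). -/
def IsPSolvable (p : ℕ) (G : Type) [Group G] : Prop :=
  ∃ (n : ℕ) (H : ℕ → Subgroup G),
    H 0 = ⊥ ∧ H n = ⊤ ∧
    (∀ i, i < n → H i ≤ H (i + 1)) ∧
    (∀ i, i < n → ((H i).subgroupOf (H (i + 1))).Normal) ∧
    (∀ i, i < n →
      (∃ k : ℕ, Nat.card ((H (i + 1) : Subgroup G) ⧸ (H i).subgroupOf (H (i + 1))) = p ^ k) ∨
      Nat.Coprime (Nat.card ((H (i + 1) : Subgroup G) ⧸ (H i).subgroupOf (H (i + 1)))) p)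

theorem exists_ringEquiv_extending {F : Type} [Field F] [Algebra F ℂ] [IsAlgClosed F]
    (s : F ≃+* F) : ∃ t : ℂ ≃+* ℂ, ∀ x : F, t (algebraMap F ℂ x) = algebraMap F ℂ (s x) := by
  obtain ⟨B, hB⟩ := exists_isTranscendenceBasis F ℂ
  let := IsAlgClosed.isAlgClosure_of_transcendence_basis _ hB
  let e := hB.1.aevalEquiv
  let r : Algebra.adjoin F (Set.range ((↑) : B → ℂ)) ≃+*
      Algebra.adjoin F (Set.range ((↑) : B → ℂ)) :=
    e.symm.toRingEquiv.trans ((MvPolynomial.mapEquiv B s).trans e.toRingEquiv)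
  refine ⟨IsAlgClosure.equivOfEquiv ℂ ℂ r, fun x => ?_⟩
  have h := IsAlgClosure.equivOfEquiv_algebraMap (L := ℂ) (M := ℂ) r (algebraMap F _ x)
  have h2 : r (algebraMap F _ x) = algebraMap F _ (s x) := by
    simp only [r, RingEquiv.trans_apply]
    have : e.symm.toRingEquiv (algebraMap F _ x) = MvPolynomial.C x := by
      exact e.symm.commutes x
    rw [this]
    have h3 : (MvPolynomial.mapEquiv B s) (MvPolynomial.C x) = MvPolynomial.C (s x) := by
      simp only [MvPolynomial.mapEquiv_apply, MvPolynomial.map_C, RingHom.coe_coe]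
    rw [h3]
    exact e.commutes (s x)
  rw [h2] at h
  exact h

theorem mem_of_forall_ringEquiv_fixed (F : Subfield ℂ) (x : ℂ) (hx : IsAlgebraic F x)
    (h : ∀ s : ℂ ≃+* ℂ, (∀ y ∈ F, s y = y) → s x = x) : x ∈ F := by
  let A := algebraicClosure F ℂ
  have : IsAlgClosure F A := inferInstance
  have : IsAlgClosed A := IsAlgClosure.isAlgClosed F
  have : IsGalois F A := inferInstance
  let y : A := ⟨x, (mem_algebraicClosure_iff).2 hx⟩
  have hy : y ∈ (⊥ : IntermediateField F A) := by
    rw [InfiniteGalois.mem_bot_iff_fixed]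
    intro f
    obtain ⟨t, ht⟩ := exists_ringEquiv_extending f.toRingEquiv
    have := h t (fun z hz => by
      have h1 := ht (algebraMap F A ⟨z, hz⟩)
      have h2 : f.toRingEquiv (algebraMap F A ⟨z, hz⟩) = algebraMap F A ⟨z, hz⟩ := f.commutes _
      rw [h2] at h1
      exact h1)
    apply Subtype.ext
    have h1 := ht y
    exact h1.symm.trans this
  obtain ⟨z, hz⟩ := IntermediateField.mem_bot.1 hy
  have := congrArg (algebraMap A ℂ) hz
  rw [show x = (z : ℂ) from this.symm]
  exact z.2

/-- An element whose order is a power of `p`. -/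
def IsPEl (p : ℕ) {G : Type} [Group G] (g : G) : Prop := ∃ k : ℕ, g ^ p ^ k = 1

/-- A field automorphism of `ℂ` fixing all roots of unity of `p`-power order. -/
def FixesPRoots (p : ℕ) (s : ℂ ≃+* ℂ) : Prop := ∀ (x : ℂ) (a : ℕ), x ^ p ^ a = 1 → s x = x

/-- A character of norm one of a matrix representation whose values are fixed by all field
automorphisms fixing the roots of unity of `p`-power order. -/
def IsQpIrr (p : ℕ) {G : Type} [Group G] [Fintype G] (χ : G → ℂ) : Prop :=
  ∃ (n : Type) (_ : Fintype n) (ρ : G →* Matrix n n ℂ), (∀ g, χ g = (ρ g).trace) ∧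
    ∑ g, χ g * χ g⁻¹ = Fintype.card G ∧ ∀ s, FixesPRoots p s → ∀ g, s (χ g) = χ g

theorem pow_eq_one_of_mem_roots_charpoly {n : Type} [Fintype n] {A : Matrix n n ℂ} {k : ℕ}
    (hA : A ^ k = 1) {r : ℂ} (hr : r ∈ A.charpoly.roots) : r ^ k = 1 := by
  have h1 : r ∈ spectrum ℂ A :=
    Matrix.mem_spectrum_of_isRoot_charpoly (Polynomial.isRoot_of_mem_roots hr)
  have h2 := spectrum.pow_mem_pow A k h1
  rw [hA, spectrum.mem_iff] at h2
  by_contra hne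
  apply h2
  rw [← map_one (algebraMap ℂ (Matrix n n ℂ)), ← map_sub]
  exact (IsUnit.mk0 _ (sub_ne_zero.2 hne)).map _

theorem map_trace_eq_of_pow_eq_one {p : ℕ} {s : ℂ ≃+* ℂ} (hs : FixesPRoots p s) {n : Type}
    [Fintype n] {A : Matrix n n ℂ} {k : ℕ} (hA : A ^ p ^ k = 1) : s A.trace = A.trace := by
  rw [Matrix.trace_eq_sum_roots_charpoly, map_multiset_sum]
  congr 1
  conv_rhs => rw [← Multiset.map_id A.charpoly.roots]
  exact Multiset.map_congr rfl fun r hr => hs r k (pow_eq_one_of_mem_roots_charpoly hA hr)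

theorem IsQpIrr.mem_QpValuedIrrChars {p : ℕ} {G : Type} [Group G] [Fintype G] {χ : G → ℂ}
    (h : IsQpIrr p χ) : χ ∈ QpValuedIrrChars p G := by
  obtain ⟨n, _, ρ, hρ, hn, hs⟩ := h
  refine ⟨?_, fun g => ?_⟩
  · let τ : Representation ℂ G (n → ℂ) :=
      ((Matrix.toLinAlgEquiv' : Matrix n n ℂ ≃ₐ[ℂ] _) : Matrix n n ℂ →* _).comp ρ
    have hc : ∀ g, (FDRep.of τ).character g = χ g := fun g => by
      rw [hρ]
      change LinearMap.trace ℂ _ (Matrix.toLin' (ρ g)) = _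
      exact Matrix.trace_toLin'_eq (ρ g)
    refine ⟨FDRep.of τ, ?_, funext fun g => (hc g).symm⟩
    rw [FDRep.simple_iff_char_is_norm_one]
    simp only [hc, hn, Nat.card_eq_fintype_card]
  · apply mem_of_forall_ringEquiv_fixed
    · rw [hρ, Matrix.trace_eq_sum_roots_charpoly]
      have hA : (ρ g) ^ Fintype.card G = 1 := by rw [← map_pow, pow_card_eq_one, map_one]
      have : ∀ r ∈ (ρ g).charpoly.roots, r ∈ algebraicClosure (Qfield p) ℂ := fun r hr => by
        rw [mem_algebraicClosure_iff]
        refine ⟨Polynomial.X ^ Fintype.card G - 1, ?_, ?_⟩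
        · exact Polynomial.X_pow_sub_C_ne_zero Fintype.card_pos (1 : Qfield p)
        · simp [pow_eq_one_of_mem_roots_charpoly hA hr]
      exact (mem_algebraicClosure_iff).1 (multiset_sum_mem _ this)
    · intro s h
      apply hs
      intro x a hx
      refine h x (Subfield.subset_closure ?_)
      refine ⟨a + 1, Nat.succ_pos a, ?_⟩
      rw [pow_succ, pow_mul, hx, one_pow]

theorem finite_QpValuedIrrChars (p : ℕ) (G : Type) [Group G] [Fintype G] :
    (QpValuedIrrChars p G).Finite := by
  have hG : (Nat.card G : ℂ) ≠ 0 := Nat.cast_ne_zero.2 Nat.card_pos.ne'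
  have : Invertible (Nat.card G : ℂ) := invertibleOfNonzero hG
  have hli : LinearIndependent ℂ ((↑) : QpValuedIrrChars p G → (G → ℂ)) := by
    rw [linearIndependent_iff']
    intro s c hc χ hχ
    have horth : ∀ ψ : QpValuedIrrChars p G,
        ∑ g, (ψ : G → ℂ) g * (χ : G → ℂ) g⁻¹ = if ψ = χ then (Nat.card G : ℂ) else 0 := by
      rintro ⟨ψ, ⟨V, hV, rfl⟩, h1⟩
      obtain ⟨χ, ⟨W, hW, rfl⟩, h2⟩ := χ
      have h3 := FDRep.char_orthonormal V W
      rw [inv_mul_eq_iff_eq_mul₀ hG] at h3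
      simp only [h3]
      split_ifs with ha hb hb
      · simp
      · exfalso; apply hb; obtain ⟨i⟩ := ha; apply Subtype.ext; exact FDRep.char_iso i
      · exfalso
        rw [if_neg ha, mul_zero] at h3
        have h4 := FDRep.char_orthonormal W W
        rw [if_pos ⟨CategoryTheory.Iso.refl _⟩, inv_mul_eq_iff_eq_mul₀ hG] at h4
        have h5 : V.character = W.character := congrArg Subtype.val hb
        rw [h5, h4] at h3
        simp at h3
      · simp
    have h1 : ∑ g, (∑ ψ ∈ s, c ψ • (ψ : G → ℂ)) g * (χ : G → ℂ) g⁻¹ = 0 := by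
      rw [hc]; simp
    simp only [Finset.sum_apply, Pi.smul_apply, smul_eq_mul, Finset.sum_mul] at h1
    rw [Finset.sum_comm] at h1
    simp only [mul_assoc, ← Finset.mul_sum, horth] at h1
    simp only [mul_ite, mul_zero, Finset.sum_ite_eq', hχ, if_true] at h1
    exact (mul_eq_zero.1 h1).resolve_right hG
  exact Set.finite_coe_iff.1 hli.finite

theorem IsPEl.conj {p : ℕ} {G : Type} [Group G] {g : G} (h : IsPEl p g) (x : G) :
    IsPEl p (x * g * x⁻¹) := by
  obtain ⟨k, hk⟩ := h
  exact ⟨k, by rw [conj_pow, hk]; simp⟩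

theorem isPEl_conj_iff {p : ℕ} {G : Type} [Group G] {g : G} (x : G) :
    IsPEl p (x * g * x⁻¹) ↔ IsPEl p g :=
  ⟨fun h => by simpa [mul_assoc] using h.conj x⁻¹, fun h => h.conj x⟩

theorem IsPEl.map {p : ℕ} {G H : Type} [Group G] [Group H] {g : G} (h : IsPEl p g) (φ : G →* H) :
    IsPEl p (φ g) := by
  obtain ⟨k, hk⟩ := h
  exact ⟨k, by rw [← map_pow, hk, map_one]⟩

theorem isPEl_map_iff {p : ℕ} {G H : Type} [Group G] [Group H] (φ : G →* H)
    (hφ : ∀ x, φ x = 1 → IsPEl p x) (g : G) : IsPEl p (φ g) ↔ IsPEl p g := by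
  refine ⟨fun ⟨k, hk⟩ => ?_, fun h => h.map φ⟩
  obtain ⟨l, hl⟩ := hφ (g ^ p ^ k) (by rw [map_pow, hk])
  exact ⟨k + l, by rw [pow_add, pow_mul, hl]⟩

theorem ncard_pElementClasses_le_of_span {p : ℕ} {G : Type} [Group G] [Fintype G]
    (h : ∀ f : G → ℂ, (∀ g, ¬ IsPEl p g → f g = 0) → (∀ x g, f (x * g * x⁻¹) = f g) →
      f ∈ Submodule.span ℂ {F : G → ℂ | ∃ χ : G → ℂ, IsQpIrr p χ ∧
        F = fun g => if IsPEl p g then χ g else 0}) :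
    (PElementClasses p G).ncard ≤ (QpValuedIrrChars p G).ncard := by
  let Φ : (G → ℂ) → (G → ℂ) := fun χ g => if IsPEl p g then χ g else 0
  have hTf := finite_QpValuedIrrChars p G
  let v : PElementClasses p G → (G → ℂ) := fun c g => if ConjClasses.mk g = c then 1 else 0
  have hv : LinearIndependent ℂ v := by
    rw [Fintype.linearIndependent_iff]
    rintro c hc ⟨_, g, rfl, hg⟩
    have := congrFun hc g
    simp only [Finset.sum_apply, Pi.smul_apply, smul_eq_mul, v, Pi.zero_apply, mul_ite, mul_one,
      mul_zero] at this
    rw [Finset.sum_eq_single ⟨ConjClasses.mk g, g, rfl, hg⟩] at this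
    · simpa using this
    · intro b _ hb
      rw [if_neg]
      exact fun h => hb (Subtype.ext h.symm)
    · simp
  have hmem : ∀ c, v c ∈ Submodule.span ℂ (Φ '' QpValuedIrrChars p G) := by
    rintro ⟨_, g, rfl, k, hk⟩
    have := h (v ⟨ConjClasses.mk g, g, rfl, k, hk⟩) (fun x hx => ?_) (fun x y => ?_)
    · refine Submodule.span_mono ?_ this
      rintro _ ⟨χ, hχ, rfl⟩
      exact ⟨χ, hχ.mem_QpValuedIrrChars, rfl⟩
    · simp only [v]
      rw [if_neg]
      intro hxg
      obtain ⟨c, hc⟩ := isConj_iff.1 (ConjClasses.mk_eq_mk_iff_isConj.1 hxg.symm)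
      apply hx
      rw [← hc]
      exact IsPEl.conj ⟨k, by rw [← hk, pow_orderOf_eq_one]⟩ c
    · have : ConjClasses.mk (x * y * x⁻¹) = ConjClasses.mk y :=
        ConjClasses.mk_eq_mk_iff_isConj.2 (isConj_iff.2 ⟨x⁻¹, by group⟩)
      simp only [v, this]
  have hli : LinearIndependent ℂ (fun c => (⟨v c, hmem c⟩ :
      Submodule.span ℂ (Φ '' QpValuedIrrChars p G))) :=
    LinearIndependent.of_comp (Submodule.subtype _) hv
  let _ : Fintype (Φ '' QpValuedIrrChars p G) := (hTf.image Φ).fintype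
  have h1 := hli.fintype_card_le_finrank
  rw [Set.ncard_eq_toFinset_card', Set.toFinset_card]
  refine h1.trans ?_
  refine (finrank_span_le_card (R := ℂ) (Φ '' QpValuedIrrChars p G)).trans ?_
  rw [← Set.ncard_eq_toFinset_card']
  exact Set.ncard_image_le hTf

/-- A group with a subnormal series each of whose factors has exponent a power of `p` or an
exponent coprime to `p`. -/
def PSep (p : ℕ) (H : Type) [Group H] : Prop :=
  ∃ (n : ℕ) (L : ℕ → Subgroup H), L 0 = ⊥ ∧ L n = ⊤ ∧ ∀ i < n,
    (∀ x ∈ L (i + 1), ∀ y ∈ L i, x * y * x⁻¹ ∈ L i) ∧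
    ((∃ k, ∀ x ∈ L (i + 1), x ^ p ^ k ∈ L i) ∨
      ∃ m, Nat.Coprime m p ∧ ∀ x ∈ L (i + 1), x ^ m ∈ L i)

/-- An element whose order is coprime to `p`. -/
def IsCoprimeEl (p : ℕ) {G : Type} [Group G] (g : G) : Prop := ∃ m : ℕ, Nat.Coprime m p ∧ g ^ m = 1

theorem IsCoprimeEl.conj {p : ℕ} {G : Type} [Group G] {g : G} (h : IsCoprimeEl p g) (x : G) :
    IsCoprimeEl p (x * g * x⁻¹) := by
  obtain ⟨k, h1, hk⟩ := h
  exact ⟨k, h1, by rw [conj_pow, hk]; simp⟩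

theorem mem_of_pow_mem_of_coprime {G : Type} [Group G] (L : Subgroup G) {x : G} {a b : ℕ}
    (hab : Nat.Coprime a b) (ha : x ^ a ∈ L) (hb : x ^ b ∈ L) : x ∈ L := by
  have h := Nat.gcd_eq_gcd_ab a b
  rw [hab] at h
  have : x = (x ^ a) ^ (Nat.gcdA a b) * (x ^ b) ^ (Nat.gcdB a b) := by
    rw [← zpow_natCast, ← zpow_natCast x b, ← zpow_mul, ← zpow_mul, ← zpow_add, ← h]
    simp
  rw [this]
  exact L.mul_mem (L.zpow_mem ha _) (L.zpow_mem hb _)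

theorem eq_one_of_isPEl_of_isCoprimeEl {p : ℕ} {G : Type} [Group G] {x : G} (h : IsPEl p x)
    (h' : IsCoprimeEl p x) : x = 1 := by
  obtain ⟨k, hk⟩ := h
  obtain ⟨m, hm, hmx⟩ := h'
  have := mem_of_pow_mem_of_coprime (⊥ : Subgroup G) (x := x) (Nat.Coprime.pow_right k hm)
    (by simp [hmx]) (by simp [hk])
  simpa using this

theorem exists_pow_mul_coprime {p : ℕ} (hp : p.Prime) {G : Type} [Group G] [Finite G] (x : G) :
    ∃ k m, Nat.Coprime m p ∧ x ^ (p ^ k * m) = 1 := by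
  obtain ⟨k, m, hm, h⟩ := Nat.exists_eq_pow_mul_and_not_dvd (orderOf_pos x).ne' p hp.ne_one
  exact ⟨k, m, ((Nat.Prime.coprime_iff_not_dvd hp).2 hm).symm, by rw [← h, pow_orderOf_eq_one]⟩

theorem PSep.section {p : ℕ} {H K Q : Type} [Group H] [Group K] [Group Q] (hH : PSep p H)
    (i : K →* H) (φ : K →* Q) (hφ : Function.Surjective φ) (hi : i.ker ≤ φ.ker) : PSep p Q := by
  obtain ⟨n, L, h0, hn, h⟩ := hH
  refine ⟨n, fun j => ((L j).comap i).map φ, ?_, ?_, fun j hj => ⟨?_, ?_⟩⟩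
  · simp only [h0]
    rw [eq_bot_iff, Subgroup.map_le_iff_le_comap]
    exact hi
  · simp only [hn, Subgroup.comap_top]
    exact Subgroup.map_top_of_surjective φ hφ
  · rintro _ ⟨a, ha, rfl⟩ _ ⟨b, hb, rfl⟩
    refine ⟨a * b * a⁻¹, ?_, by simp⟩
    have := (h j hj).1 _ ha _ hb
    simpa using this
  · refine (h j hj).2.imp ?_ ?_
    · rintro ⟨k, hk⟩
      refine ⟨k, ?_⟩
      rintro _ ⟨a, ha, rfl⟩
      exact ⟨a ^ p ^ k, by simpa using hk _ ha, by simp⟩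
    · rintro ⟨k, hkp, hk⟩
      refine ⟨k, hkp, ?_⟩
      rintro _ ⟨a, ha, rfl⟩
      exact ⟨a ^ k, by simpa using hk _ ha, by simp⟩

theorem IsPSolvable.pSep {p : ℕ} {G : Type} [Group G] [Fintype G]
    (hG : IsPSolvable p G) : PSep p G := by
  obtain ⟨n, H, h0, hn, hle, hnorm, hc⟩ := hG
  refine ⟨n, H, h0, hn, fun i hi => ?_⟩
  have hN := hnorm i hi
  have key : ∀ x ∈ H (i + 1), x ^ Nat.card ((H (i + 1) : Subgroup G) ⧸
      (H i).subgroupOf (H (i + 1))) ∈ H i := fun x hx => by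
    have : ((⟨x, hx⟩ : H (i + 1)) : (H (i + 1) : Subgroup G) ⧸
      (H i).subgroupOf (H (i + 1))) ^ Nat.card ((H (i + 1) : Subgroup G) ⧸
      (H i).subgroupOf (H (i + 1))) = 1 := pow_card_eq_one'
    rw [← QuotientGroup.mk_pow, QuotientGroup.eq_one_iff, Subgroup.mem_subgroupOf] at this
    exact this
  refine ⟨fun x hx y hy => ?_, ?_⟩
  · have := hN.conj_mem ⟨y, hle i hi hy⟩ (by exact hy) ⟨x, hx⟩
    exact this
  · refine (hc i hi).imp ?_ ?_
    · rintro ⟨k, hk⟩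
      exact ⟨k, fun x hx => hk ▸ key x hx⟩
    · exact fun h => ⟨_, h, key⟩

theorem PSep.exists_minimal_normal {p : ℕ} (hp : p.Prime) {H : Type} [Group H] [Finite H]
    [Nontrivial H] (hH : PSep p H) : ∃ N : Subgroup H, N.Normal ∧ N ≠ ⊥ ∧
      (∀ K : Subgroup H, K.Normal → K ≤ N → K = ⊥ ∨ K = N) ∧
      ((∀ x ∈ N, IsPEl p x) ∨ ∀ x ∈ N, IsCoprimeEl p x) := by
  obtain ⟨N, ⟨hN, hb⟩, hmin⟩ := (wellFounded_lt (α := Subgroup H)).has_min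
    {N | N.Normal ∧ N ≠ ⊥} ⟨⊤, inferInstance, top_ne_bot⟩
  have hmin' : ∀ K : Subgroup H, K.Normal → K ≤ N → K = ⊥ ∨ K = N := fun K hK hKN => by
    by_contra! h
    exact hmin K ⟨hK, h.1⟩ (lt_of_le_of_ne hKN h.2)
  refine ⟨N, hN, hb, hmin', ?_⟩
  have : Nontrivial N := (Subgroup.nontrivial_iff_ne_bot N).2 hb
  obtain ⟨n, L, h0, hn, h⟩ := hH.section N.subtype (MonoidHom.id N) Function.surjective_id
    (by rw [Subgroup.ker_subtype]; exact bot_le)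
  have hex : ∃ n, L n = ⊤ := ⟨n, hn⟩
  have key : ∃ i < n, L i ≠ ⊤ ∧ L (i + 1) = ⊤ := by
    have h1 := Nat.find_spec hex
    have h2 : Nat.find hex ≠ 0 := fun h => by
      rw [h, h0] at h1; exact bot_ne_top h1
    obtain ⟨i, hi⟩ := Nat.exists_eq_succ_of_ne_zero h2
    have h3 : Nat.find hex ≤ n := Nat.find_min' hex hn
    refine ⟨i, by omega, Nat.find_min hex (by omega), ?_⟩
    rw [hi] at h1; exact h1
  obtain ⟨i, hi, hLi, hLi1⟩ := key
  have gen : ∀ P : H → Prop, (∀ x y, P x → P (y * x * y⁻¹)) →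
      (∀ x : N, P x → x ∈ L i) → ∀ x ∈ N, P x → x = 1 := fun P hP hPL x hx hPx => by
    let C := Subgroup.closure {x : H | x ∈ N ∧ P x}
    have hC : C.Normal := by
      refine ⟨fun z hz g => ?_⟩
      have h1 : C ≤ C.comap (MulAut.conj g).toMonoidHom := by
        refine (Subgroup.closure_le _).2 fun y hy => ?_
        exact Subgroup.subset_closure ⟨hN.conj_mem _ hy.1 g, hP _ _ hy.2⟩
      exact h1 hz
    have hCL : C ≤ (L i).map N.subtype := by
      refine (Subgroup.closure_le _).2 fun y hy => ?_
      exact ⟨⟨y, hy.1⟩, hPL _ hy.2, rfl⟩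
    have hxC : x ∈ C := Subgroup.subset_closure ⟨hx, hPx⟩
    rcases hmin' C hC (hCL.trans (Subgroup.map_subtype_le _)) with h1 | h1
    · rwa [h1, Subgroup.mem_bot] at hxC
    · exfalso
      apply hLi
      rw [eq_top_iff]
      rintro ⟨y, hy⟩ -
      obtain ⟨z, hz, rfl⟩ := hCL (h1 ▸ hy : y ∈ C)
      exact hz
  refine (h i hi).2.imp ?_ ?_
  · rintro ⟨k, hk⟩ x hx
    obtain ⟨a, m, hm, hx1⟩ := exists_pow_mul_coprime hp x
    refine ⟨a, gen (IsCoprimeEl p) (fun x y h => h.conj y) ?_ _ (N.pow_mem hx _)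
      ⟨m, hm, by rw [← pow_mul, hx1]⟩⟩
    rintro ⟨y, hy⟩ ⟨l, hl, hyl⟩
    refine mem_of_pow_mem_of_coprime (L i) (Nat.Coprime.pow_right k hl) ?_ (hk _ (by simp [hLi1]))
    convert (L i).one_mem
    exact Subtype.ext hyl
  · rintro ⟨k, hkp, hk⟩ x hx
    obtain ⟨a, m, hm, hx1⟩ := exists_pow_mul_coprime hp x
    refine ⟨m, hm, gen (IsPEl p) (fun x y h => h.conj y) ?_ _ (N.pow_mem hx _)
      ⟨a, by rw [← pow_mul, mul_comm, hx1]⟩⟩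
    rintro ⟨y, hy⟩ ⟨l, hyl⟩
    refine mem_of_pow_mem_of_coprime (L i) (Nat.Coprime.pow_right l hkp) (hk _ (by simp [hLi1])) ?_
    convert (L i).one_mem
    exact Subtype.ext hyl

/-- Restrictions to the `p`-elements of the `Q_p`-valued irreducible characters of `G` lying over
the character `l` of the central subgroup `ι.range`. -/
def coverRestr (p : ℕ) {G Z : Type} [Group G] [Fintype G] [Group Z] (ι : Z →* G) (l : Z →* ℂˣ) :
    Set (G → ℂ) :=
  {F | ∃ χ : G → ℂ, IsQpIrr p χ ∧ (∀ z g, χ (ι z * g) = l z * χ g) ∧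
    F = fun g => if IsPEl p g then χ g else 0}

/-- Class functions supported on the `p`-elements which transform by `l` under translation by the
central subgroup `ι.range`. -/
structure IsCoverFun (p : ℕ) {G Z : Type} [Group G] [Group Z] (ι : Z →* G)
    (l : Z →* ℂˣ) (f : G → ℂ) : Prop where
  supp : ∀ g, ¬ IsPEl p g → f g = 0
  conj : ∀ x g, f (x * g * x⁻¹) = f g
  cov : ∀ z g, f (ι z * g) = l z * f g

/-- A central extension `G` of `H` by the `p`-group `ι.range`, with a faithful character of
that group. -/
structure CentralSetup (p : ℕ) {G H Z : Type} [Group G] [Group H] [Group Z] (π : G →* H)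
    (ι : Z →* G) (l : Z →* ℂˣ) : Prop where
  surj : Function.Surjective π
  ker : ∀ g, π g = 1 ↔ ∃ z, ι z = g
  central : ∀ z g, ι z * g = g * ι z
  inj : ∀ z, ι z = 1 ↔ l z = 1
  pel : ∀ z, IsPEl p (ι z)
  psep : PSep p H

/-- The span statement for all central setups over groups of order less than `n`. -/
def SpanBelow (p n : ℕ) : Prop := ∀ (G H Z : Type) [Group G] [Group H] [Group Z] [Fintype G]
  (π : G →* H) (ι : Z →* G) (l : Z →* ℂˣ), CentralSetup p π ι l → Nat.card H < n →
  ∀ f : G → ℂ, IsCoverFun p ι l f → f ∈ Submodule.span ℂ (coverRestr p ι l)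

section
variable {p : ℕ} {G H Z : Type} [Group G] [Group H] [Group Z] {π : G →* H}
  {ι : Z →* G} {l : Z →* ℂˣ}

theorem CentralSetup.eq_of_eq (S : CentralSetup p π ι l) {z w : Z} (h : ι z = ι w) : l z = l w := by
  have : l (z * w⁻¹) = 1 := (S.inj _).1 (by simp [h])
  rw [map_mul, map_inv, mul_inv_eq_one] at this
  exact this

theorem CentralSetup.pel_lam (S : CentralSetup p π ι l) (z : Z) : ∃ k, l z ^ p ^ k = 1 := by
  obtain ⟨k, hk⟩ := S.pel z
  exact ⟨k, by rw [← map_pow, ← S.inj, map_pow, hk]⟩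

end

theorem span_transfer {A B : Type} {S : Set (A → ℂ)} {T : Set (B → ℂ)}
    (L : (A → ℂ) →ₗ[ℂ] (B → ℂ)) (hL : ∀ F ∈ S, L F ∈ Submodule.span ℂ T) {f : A → ℂ}
    (hf : f ∈ Submodule.span ℂ S) : L f ∈ Submodule.span ℂ T := by
  have : Submodule.span ℂ S ≤ (Submodule.span ℂ T).comap L := Submodule.span_le.2 hL
  exact this hf

theorem exists_sum_comp {G Q : Type} [Group G] [Group Q] [Fintype G] [Fintype Q] (q : G →* Q)
    (hq : Function.Surjective q) :
    ∃ c : ℂ, c ≠ 0 ∧ (Fintype.card G : ℂ) = c * Fintype.card Q ∧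
      ∀ F : Q → ℂ, ∑ g, F (q g) = c * ∑ x, F x := by
  have key : ∀ F : Q → ℂ, ∑ g, F (q g) =
      ((Finset.univ.filter fun g => q g = 1).card : ℂ) * ∑ x, F x := fun F => by
    rw [← Finset.sum_fiberwise (s := Finset.univ) (g := q), Finset.mul_sum]
    refine Finset.sum_congr rfl fun x _ => ?_
    rw [Finset.sum_congr rfl (g := fun _ => F x)
      (fun g hg => by rw [(Finset.mem_filter.1 hg).2]), Finset.sum_const, nsmul_eq_mul]
    rw [MonoidHom.card_fiber_eq_of_mem_range q (x := x) (y := 1) (hq x) (hq 1)]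
  refine ⟨_, ?_, ?_, key⟩
  · rw [Nat.cast_ne_zero, ← Nat.pos_iff_ne_zero, Finset.card_pos]
    exact ⟨1, by simp⟩
  · simpa using key fun _ => 1

theorem IsQpIrr.of_decidableEq {p : ℕ} {G : Type} [Group G] [Fintype G] {χ : G → ℂ} (n : Type)
    [Fintype n] [i : DecidableEq n] (ρ : G →* Matrix n n ℂ) (h1 : ∀ g, χ g = (ρ g).trace)
    (h2 : ∑ g, χ g * χ g⁻¹ = Fintype.card G)
    (h3 : ∀ s, FixesPRoots p s → ∀ g, s (χ g) = χ g) : IsQpIrr p χ := by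
  obtain rfl : i = fun a b => Classical.propDecidable (a = b) := Subsingleton.elim _ _
  exact ⟨n, inferInstance, ρ, h1, h2, h3⟩

theorem IsQpIrr.inflate {p : ℕ} {G Q : Type} [Group G] [Group Q] [Fintype G] [Fintype Q]
    (q : G →* Q) (hq : Function.Surjective q) {χ : Q → ℂ} (h : IsQpIrr p χ) :
    IsQpIrr p (fun g => χ (q g)) := by
  obtain ⟨n, i, ρ, h1, h2, h3⟩ := h
  obtain ⟨c, hc, hcard, hsum⟩ := exists_sum_comp q hq
  refine ⟨n, i, ρ.comp q, fun g => h1 _, ?_, fun s hs g => h3 s hs _⟩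
  have := hsum (fun x => χ x * χ x⁻¹)
  simp only [map_inv] at this ⊢
  rw [this, h2, hcard]

theorem IsQpIrr.descend {p : ℕ} {G Q : Type} [Group G] [Group Q] [Fintype G] [Fintype Q]
    (q : G →* Q) (hq : Function.Surjective q) {n : Type} [Fintype n]
    (ρ : G →* Matrix n n ℂ) (hρ : ∀ x, q x = 1 → ρ x = 1)
    (hn : ∑ g, (ρ g).trace * (ρ g⁻¹).trace = Fintype.card G)
    (hs : ∀ s, FixesPRoots p s → ∀ g, s (ρ g).trace = (ρ g).trace) {χ : Q → ℂ}
    (hχ : ∀ g, χ (q g) = (ρ g).trace) : IsQpIrr p χ := by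
  have hρ' : ∀ x y, q x = q y → ρ x = ρ y := fun x y hxy => by
    have : ρ (x * y⁻¹) = 1 := hρ _ (by simp [hxy])
    calc ρ x = ρ (x * y⁻¹ * y) := by simp
      _ = ρ y := by rw [map_mul, this, one_mul]
  let r := Function.surjInv hq
  have hr : ∀ x, q (r x) = x := Function.surjInv_eq hq
  obtain ⟨c, hc, hcard, hsum⟩ := exists_sum_comp q hq
  refine ⟨n, inferInstance, ⟨⟨fun x => ρ (r x), hρ _ (hr 1)⟩, fun x y => ?_⟩, fun x => ?_, ?_,
    fun s h x => ?_⟩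
  · rw [← map_mul]; exact hρ' _ _ (by simp [hr])
  · rw [← hr x, hχ]; exact congrArg _ (hρ' _ _ (by simp [hr]))
  · have := hsum (fun x => χ x * χ x⁻¹)
    simp only [← map_inv, hχ, hn, hcard] at this
    exact (mul_left_cancel₀ hc this).symm
  · rw [← hr x, hχ, hs s h]

section
variable {p : ℕ} {G H Z : Type} [Group G] [Group H] [Group Z] [Fintype G] {π : G →* H}
  {ι : Z →* G} {l : Z →* ℂˣ}

theorem CentralSetup.mem_span_of_trivial (S : CentralSetup p π ι l) (hH : ∀ h : H, h = 1)
    {f : G → ℂ} (hf : IsCoverFun p ι l f) : f ∈ Submodule.span ℂ (coverRestr p ι l) := by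
  have hz : ∀ g, ∃ z, ι z = g := fun g => (S.ker g).1 (hH _)
  choose ζ hζ using hz
  have hl : ∀ z, l (ζ (ι z)) = l z := fun z => S.eq_of_eq (hζ _)
  let χ : G →* ℂˣ := ⟨⟨fun g => l (ζ g), by
    simpa using S.eq_of_eq (z := ζ 1) (w := 1) (by simp [hζ])⟩, fun x y => by
    simpa using S.eq_of_eq (z := ζ (x * y)) (w := ζ x * ζ y) (by simp [hζ])⟩
  have hχ : ∀ z, χ (ι z) = l z := hl
  have hmem : (fun g => if IsPEl p g then (χ g : ℂ) else 0) ∈ coverRestr p ι l := by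
    refine ⟨fun g => χ g, .of_decidableEq Unit
      (((Matrix.scalar Unit : ℂ →+* _) : ℂ →* Matrix Unit Unit ℂ).comp ((Units.coeHom ℂ).comp χ))
      (fun g => ?_) ?_ fun s hs g => ?_, fun z g => ?_, rfl⟩
    · simp [Matrix.trace]
    · simp
    · rw [← hζ g]
      simp only [hχ]
      obtain ⟨k, hk⟩ := S.pel_lam (ζ g)
      refine hs _ k ?_
      rw [← Units.val_pow_eq_pow_val, hk, Units.val_one]
    · simp only [map_mul, hχ, Units.val_mul]
  have : f = f 1 • (fun g => if IsPEl p g then (χ g : ℂ) else 0) := by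
    funext g
    have h1 := hf.cov (ζ g) 1
    have h2 : IsPEl p g := hζ g ▸ S.pel (ζ g)
    rw [mul_one, hζ] at h1
    simp only [Pi.smul_apply, smul_eq_mul, if_pos h2]
    rw [h1, mul_comm]; rfl
  rw [this]
  exact Submodule.smul_mem _ _ (Submodule.subset_span hmem)

end

theorem exists_conj_of_inv_mul_mem {p : ℕ} (hp : p.Prime) {G : Type} [Group G] [Finite G]
    {K : Subgroup G} [K.Normal] (hK : ∀ x ∈ K, IsCoprimeEl p x) {x y : G} (hx : IsPEl p x)
    (hy : IsPEl p y) (hxy : x⁻¹ * y ∈ K) : ∃ g, g * x * g⁻¹ = y := by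
  have : Fact p.Prime := ⟨hp⟩
  let q := QuotientGroup.mk' K
  have hq : q x = q y := QuotientGroup.eq.2 hxy
  let L := (Subgroup.zpowers (q x)).comap q
  have hxL : x ∈ L := Subgroup.mem_zpowers (q x)
  have hyL : y ∈ L := by
    change q y ∈ Subgroup.zpowers (q x)
    rw [← hq]; exact Subgroup.mem_zpowers _
  have hz : ∀ u : G, IsPEl p u → ∀ hu : u ∈ L, ∃ P : Sylow p L, (⟨u, hu⟩ : L) ∈ P := by
    intro u hup hu
    have : IsPGroup p (Subgroup.zpowers (⟨u, hu⟩ : L)) := by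
      rintro ⟨_, n, rfl⟩
      obtain ⟨k, hk⟩ := hup
      refine ⟨k, Subtype.ext (Subtype.ext ?_)⟩
      simp only [Subgroup.coe_pow, Subgroup.coe_zpow, Subgroup.coe_one]
      rw [← zpow_natCast, ← zpow_mul, mul_comm, zpow_mul, zpow_natCast, hk, one_zpow]
    obtain ⟨P, hP⟩ := this.exists_le_sylow
    exact ⟨P, hP (Subgroup.mem_zpowers _)⟩
  obtain ⟨P, hP⟩ := hz x hx hxL
  obtain ⟨Q, hQ⟩ := hz y hy hyL
  obtain ⟨⟨g, hg⟩, hgPQ⟩ := MulAction.exists_smul_eq L P Q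
  refine ⟨g, ?_⟩
  have h1 : (⟨g * x * g⁻¹, L.mul_mem (L.mul_mem hg hxL) (L.inv_mem hg)⟩ : L) ∈ Q := by
    rw [← hgPQ]
    exact ⟨⟨x, hxL⟩, hP, rfl⟩
  have h2 := Q.mul_mem h1 (Q.inv_mem hQ)
  have hpel : IsPEl p (g * x * g⁻¹ * y⁻¹) := by
    obtain ⟨k, hk⟩ := Q.isPGroup' ⟨_, h2⟩
    exact ⟨k, congrArg (fun u : Q => ((u : L) : G)) hk⟩
  have hmem : g * x * g⁻¹ * y⁻¹ ∈ K := by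
    rw [← QuotientGroup.eq_one_iff]
    change q _ = 1
    obtain ⟨n, hn⟩ : q g ∈ Subgroup.zpowers (q x) := hg
    simp only [map_mul, map_inv, ← hq, ← hn]
    group
  exact mul_inv_eq_one.1 (eq_one_of_isPEl_of_isCoprimeEl hpel (hK _ hmem))

theorem CentralSetup.mem_span_of_coprime {p : ℕ} (hp : p.Prime) {G H Z : Type} [Group G] [Group H]
    [Group Z] [Fintype G] {π : G →* H} {ι : Z →* G} {l : Z →* ℂˣ} (S : CentralSetup p π ι l)
    (IH : SpanBelow p (Nat.card H)) (K : Subgroup G) [K.Normal] (hK : ∀ x ∈ K, IsCoprimeEl p x)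
    (hK1 : K ≠ ⊥) {f : G → ℂ} (hf : IsCoverFun p ι l f) :
    f ∈ Submodule.span ℂ (coverRestr p ι l) := by
  have : Finite H := Finite.of_surjective π S.surj
  have : (K.map π).Normal := Subgroup.Normal.map ‹_› π S.surj
  let q := QuotientGroup.mk' K
  have hq : Function.Surjective q := QuotientGroup.mk'_surjective K
  have hqK : ∀ x, q x = 1 ↔ x ∈ K := fun x => QuotientGroup.eq_one_iff x
  let π' : G ⧸ K →* H ⧸ K.map π := QuotientGroup.map _ _ π (Subgroup.le_comap_map π K)
  have hπ' : ∀ x, π' (q x) = QuotientGroup.mk' (K.map π) (π x) := fun x => rfl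
  have hzK : ∀ z, ι z ∈ K → ι z = 1 := fun z hz =>
    eq_one_of_isPEl_of_isCoprimeEl (S.pel z) (hK _ hz)
  have S' : CentralSetup p π' (q.comp ι) l := by
    refine ⟨?_, ?_, ?_, ?_, ?_, ?_⟩
    · intro h
      obtain ⟨h, rfl⟩ := QuotientGroup.mk'_surjective _ h
      obtain ⟨g, rfl⟩ := S.surj h
      exact ⟨q g, rfl⟩
    · intro g
      obtain ⟨g, rfl⟩ := hq g
      rw [hπ', QuotientGroup.mk'_apply, QuotientGroup.eq_one_iff]
      constructor
      · rintro ⟨k, hk, hkg⟩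
        obtain ⟨z, hz⟩ := (S.ker (g * k⁻¹)).1 (by simp [hkg])
        refine ⟨z, ?_⟩
        simp [hz, (hqK k).2 hk]
      · rintro ⟨z, hz⟩
        refine ⟨(ι z)⁻¹ * g, (hqK _).1 (by simpa using inv_mul_eq_one.2 hz), ?_⟩
        rw [map_mul, map_inv, (S.ker (ι z)).2 ⟨z, rfl⟩]; simp
    · intro z g
      obtain ⟨g, rfl⟩ := hq g
      simp only [MonoidHom.comp_apply, ← map_mul, S.central]
    · intro z
      rw [MonoidHom.comp_apply, hqK, ← S.inj]
      exact ⟨hzK z, fun h => h ▸ K.one_mem⟩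
    · exact fun z => (S.pel z).map q
    · exact S.psep.section (MonoidHom.id H) (QuotientGroup.mk' _) (QuotientGroup.mk'_surjective _)
        (fun x hx => by
          have : x = 1 := hx
          rw [this]; exact Subgroup.one_mem _)
  have hcard : Nat.card (H ⧸ K.map π) < Nat.card H := by
    have h1 : K.map π ≠ ⊥ := fun h => by
      apply hK1
      rw [eq_bot_iff]
      intro k hk
      have : π k ∈ K.map π := ⟨k, hk, rfl⟩
      rw [h, Subgroup.mem_bot] at this
      obtain ⟨z, rfl⟩ := (S.ker k).1 this
      exact hzK z hk
    rw [Subgroup.card_eq_card_quotient_mul_card_subgroup (K.map π)]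
    have h2 := (Subgroup.one_lt_card_iff_ne_bot _).2 h1
    have h3 : 0 < Nat.card (H ⧸ K.map π) := Nat.card_pos
    nlinarith
  let f' : G ⧸ K → ℂ := fun x => if h : ∃ g, IsPEl p g ∧ q g = x then f h.choose else 0
  have hf' : ∀ g, IsPEl p g → f' (q g) = f g := fun g hg => by
    have h : ∃ g', IsPEl p g' ∧ q g' = q g := ⟨g, hg, rfl⟩
    simp only [f', dif_pos h]
    obtain ⟨u, hu⟩ := exists_conj_of_inv_mul_mem hp hK hg h.choose_spec.1
      ((hqK _).1 (by simp [h.choose_spec.2]))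
    rw [← hu, hf.conj]
  have hf0 : ∀ x, (∀ g, IsPEl p g → q g ≠ x) → f' x = 0 := fun x hx => by
    simp only [f']
    rw [dif_neg]
    rintro ⟨g, h1, h2⟩; exact hx g h1 h2
  have hcf : IsCoverFun p (q.comp ι) l f' := by
    refine ⟨fun x hx => hf0 x ?_, fun y x => ?_, fun z x => ?_⟩
    · rintro g hg rfl
      exact hx (hg.map q)
    · obtain ⟨y, rfl⟩ := hq y
      by_cases h : ∃ g, IsPEl p g ∧ q g = x
      · obtain ⟨g, hg, rfl⟩ := h
        rw [← map_inv, ← map_mul, ← map_mul, hf' _ hg, hf' _ (hg.conj y), hf.conj]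
      · push Not at h
        rw [hf0 x h, hf0]
        intro g hg hgx
        refine h _ (hg.conj y⁻¹) ?_
        simp only [map_mul, map_inv, hgx]
        group
    · have hpz : ∀ z g, IsPEl p g → IsPEl p (ι z * g) := by
        rintro z g ⟨a, ha⟩
        obtain ⟨b, hb⟩ := S.pel z
        refine ⟨a + b, ?_⟩
        rw [(show Commute (ι z) g from S.central z g).mul_pow, pow_add, pow_mul g, ha, one_pow,
          mul_one, mul_comm, pow_mul, hb, one_pow]
      by_cases h : ∃ g, IsPEl p g ∧ q g = x
      · obtain ⟨g, hg, rfl⟩ := h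
        rw [MonoidHom.comp_apply, ← map_mul, hf' _ hg, hf' _ (hpz z g hg), hf.cov]
      · push Not at h
        rw [hf0 x h, hf0, mul_zero]
        intro g hg hgx
        refine h _ (hpz z⁻¹ _ hg) ?_
        rw [map_mul, hgx]
        simp
  have hspan := IH _ _ _ π' (q.comp ι) l S' hcard f' hcf
  let L : (G ⧸ K → ℂ) →ₗ[ℂ] (G → ℂ) :=
    { toFun := fun F g => if IsPEl p g then F (q g) else 0
      map_add' := fun F F' => by funext g; by_cases h : IsPEl p g <;> simp [h]
      map_smul' := fun c F => by funext g; by_cases h : IsPEl p g <;> simp [h] }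
  have hL : L f' = f := by
    funext g
    change (if IsPEl p g then f' (q g) else 0) = f g
    split_ifs with h
    · exact hf' g h
    · exact (hf.supp g h).symm
  rw [← hL]
  refine span_transfer L ?_ hspan
  rintro _ ⟨χ, h1, h2, rfl⟩
  refine Submodule.subset_span ⟨fun g => χ (q g), h1.inflate q hq, fun z g => ?_, ?_⟩
  · simp only [map_mul]; exact h2 z _
  · funext g
    change (if IsPEl p g then (if IsPEl p (q g) then χ (q g) else 0) else 0) = _
    by_cases h : IsPEl p g
    · simp [h, h.map q]
    · simp [h]

theorem coprime_card_of_forall_isCoprimeEl {p : ℕ} (hp : p.Prime) {G : Type} [Group G] [Finite G]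
    (h : ∀ g : G, IsCoprimeEl p g) : (Nat.card G).Coprime p := by
  rw [Nat.coprime_comm, Nat.Prime.coprime_iff_not_dvd hp]
  intro hd
  have : Fact p.Prime := ⟨hp⟩
  obtain ⟨x, hx⟩ := exists_prime_orderOf_dvd_card' p hd
  have : x = 1 := eq_one_of_isPEl_of_isCoprimeEl ⟨1, by rw [pow_one, ← hx, pow_orderOf_eq_one]⟩
    (h x)
  rw [this, orderOf_one] at hx
  exact hp.ne_one hx.symm

theorem CentralSetup.exists_coprime_normal {p : ℕ} (hp : p.Prime) {G H Z : Type} [Group G]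
    [Group H] [Group Z] [Fintype G] {π : G →* H} {ι : Z →* G} {l : Z →* ℂˣ}
    (S : CentralSetup p π ι l) (N : Subgroup H) [N.Normal] (hN : N ≠ ⊥)
    (hNp : ∀ x ∈ N, IsCoprimeEl p x) :
    ∃ K : Subgroup G, K.Normal ∧ (∀ x ∈ K, IsCoprimeEl p x) ∧ K ≠ ⊥ := by
  have : Fact p.Prime := ⟨hp⟩
  let M := N.comap π
  let A : Subgroup M := (ι.range).subgroupOf M
  have hAmem : ∀ m : M, m ∈ A ↔ ∃ z, ι z = m := fun m => Iff.rfl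
  have hAc : ∀ a ∈ A, ∀ m : M, a * m = m * a := by
    intro a ha m
    obtain ⟨z, hz⟩ := (hAmem a).1 ha
    apply Subtype.ext
    simp only [Subgroup.coe_mul, ← hz, S.central]
  have hAn : A.Normal := ⟨fun a ha m => by rw [← hAc a ha m]; simpa using ha⟩
  have hAp : ∀ a ∈ A, IsPEl p a := by
    intro a ha
    obtain ⟨z, hz⟩ := (hAmem a).1 ha
    obtain ⟨k, hk⟩ := S.pel z
    exact ⟨k, Subtype.ext (by simp [← hz, hk])⟩
  have hcA : ∃ n, Nat.card A = p ^ n := by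
    rw [← IsPGroup.iff_card]
    rintro ⟨a, ha⟩
    obtain ⟨k, hk⟩ := hAp a ha
    exact ⟨k, Subtype.ext hk⟩
  have hind : (Nat.card (M ⧸ A)).Coprime p := by
    apply coprime_card_of_forall_isCoprimeEl hp
    intro x
    obtain ⟨⟨m, hm⟩, rfl⟩ := QuotientGroup.mk'_surjective A x
    obtain ⟨r, hr, h⟩ := hNp _ hm
    refine ⟨r, hr, ?_⟩
    rw [← map_pow, QuotientGroup.mk'_apply, QuotientGroup.eq_one_iff, hAmem]
    rw [← map_pow] at h
    exact (S.ker _).1 h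
  obtain ⟨K, hK⟩ := Subgroup.exists_right_complement'_of_coprime (N := A) (by
    obtain ⟨n, hn⟩ := hcA
    rw [hn]
    exact (Nat.Coprime.pow_right n hind).symm)
  have hKc : ∀ k ∈ K, IsCoprimeEl p k := by
    intro k hk
    refine ⟨Nat.card K, ?_, ?_⟩
    · rw [← hK.symm.index_eq_card]; exact hind
    · exact congrArg (fun u : K => (u : M)) (pow_card_eq_one' (x := (⟨k, hk⟩ : K)))
  have hKmem : ∀ m : M, IsCoprimeEl p m → m ∈ K := by
    rintro m ⟨r, hr, hm⟩
    obtain ⟨⟨a, k⟩, rfl⟩ := hK.2 m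
    have hcomm : Commute (a : M) (k : M) := hAc a a.2 k
    simp only [hcomm.mul_pow] at hm
    have h1 : (a : M) ^ r ∈ K := by
      rw [mul_eq_one_iff_eq_inv.1 hm]; exact K.inv_mem (K.pow_mem k.2 r)
    have h2 : (a : M) ^ r = 1 := by
      have := hK.disjoint.le_bot ⟨A.pow_mem a.2 r, h1⟩
      exact this
    have h3 := eq_one_of_isPEl_of_isCoprimeEl (hAp a a.2) ⟨r, hr, h2⟩
    simp only [h3, one_mul]
    exact k.2
  refine ⟨K.map M.subtype, ⟨?_⟩, ?_, ?_⟩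
  · rintro _ ⟨k, hk, rfl⟩ g
    have hM : M.Normal := Subgroup.Normal.comap ‹_› π
    obtain ⟨r, hr, hkr⟩ := hKc k hk
    refine ⟨⟨g * k * g⁻¹, hM.conj_mem _ k.2 g⟩, hKmem _ ⟨r, hr, Subtype.ext ?_⟩, rfl⟩
    have : (k : G) ^ r = 1 := congrArg Subtype.val hkr
    simp [conj_pow, this]
  · rintro _ ⟨k, hk, rfl⟩
    obtain ⟨r, hr, hkr⟩ := hKc k hk
    exact ⟨r, hr, by rw [← map_pow, hkr, map_one]⟩
  · intro hb
    apply hN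
    rw [eq_bot_iff]
    intro x hx
    obtain ⟨g, rfl⟩ := S.surj x
    obtain ⟨⟨a, k⟩, hak⟩ := hK.2 ⟨g, hx⟩
    have hk1 : ((k : M) : G) = 1 := by
      have : ((k : M) : G) ∈ K.map M.subtype := ⟨k, k.2, rfl⟩
      rw [hb] at this; exact this
    obtain ⟨z, hz⟩ := (hAmem a).1 a.2
    have hg : g = ((a : M) : G) * ((k : M) : G) := congrArg Subtype.val hak.symm
    rw [Subgroup.mem_bot, hg, hk1, mul_one]
    exact (S.ker _).2 ⟨z, hz⟩

section
variable {G : Type} [Group G] (T : Subgroup G)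

theorem sum_eq_card_mul_sum_quotient [Fintype G] {φ : G → ℂ} (hφ : ∀ x, ∀ t ∈ T, φ (x * t) = φ x) :
    ∑ x, φ x = Fintype.card T * ∑ a : G ⧸ T, φ a.out := by
  have hmem : ∀ x : G, ((x : G ⧸ T).out)⁻¹ * x ∈ T := fun x => by
    rw [← QuotientGroup.eq]; simp
  let e : (G ⧸ T) × T ≃ G :=
    { toFun := fun a => a.1.out * a.2
      invFun := fun x => (x, ⟨(x : G ⧸ T).out⁻¹ * x, hmem x⟩)
      left_inv := by
        rintro ⟨a, t, ht⟩
        have : ((a.out * t : G) : G ⧸ T) = a := by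
          rw [QuotientGroup.mk_mul_of_mem _ ht]; simp
        simp [this]
      right_inv := fun x => by simp }
  rw [← e.sum_comp, Fintype.sum_prod_type, Finset.mul_sum]
  refine Finset.sum_congr rfl fun a _ => ?_
  have : ∀ t, φ (e (a, t)) = φ a.out := fun t => hφ _ _ t.2
  simp [this]

variable {T} {n : Type} [Fintype n]

/-- The extension by zero of a matrix representation of a subgroup. -/
def zeroExt (ρ : T →* Matrix n n ℂ) (g : G) : Matrix n n ℂ := if h : g ∈ T then ρ ⟨g, h⟩ else 0

theorem zeroExt_of_mem (ρ : T →* Matrix n n ℂ) {g : G} (h : g ∈ T) : zeroExt ρ g = ρ ⟨g, h⟩ :=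
  dif_pos h

theorem zeroExt_of_notMem (ρ : T →* Matrix n n ℂ) {g : G} (h : g ∉ T) : zeroExt ρ g = 0 :=
  dif_neg h

theorem zeroExt_mul_right (ρ : T →* Matrix n n ℂ) (g : G) {t : G} (h : t ∈ T) :
    zeroExt ρ (g * t) = zeroExt ρ g * zeroExt ρ t := by
  by_cases hg : g ∈ T
  · rw [zeroExt_of_mem ρ h, zeroExt_of_mem ρ hg, zeroExt_of_mem ρ (T.mul_mem hg h), ← map_mul]
    rfl
  · rw [zeroExt_of_notMem ρ hg, zeroExt_of_notMem ρ fun h' => hg ?_, zero_mul]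
    simpa using T.mul_mem h' (T.inv_mem h)

theorem zeroExt_mul_left (ρ : T →* Matrix n n ℂ) (g : G) {t : G} (h : t ∈ T) :
    zeroExt ρ (t * g) = zeroExt ρ t * zeroExt ρ g := by
  by_cases hg : g ∈ T
  · rw [zeroExt_of_mem ρ h, zeroExt_of_mem ρ hg, zeroExt_of_mem ρ (T.mul_mem h hg), ← map_mul]
    rfl
  · rw [zeroExt_of_notMem ρ hg, zeroExt_of_notMem ρ fun h' => hg ?_, mul_zero]
    simpa using T.mul_mem (T.inv_mem h) h'

variable [Fintype G]

/-- The matrix representation induced from a subgroup. -/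
def inducedRep (ρ : T →* Matrix n n ℂ) : G →* Matrix ((G ⧸ T) × n) ((G ⧸ T) × n) ℂ where
  toFun g := Matrix.of fun a b => zeroExt ρ (a.1.out⁻¹ * g * b.1.out) a.2 b.2
  map_one' := by
    ext ⟨a, i⟩ ⟨b, j⟩
    simp only [Matrix.of_apply, mul_one]
    by_cases hab : a = b
    · subst hab
      rw [inv_mul_cancel, zeroExt_of_mem ρ T.one_mem]
      change ρ 1 i j = _
      simp [Matrix.one_apply]
    · rw [zeroExt_of_notMem, Matrix.one_apply_ne]
      · rfl
      · simp [hab]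
      · rw [← QuotientGroup.eq]; simpa using hab
  map_mul' g h := by
    ext ⟨a, i⟩ ⟨b, j⟩
    simp only [Matrix.of_apply, Matrix.mul_apply, Fintype.sum_prod_type]
    rw [Finset.sum_eq_single ((h * b.out : G) : G ⧸ T)]
    · have hmem : ((h * b.out : G) : G ⧸ T).out⁻¹ * h * b.out ∈ T := by
        rw [mul_assoc, ← QuotientGroup.eq]; simp
      rw [← Matrix.mul_apply, ← zeroExt_mul_right _ _ hmem]
      have h1 : a.out⁻¹ * (g * h) * b.out = a.out⁻¹ * g * ((h * b.out : G) : G ⧸ T).out *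
        (((h * b.out : G) : G ⧸ T).out⁻¹ * h * b.out) := by group
      rw [h1]
    · intro c _ hc
      refine Finset.sum_eq_zero fun k _ => ?_
      rw [zeroExt_of_notMem ρ (g := c.out⁻¹ * h * b.out)]
      · simp
      · rw [mul_assoc, ← QuotientGroup.eq]
        simpa using hc
    · simp

theorem card_mul_trace_inducedRep (ρ : T →* Matrix n n ℂ) (g : G) :
    Fintype.card T * (inducedRep ρ g).trace = ∑ x : G, (zeroExt ρ (x⁻¹ * g * x)).trace := by
  rw [sum_eq_card_mul_sum_quotient T (φ := fun x => (zeroExt ρ (x⁻¹ * g * x)).trace)]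
  · congr 1
    simp only [Matrix.trace, Matrix.diag_apply, inducedRep, MonoidHom.coe_mk, OneHom.coe_mk,
      Matrix.of_apply, Fintype.sum_prod_type]
  · intro x t ht
    have : (x * t)⁻¹ * g * (x * t) = t⁻¹ * ((x⁻¹ * g * x) * t) := by group
    simp only [this]
    rw [zeroExt_mul_left _ _ (T.inv_mem ht), Matrix.trace_mul_comm, ← zeroExt_mul_right _ _
      (T.inv_mem ht)]
    simp

end

theorem IsQpIrr.induce {p : ℕ} {G : Type} [Group G] [Fintype G] (T Y : Subgroup G) [Y.Normal]
    (hYT : Y ≤ T) (θ : Y →* ℂˣ)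
    (hθ : ∀ w, (∀ y, θ (MulAut.conjNormal w y) = θ y) → w ∈ T) {χ : T → ℂ} (hχ : IsQpIrr p χ)
    (hcov : ∀ (y : Y) (t : T), χ (Subgroup.inclusion hYT y * t) = θ y * χ t) :
    IsQpIrr p (fun g : G => (Fintype.card T : ℂ)⁻¹ *
      ∑ x : G, if h : x⁻¹ * g * x ∈ T then χ ⟨_, h⟩ else 0) := by
  obtain ⟨n, _, ρ, h1, h2, h3⟩ := hχ
  have hT : (Fintype.card T : ℂ) ≠ 0 := Nat.cast_ne_zero.2 Fintype.card_ne_zero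
  let ψ : G → ℂ := fun g => if h : g ∈ T then χ ⟨g, h⟩ else 0
  have hψ : ∀ g, ψ g = (zeroExt ρ g).trace := fun g => by
    by_cases h : g ∈ T
    · simp only [ψ, dif_pos h, zeroExt_of_mem ρ h, h1]
    · simp only [ψ, dif_neg h, zeroExt_of_notMem ρ h, Matrix.trace_zero]
  have hψc : ∀ t ∈ T, ∀ g, ψ (t⁻¹ * g * t) = ψ g := fun t ht g => by
    rw [hψ, zeroExt_mul_right _ _ ht, Matrix.trace_mul_comm, ← zeroExt_mul_left _ _ ht, hψ]
    congr 2; group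
  have hψy : ∀ (y : Y) g, ψ (y * g) = θ y * ψ g := fun y g => by
    by_cases h : g ∈ T
    · simp only [ψ, dif_pos h, dif_pos (T.mul_mem (hYT y.2) h)]
      exact hcov y ⟨g, h⟩
    · simp only [ψ, dif_neg h, mul_zero]
      rw [dif_neg]
      intro h'
      apply h
      simpa using T.mul_mem (T.inv_mem (hYT y.2)) h'
  have hψy' : ∀ (y : Y) g, ψ (g * y) = θ y * ψ g := fun y g => by
    rw [← hψy, ← hψc y (hYT y.2) (y * g)]
    congr 1; group
  refine .of_decidableEq ((G ⧸ T) × n) (inducedRep ρ) (fun g => ?_) ?_ fun s hs g => ?_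
  · rw [inv_mul_eq_iff_eq_mul₀ hT, card_mul_trace_inducedRep]
    exact Finset.sum_congr rfl fun x _ => hψ _
  · let E : G → ℂ := fun w => ∑ h, ψ h * ψ (w⁻¹ * h⁻¹ * w)
    have hE1 : ∀ w ∈ T, E w = Fintype.card T := fun w hw => by
      rw [← h2]
      simp only [E, hψc w hw]
      symm
      refine Fintype.sum_of_injective (Subtype.val : T → G) Subtype.val_injective _ _ ?_ ?_
      · intro g hg
        have : g ∉ T := fun h => hg ⟨⟨g, h⟩, rfl⟩
        simp [ψ, this]
      · intro t
        simp only [ψ, dif_pos t.2, dif_pos (T.inv_mem t.2)]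
        rfl
    have hE0 : ∀ w, w ∉ T → E w = 0 := fun w hw => by
      have hex : ∃ y u : Y, (u : G) = w⁻¹ * y * w ∧ θ u ≠ θ y := by
        by_contra! h
        have := T.inv_mem (hθ w⁻¹ fun y => h y _ (by simp))
        exact hw (by simpa using this)
      obtain ⟨y, u, hu, hy⟩ := hex
      have : E w = θ y * (θ u : ℂ)⁻¹ * E w := by
        conv_lhs => simp only [E]
        rw [← Equiv.sum_comp (Equiv.mulLeft (y : G)), Finset.mul_sum]
        refine Finset.sum_congr rfl fun h _ => ?_
        have h5 : w⁻¹ * (y * h)⁻¹ * w = (w⁻¹ * h⁻¹ * w) * ((u⁻¹ : Y) : G) := by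
          rw [Subgroup.coe_inv, hu]; group
        have h6 := hψy' u⁻¹ (w⁻¹ * h⁻¹ * w)
        rw [map_inv, Units.val_inv_eq_inv_val] at h6
        rw [Equiv.coe_mulLeft, hψy, h5, h6]
        ring
      by_contra hne
      apply hy
      have h7 := mul_right_cancel₀ hne ((one_mul _).trans this)
      have h8 : (θ u : ℂ) ≠ 0 := Units.ne_zero _
      field_simp at h7
      exact Units.ext h7
    have key : ∑ g, (∑ x : G, ψ (x⁻¹ * g * x)) * (∑ y : G, ψ (y⁻¹ * g⁻¹ * y)) =
        Fintype.card G * (Fintype.card T * Fintype.card T) := by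
      simp only [Finset.sum_mul_sum]
      rw [Finset.sum_comm]
      have h1 : ∀ x : G, ∑ g, ∑ y, ψ (x⁻¹ * g * x) * ψ (y⁻¹ * g⁻¹ * y) =
          (Fintype.card T * Fintype.card T : ℂ) := fun x => by
        rw [Finset.sum_comm]
        have h2 : ∀ y : G, ∑ g, ψ (x⁻¹ * g * x) * ψ (y⁻¹ * g⁻¹ * y) = E (x⁻¹ * y) := fun y => by
          rw [← (MulAut.conj x).toEquiv.sum_comp]
          refine Finset.sum_congr rfl fun g _ => ?_
          simp only [MulEquiv.toEquiv_eq_coe, EquivLike.coe_coe, MulAut.conj_apply]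
          congr 2 <;> group
        simp only [h2]
        rw [show ∑ y, E (x⁻¹ * y) = ∑ y, E y from Equiv.sum_comp (Equiv.mulLeft x⁻¹) E]
        have h3 : (Fintype.card T * Fintype.card T : ℂ) = ∑ t : T, (Fintype.card T : ℂ) := by
          simp
        rw [h3]
        symm
        refine Fintype.sum_of_injective (Subtype.val : T → G) Subtype.val_injective _ _ ?_ ?_
        · intro g hg
          exact hE0 g fun h => hg ⟨⟨g, h⟩, rfl⟩
        · intro t
          exact (hE1 t t.2).symm
      simp [h1]
    have hrw : ∀ g, (∑ x : G, if h : x⁻¹ * g * x ∈ T then χ ⟨_, h⟩ else 0) =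
        ∑ x : G, ψ (x⁻¹ * g * x) := fun g => rfl
    simp only [hrw]
    calc _ = (Fintype.card T : ℂ)⁻¹ * (Fintype.card T : ℂ)⁻¹ *
          ∑ g, (∑ x : G, ψ (x⁻¹ * g * x)) * (∑ y : G, ψ (y⁻¹ * g⁻¹ * y)) := by
          rw [Finset.mul_sum]
          exact Finset.sum_congr rfl fun g _ => by ring
      _ = _ := by rw [key]; field_simp
  · rw [map_mul, map_inv₀, map_natCast, map_sum]
    congr 1
    refine Finset.sum_congr rfl fun x _ => ?_
    split_ifs
    · exact h3 s hs _
    · simp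

theorem card_quotient_subgroupOf_lt {G H : Type} [Group G] [Group H] [Finite G] {π : G →* H}
    (hπ : Function.Surjective π) {Y T : Subgroup G} (hYT : Y ≤ T) (hker : π.ker < Y) :
    Nat.card (T ⧸ Y.subgroupOf T) < Nat.card H := by
  have : Finite H := Finite.of_surjective π hπ
  have h1 := Subgroup.card_eq_card_quotient_mul_card_subgroup (Y.subgroupOf T)
  rw [Nat.card_congr (Subgroup.subgroupOfEquivOfLe hYT).toEquiv] at h1
  have h2 := Subgroup.card_eq_card_quotient_mul_card_subgroup π.ker
  rw [Nat.card_congr (QuotientGroup.quotientKerEquivOfSurjective π hπ).toEquiv] at h2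
  have h3 : Nat.card T ≤ Nat.card G := Subgroup.card_le_card_group T
  have h4 : Nat.card π.ker < Nat.card Y := by
    rw [← SetLike.coe_sort_coe, ← SetLike.coe_sort_coe, Nat.card_coe_set_eq, Nat.card_coe_set_eq]
    exact Set.ncard_lt_ncard hker
  have h5 : 0 < Nat.card H := Nat.card_pos
  by_contra! h
  have := Nat.mul_le_mul h h4.le
  have := Nat.mul_lt_mul_of_pos_left h4 h5
  nlinarith

theorem isPEl_mul_iff {p : ℕ} {G : Type} [Group G] {Y : Subgroup G} [Y.Normal]
    (hY : ∀ y ∈ Y, IsPEl p y) {g y : G} (hy : y ∈ Y) : IsPEl p (g * y) ↔ IsPEl p g := by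
  have h : ∀ x, QuotientGroup.mk' Y x = 1 → IsPEl p x := fun x hx =>
    hY x ((QuotientGroup.eq_one_iff x).1 hx)
  rw [← isPEl_map_iff _ h, ← isPEl_map_iff _ h g, map_mul,
    show QuotientGroup.mk' Y y = 1 from (QuotientGroup.eq_one_iff y).2 hy, mul_one]

theorem CentralSetup.mem_span_of_extension {p : ℕ} {G H Z : Type} [Group G] [Group H]
    [Group Z] [Fintype G] {π : G →* H} {ι : Z →* G} {l : Z →* ℂˣ} (S : CentralSetup p π ι l)
    (IH : SpanBelow p (Nat.card H)) (Y : Subgroup G) [Y.Normal] (hker : π.ker < Y)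
    (hYp : ∀ y ∈ Y, IsPEl p y) (hYc : ∀ x ∈ Y, ∀ y ∈ Y, x * y = y * x) (θ : Y →* ℂˣ)
    {u : G → ℂ} (supp : ∀ g, ¬ IsPEl p g → u g = 0) (hu : ∀ g (y : Y), u (g * y) = θ y * u g)
    (hconj : ∀ t, (∀ y, θ (MulAut.conjNormal t y) = θ y) → ∀ g, u (t * g * t⁻¹) = u g)
    (hcov : ∀ z g, u (ι z * g) = l z * u g) :
    (fun g => ∑ x : G, u (x⁻¹ * g * x)) ∈ Submodule.span ℂ (coverRestr p ι l) := by
  have hιY : ∀ z, ι z ∈ Y := fun z => hker.le ((S.ker _).2 ⟨z, rfl⟩)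
  by_cases hθ : ∀ z, θ ⟨ι z, hιY z⟩ = l z
  swap
  · push Not at hθ
    obtain ⟨z, hz⟩ := hθ
    have hu0 : ∀ g, u g = 0 := fun g => by
      have h1 := hu g ⟨ι z, hιY z⟩
      rw [← S.central, hcov] at h1
      by_contra hne
      exact hz (Units.ext (mul_right_cancel₀ hne h1).symm)
    simp only [hu0, Finset.sum_const_zero]
    exact Submodule.zero_mem _
  let T : Subgroup G :=
    { carrier := {t | ∀ y, θ (MulAut.conjNormal t y) = θ y}
      one_mem' := fun y => by simp
      mul_mem' := fun {a b} ha hb y => by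
        rw [map_mul, MulAut.mul_apply, ha, hb]
      inv_mem' := fun {a} ha y => by
        rw [← ha, ← MulAut.mul_apply, ← map_mul]; simp }
  have hTmem : ∀ t, t ∈ T ↔ ∀ y, θ (MulAut.conjNormal t y) = θ y := fun t => Iff.rfl
  have hYT : Y ≤ T := fun x hx y => by
    congr 1
    apply Subtype.ext
    rw [MulAut.conjNormal_apply, hYc x hx y y.2]; simp
  have hoff : ∀ g, g ∉ T → u g = 0 := fun g hg => by
    by_contra hne
    apply hg
    rw [← T.inv_mem_iff]
    intro y
    have h1 := hconj y (hYT y.2) g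
    have h2 : (y : G) * g * (y : G)⁻¹ = g * ((MulAut.conjNormal g⁻¹ y * y⁻¹ : Y) : G) := by
      rw [Subgroup.coe_mul, MulAut.conjNormal_apply, Subgroup.coe_inv]; group
    rw [h2, hu] at h1
    have h3 := mul_right_cancel₀ hne (h1.trans (one_mul _).symm)
    rw [Units.val_eq_one, map_mul θ, map_inv θ y] at h3
    exact mul_inv_eq_one.1 h3
  let j : Y →* T := Subgroup.inclusion hYT
  let N : Subgroup T := θ.ker.map j
  have hNmem : ∀ y, j y ∈ N ↔ θ y = 1 := fun y => by
    constructor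
    · rintro ⟨y', h1, h2⟩
      rw [← Subgroup.inclusion_injective hYT h2]; exact h1
    · exact fun h => ⟨y, h, rfl⟩
  have hNY : ∀ t ∈ N, ∃ y : Y, θ y = 1 ∧ j y = t := fun t ⟨y, h1, h2⟩ => ⟨y, h1, h2⟩
  have hNn : N.Normal := by
    refine ⟨fun n hn t => ?_⟩
    obtain ⟨y, h1, rfl⟩ := hNY n hn
    refine ⟨MulAut.conjNormal (t : G) y, (t.2 y).trans h1, Subtype.ext ?_⟩
    simp [j]
  let q := QuotientGroup.mk' N
  have hq : Function.Surjective q := QuotientGroup.mk'_surjective N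
  have hqN : ∀ x, q x = 1 ↔ x ∈ N := fun x => QuotientGroup.eq_one_iff x
  let Y' := Y.subgroupOf T
  have hNY' : N ≤ Y' := by
    intro t ht
    obtain ⟨y, -, rfl⟩ := hNY t ht
    exact y.2
  let π' : T ⧸ N →* T ⧸ Y' := QuotientGroup.map N Y' (MonoidHom.id T) hNY'
  have hπ' : ∀ t, π' (q t) = QuotientGroup.mk' Y' t := fun t => rfl
  have hqj : ∀ (y : Y) (t : T), q (j y) * q t = q t * q (j y) := fun y t => by
    rw [← map_mul, ← map_mul]
    refine QuotientGroup.eq.2 ?_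
    have : (j y * t)⁻¹ * (t * j y) = j ((MulAut.conjNormal ((t⁻¹ : T) : G) y⁻¹) * y) := by
      apply Subtype.ext
      simp [j, mul_assoc]
    rw [this, hNmem, map_mul, (t⁻¹).2, map_inv, inv_mul_cancel]
  have S' : CentralSetup p π' (q.comp j) θ := by
    refine ⟨?_, ?_, ?_, ?_, ?_, ?_⟩
    · intro h
      obtain ⟨t, rfl⟩ := QuotientGroup.mk'_surjective _ h
      exact ⟨q t, rfl⟩
    · intro g
      obtain ⟨t, rfl⟩ := hq g
      rw [hπ', QuotientGroup.mk'_apply, QuotientGroup.eq_one_iff]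
      constructor
      · intro ht
        exact ⟨⟨t, ht⟩, rfl⟩
      · rintro ⟨y, hy⟩
        have h1 : (j y)⁻¹ * t ∈ N := QuotientGroup.eq.1 hy
        have h2 : j y ∈ Y' := y.2
        simpa using Y'.mul_mem h2 (hNY' h1)
    · intro y g
      obtain ⟨t, rfl⟩ := hq g
      exact hqj y t
    · intro y
      rw [MonoidHom.comp_apply, hqN, hNmem]
    · rintro ⟨y, hy⟩
      obtain ⟨k, hk⟩ := hYp y hy
      have : IsPEl p (⟨y, hy⟩ : Y) := ⟨k, Subtype.ext hk⟩
      exact this.map _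
    · refine S.psep.section (π.comp T.subtype) (QuotientGroup.mk' Y')
        (QuotientGroup.mk'_surjective _) fun t ht => ?_
      rw [QuotientGroup.ker_mk']
      exact hker.le ht
  have hcard := card_quotient_subgroupOf_lt S.surj hYT hker
  let f' : T ⧸ N → ℂ := fun x => u (Function.surjInv hq x : T)
  have hf' : ∀ t : T, f' (q t) = u t := fun t => by
    have h1 : t⁻¹ * Function.surjInv hq (q t) ∈ N :=
      QuotientGroup.eq.1 (Function.surjInv_eq hq (q t)).symm
    obtain ⟨y, h2, h3⟩ := hNY _ h1
    have h4 : ((Function.surjInv hq (q t) : T) : G) = t * y := by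
      have : ((j y : T) : G) = y := rfl
      rw [← this, h3]; simp
    simp only [f', h4, hu, h2, Units.val_one, one_mul]
  have hcf : IsCoverFun p (q.comp j) θ f' := by
    refine ⟨fun x hx => ?_, fun y x => ?_, fun y x => ?_⟩
    · obtain ⟨t, rfl⟩ := hq x
      rw [hf']
      refine supp _ fun ⟨k, hk⟩ => hx ?_
      exact IsPEl.map ⟨k, Subtype.ext hk⟩ q
    · obtain ⟨t, rfl⟩ := hq x
      obtain ⟨s, rfl⟩ := hq y
      rw [← map_inv, ← map_mul, ← map_mul, hf', hf']
      exact hconj s s.2 t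
    · obtain ⟨t, rfl⟩ := hq x
      rw [MonoidHom.comp_apply, hqj, ← map_mul, hf', hf']
      exact hu t y
  have hspan := IH _ _ _ π' (q.comp j) θ S' hcard f' hcf
  let L : (T ⧸ N → ℂ) →ₗ[ℂ] (G → ℂ) :=
    { toFun := fun F g => ∑ x : G, if h : x⁻¹ * g * x ∈ T then F (q ⟨_, h⟩) else 0
      map_add' := fun F F' => by
        funext g
        simp only [Pi.add_apply, ← Finset.sum_add_distrib]
        refine Finset.sum_congr rfl fun x _ => ?_
        split_ifs <;> simp
      map_smul' := fun c F => by
        funext g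
        simp only [Pi.smul_apply, smul_eq_mul, Finset.mul_sum, RingHom.id_apply]
        refine Finset.sum_congr rfl fun x _ => ?_
        split_ifs <;> simp }
  have hLapp : ∀ F g, L F g = ∑ x : G, if h : x⁻¹ * g * x ∈ T then F (q ⟨_, h⟩) else 0 :=
    fun F g => rfl
  have hL : L f' = fun g => ∑ x : G, u (x⁻¹ * g * x) := by
    funext g
    rw [hLapp]
    refine Finset.sum_congr rfl fun x _ => ?_
    split_ifs with h
    · exact hf' _
    · exact (hoff _ h).symm
  rw [← hL]
  refine span_transfer L ?_ hspan
  rintro _ ⟨χ, h1, h2, rfl⟩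
  have hT0 : (Fintype.card T : ℂ) ≠ 0 := Nat.cast_ne_zero.2 Fintype.card_ne_zero
  have hind := (h1.inflate q hq).induce T Y hYT θ (fun w hw => hw) (fun y t => by
    rw [map_mul]; exact h2 y _)
  have hqp : ∀ t : T, IsPEl p (q t) ↔ IsPEl p (t : G) := fun t => by
    rw [isPEl_map_iff q, ← isPEl_map_iff T.subtype (g := t)]
    · rfl
    · intro x hx
      exact ⟨0, by simpa using hx⟩
    · intro x hx
      obtain ⟨y, -, rfl⟩ := hNY x ((hqN x).1 hx)
      obtain ⟨k, hk⟩ := hYp y y.2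
      exact ⟨k, Subtype.ext hk⟩
  have hmem : (fun g => if IsPEl p g then (Fintype.card T : ℂ)⁻¹ *
      ∑ x : G, (if h : x⁻¹ * g * x ∈ T then χ (q ⟨_, h⟩) else 0) else 0) ∈ coverRestr p ι l := by
    refine ⟨_, hind, fun z g => ?_, rfl⟩
    rw [mul_left_comm (l z : ℂ)]
    congr 1
    rw [Finset.mul_sum]
    refine Finset.sum_congr rfl fun x _ => ?_
    have h3 : x⁻¹ * (ι z * g) * x = ι z * (x⁻¹ * g * x) := by
      rw [← mul_assoc, ← S.central z x⁻¹]; group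
    have h4 : ι z * (x⁻¹ * g * x) ∈ T ↔ x⁻¹ * g * x ∈ T :=
      T.mul_mem_cancel_left (hYT (hιY z))
    simp only [h3, h4]
    split_ifs with h
    · rw [← hθ z, ← h2]
      rfl
    · simp
  have hLF : L (fun g => if IsPEl p g then χ g else 0) = (Fintype.card T : ℂ) •
      (fun g => if IsPEl p g then (Fintype.card T : ℂ)⁻¹ *
      ∑ x : G, (if h : x⁻¹ * g * x ∈ T then χ (q ⟨_, h⟩) else 0) else 0) := by
    funext g
    rw [hLapp, Pi.smul_apply, smul_eq_mul]
    have h5 : ∀ x, IsPEl p (x⁻¹ * g * x) ↔ IsPEl p g := fun x => by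
      simpa using isPEl_conj_iff (p := p) (g := g) x⁻¹
    simp only [hqp, h5]
    split_ifs with h
    · rw [mul_inv_cancel_left₀ hT0]
    · simp
  rw [hLF]
  exact Submodule.smul_mem _ _ (Submodule.subset_span hmem)

theorem CentralSetup.mem_span_of_abelian {p : ℕ} {G H Z : Type} [Group G] [Group H]
    [Group Z] [Fintype G] {π : G →* H} {ι : Z →* G} {l : Z →* ℂˣ} (S : CentralSetup p π ι l)
    (IH : SpanBelow p (Nat.card H)) (Y : Subgroup G) [Y.Normal] (hker : π.ker < Y)
    (hYp : ∀ y ∈ Y, IsPEl p y) (hYc : ∀ x ∈ Y, ∀ y ∈ Y, x * y = y * x)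
    {f : G → ℂ} (hf : IsCoverFun p ι l f) :
    f ∈ Submodule.span ℂ (coverRestr p ι l) := by
  let _ : CommGroup Y := { (inferInstance : Group Y) with
    mul_comm := fun a b => Subtype.ext (hYc a a.2 b b.2) }
  let Θ : AddChar (Additive Y) ℂ → (Y →* ℂˣ) := fun ψ => MonoidHom.toHomUnits
    ⟨⟨fun y => ψ (Additive.ofMul y), ψ.map_zero_eq_one⟩, fun a b => ψ.map_add_eq_mul _ _⟩
  have hΘ : ∀ ψ y, (Θ ψ y : ℂ) = ψ (Additive.ofMul y) := fun ψ y => rfl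
  have hsum : ∀ y : Y, ∑ ψ, (Θ ψ y : ℂ) = if y = 1 then (Fintype.card Y : ℂ) else 0 := fun y => by
    simp only [hΘ]
    rw [AddChar.sum_apply_eq_ite (Additive.ofMul y)]
    have : (Additive.ofMul y = 0) ↔ y = 1 := Iff.rfl
    simp only [this]
    congr 2
    exact Fintype.card_congr Additive.toMul
  have hY0 : (Fintype.card Y : ℂ) ≠ 0 := Nat.cast_ne_zero.2 Fintype.card_ne_zero
  have hG0 : (Fintype.card G : ℂ) ≠ 0 := Nat.cast_ne_zero.2 Fintype.card_ne_zero
  let u : AddChar (Additive Y) ℂ → G → ℂ := fun ψ g =>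
    (Fintype.card Y : ℂ)⁻¹ * ∑ y : Y, f (g * y) * (Θ ψ y⁻¹ : ℂ)
  have husum : ∀ g, ∑ ψ, u ψ g = f g := fun g => by
    simp only [u, ← Finset.mul_sum]
    rw [Finset.sum_comm]
    simp only [← Finset.mul_sum, hsum, inv_eq_one, mul_ite, mul_zero]
    rw [Finset.sum_ite_eq']
    simp only [Finset.mem_univ, if_true, Subgroup.coe_one, mul_one]
    field_simp
  have hmem : ∀ ψ, (fun g => ∑ x : G, u ψ (x⁻¹ * g * x)) ∈
      Submodule.span ℂ (coverRestr p ι l) := fun ψ => by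
    refine S.mem_span_of_extension IH Y hker hYp hYc (Θ ψ) (fun g hg => ?_) (fun g y => ?_)
      (fun t ht g => ?_) fun z g => ?_
    · simp only [u]
      rw [Finset.sum_eq_zero, mul_zero]
      intro y _
      rw [hf.supp _ (by rwa [isPEl_mul_iff hYp y.2]), zero_mul]
    · simp only [u]
      rw [mul_left_comm]
      congr 1
      rw [Finset.mul_sum, ← Equiv.sum_comp (Equiv.mulLeft y⁻¹)]
      refine Finset.sum_congr rfl fun w _ => ?_
      simp only [Equiv.coe_mulLeft, mul_inv_rev, inv_inv, map_mul, Units.val_mul,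
        Subgroup.coe_mul, Subgroup.coe_inv]
      rw [mul_assoc g, mul_inv_cancel_left]
      ring
    · simp only [u]
      congr 1
      rw [← Equiv.sum_comp (MulAut.conjNormal t).toEquiv]
      refine Finset.sum_congr rfl fun w _ => ?_
      simp only [MulEquiv.toEquiv_eq_coe, EquivLike.coe_coe, ← map_inv, ht,
        MulAut.conjNormal_apply]
      rw [← hf.conj t (g * w)]
      congr 2
      group
    · simp only [u]
      rw [mul_left_comm]
      congr 1
      rw [Finset.mul_sum]
      refine Finset.sum_congr rfl fun w _ => ?_
      rw [mul_assoc, hf.cov]; ring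
  have : f = (Fintype.card G : ℂ)⁻¹ • ∑ ψ, (fun g => ∑ x : G, u ψ (x⁻¹ * g * x)) := by
    funext g
    rw [Pi.smul_apply, Finset.sum_apply, Finset.sum_comm]
    simp only [husum]
    have h1 : ∀ x, f (x⁻¹ * g * x) = f g := fun x => by
      simpa using hf.conj x⁻¹ g
    simp only [h1]
    simp [hG0]
  rw [this]
  exact Submodule.smul_mem _ _ (Submodule.sum_mem _ fun ψ _ => hmem ψ)

/-- A matrix representation all of whose self-intertwiners are scalar, on which the subgroup `A`
acts by the character `μ`, and whose character vanishes off `A`. -/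
structure FullyRamified {M : Type} [Group M] (A : Subgroup M) (μ : A →* ℂˣ) {n : Type} [Fintype n]
    (ρ : M →* Matrix n n ℂ) : Prop where
  scalar : ∀ a : A, ρ a = (μ a : ℂ) • (1 : Matrix n n ℂ)
  schur : ∀ X, (∀ m, X * ρ m = ρ m * X) → ∃ c : ℂ, X = c • (1 : Matrix n n ℂ)
  trace_zero : ∀ m, m ∉ A → (ρ m).trace = 0

theorem exists_schur_rep {M : Type} [Group M] [Fintype M] (A : Subgroup M)
    (hA : ∀ a ∈ A, ∀ m, a * m = m * a) (μ : A →* ℂˣ) :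
    ∃ (n : Type) (_ : Fintype n) (ρ : M →* Matrix n n ℂ), Nonempty n ∧
      (∀ a : A, ρ a = (μ a : ℂ) • (1 : Matrix n n ℂ)) ∧
      ∀ X, (∀ m, X * ρ m = ρ m * X) → ∃ c : ℂ, X = c • (1 : Matrix n n ℂ) := by
  let R : M →* Module.End ℂ (M → ℂ) :=
    { toFun := fun g =>
        { toFun := fun f m => f (m * g)
          map_add' := fun f f' => rfl
          map_smul' := fun c f => rfl }
      map_one' := by ext; simp
      map_mul' := fun g h => by
        refine LinearMap.ext fun f => funext fun m => ?_
        simp [mul_assoc] }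
  have hR : ∀ g f m, R g f m = f (m * g) := fun g f m => rfl
  let V : Submodule ℂ (M → ℂ) :=
    { carrier := {f | ∀ (a : A) m, f (a * m) = μ a * f m}
      add_mem' := fun {f g} hf hg a m => by simp [hf a m, hg a m, mul_add]
      zero_mem' := fun a m => by simp
      smul_mem' := fun c f hf a m => by simp [hf a m, mul_left_comm] }
  have hVR : ∀ g, ∀ f ∈ V, R g f ∈ V := fun g f hf a m => by
    rw [hR, hR, mul_assoc, hf]
  have hV : V ≠ ⊥ := by
    intro h
    have : (fun m => if h : m ∈ A then (μ ⟨m, h⟩ : ℂ) else 0) ∈ V := by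
      intro a m
      by_cases hm : m ∈ A
      · have h1 : (⟨a * m, A.mul_mem a.2 hm⟩ : A) = a * ⟨m, hm⟩ := rfl
        simp only [dif_pos hm, dif_pos (A.mul_mem a.2 hm), h1, map_mul, Units.val_mul]
      · have hm' : (a : M) * m ∉ A := fun h' => hm ((A.mul_mem_cancel_left a.2).1 h')
        simp only [dif_neg hm, dif_neg hm', mul_zero]
    rw [h, Submodule.mem_bot] at this
    have := congrFun this 1
    simp only [A.one_mem, dif_pos, Pi.zero_apply] at this
    exact Units.ne_zero _ this
  obtain ⟨W, ⟨hWV, hW0, hWR⟩, hmin⟩ := (wellFounded_lt (α := Submodule ℂ (M → ℂ))).has_min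
    {W | W ≤ V ∧ W ≠ ⊥ ∧ ∀ g, ∀ f ∈ W, R g f ∈ W} ⟨V, le_rfl, hV, hVR⟩
  let S : M →* Module.End ℂ W :=
    { toFun := fun g => (R g).restrict (hWR g)
      map_one' := by
        refine LinearMap.ext fun f => Subtype.ext ?_
        simp
      map_mul' := fun g h => by
        refine LinearMap.ext fun f => Subtype.ext ?_
        simp }
  have hS : ∀ g (w : W), ((S g w : W) : M → ℂ) = R g w := fun g w => rfl
  have hSA : ∀ a : A, S a = (μ a : ℂ) • (1 : Module.End ℂ W) := fun a => by
    refine LinearMap.ext fun f => Subtype.ext (funext fun m => ?_)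
    rw [hS, hR, ← hA a a.2, hWV f.2]
    rfl
  have hnt : Nontrivial W := (Submodule.nontrivial_iff_ne_bot).2 hW0
  have hschur : ∀ X : Module.End ℂ W, (∀ m, X * S m = S m * X) →
      ∃ c : ℂ, X = c • (1 : Module.End ℂ W) := fun X hX => by
    obtain ⟨c, hc⟩ := Module.End.exists_eigenvalue X
    refine ⟨c, ?_⟩
    have hE : (X.eigenspace c).map W.subtype = W := by
      by_contra hne
      refine hmin ((X.eigenspace c).map W.subtype) ⟨?_, ?_, ?_⟩
        (lt_of_le_of_ne (Submodule.map_subtype_le _ _) hne)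
      · exact (Submodule.map_subtype_le _ _).trans hWV
      · intro hb
        rw [← Submodule.map_bot W.subtype] at hb
        exact hc (Submodule.map_injective_of_injective W.subtype_injective hb)
      · rintro g _ ⟨w, hw, rfl⟩
        refine ⟨S g w, ?_, rfl⟩
        have hw' := Module.End.mem_eigenspace_iff.1 hw
        refine Module.End.mem_eigenspace_iff.2 ?_
        rw [← Module.End.mul_apply, hX, Module.End.mul_apply, hw', map_smul]
    refine LinearMap.ext fun w => ?_
    have : (w : M → ℂ) ∈ (X.eigenspace c).map W.subtype := by rw [hE]; exact w.2
    obtain ⟨w', hw', hww⟩ := this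
    rw [← Subtype.ext hww]
    exact Module.End.mem_eigenspace_iff.1 hw'
  let b := Module.Free.chooseBasis ℂ W
  let e := LinearMap.toMatrixAlgEquiv b
  refine ⟨Module.Free.ChooseBasisIndex ℂ W, inferInstance, (e : Module.End ℂ W →* _).comp S,
    b.index_nonempty, fun a => ?_, fun X hX => ?_⟩
  · change e (S a) = _
    rw [hSA, map_smul, map_one]
  · obtain ⟨c, hc⟩ := hschur (e.symm X) fun m => by
      apply e.injective
      rw [map_mul, map_mul, e.apply_symm_apply]
      exact hX m
    refine ⟨c, ?_⟩
    rw [← e.apply_symm_apply X, hc, map_smul, map_one]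

section
variable {M : Type} [Group M] [Fintype M] {n : Type} [Fintype n] [Nonempty n]
  {ρ : M →* Matrix n n ℂ}

theorem sum_conj_eq_smul_one
    (hρ : ∀ X, (∀ m, X * ρ m = ρ m * X) → ∃ c : ℂ, X = c • (1 : Matrix n n ℂ))
    (Y : Matrix n n ℂ) :
    ∑ m, ρ m * Y * ρ m⁻¹ =
      ((Fintype.card M : ℂ) / Fintype.card n * Y.trace) • (1 : Matrix n n ℂ) := by
  have hd : (Fintype.card n : ℂ) ≠ 0 := Nat.cast_ne_zero.2 Fintype.card_ne_zero
  obtain ⟨c, hc⟩ := hρ (∑ m, ρ m * Y * ρ m⁻¹) fun x => by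
    rw [Finset.sum_mul, Finset.mul_sum, ← Equiv.sum_comp (Equiv.mulLeft x)]
    refine Finset.sum_congr rfl fun m _ => ?_
    simp only [Equiv.coe_mulLeft, mul_inv_rev, map_mul, mul_assoc, ← map_mul ρ x⁻¹ x,
      inv_mul_cancel, map_one, mul_one]
  have ht := congrArg Matrix.trace hc
  rw [Matrix.trace_sum, Matrix.trace_smul, Matrix.trace_one] at ht
  have h1 : ∀ m, (ρ m * Y * ρ m⁻¹).trace = Y.trace := fun m => by
    rw [Matrix.trace_mul_comm, ← mul_assoc, ← map_mul, inv_mul_cancel, map_one, one_mul]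
  simp only [h1, Finset.sum_const, Finset.card_univ, nsmul_eq_mul, smul_eq_mul] at ht
  rw [hc]
  congr 1
  field_simp
  rw [ht]

theorem sum_trace_smul_eq
    (hρ : ∀ X, (∀ m, X * ρ m = ρ m * X) → ∃ c : ℂ, X = c • (1 : Matrix n n ℂ))
    (X : Matrix n n ℂ) :
    ∑ m, (X * ρ m).trace • ρ m⁻¹ = ((Fintype.card M : ℂ) / Fintype.card n) • X := by
  ext i j
  have key : ∀ a b, ∑ m, ρ m b a * ρ m⁻¹ i j =
      if a = i ∧ b = j then (Fintype.card M : ℂ) / Fintype.card n else 0 := fun a b => by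
    have h := congrFun (congrFun (sum_conj_eq_smul_one hρ (Matrix.single a i 1)) b) j
    rw [Matrix.sum_apply, Matrix.smul_apply, Matrix.one_apply] at h
    have h2 : ∀ m, (ρ m * Matrix.single a i (1 : ℂ) * ρ m⁻¹ : Matrix n n ℂ) b j =
        ρ m b a * ρ m⁻¹ i j := fun m => by
      rw [Matrix.mul_apply, Finset.sum_eq_single i]
      · rw [Matrix.mul_single_apply_same]; simp
      · intro k _ hk
        rw [Matrix.mul_single_apply_of_ne _ _ _ _ _ hk.symm.symm, zero_mul]
      · simp
    simp only [h2] at h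
    rw [h]
    by_cases hai : a = i
    · subst hai
      by_cases hbj : b = j <;> simp [hbj]
    · simp [hai, Matrix.trace_single_eq_of_ne a i (1 : ℂ) hai]
  simp only [Matrix.sum_apply, Matrix.smul_apply, smul_eq_mul, Matrix.trace, Matrix.diag_apply,
    Matrix.mul_apply, Finset.sum_mul]
  rw [Finset.sum_comm]
  have h3 : ∀ a, ∑ m, ∑ b, X a b * ρ m b a * ρ m⁻¹ i j =
      ∑ b, X a b * (if a = i ∧ b = j then (Fintype.card M : ℂ) / Fintype.card n else 0) :=
    fun a => by
    rw [Finset.sum_comm]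
    refine Finset.sum_congr rfl fun b _ => ?_
    rw [← key, Finset.mul_sum]
    simp only [mul_assoc]
  simp only [h3]
  rw [Finset.sum_eq_single i, Finset.sum_eq_single j]
  · simp [mul_comm]
  · intro b _ hb; simp [hb]
  · simp
  · intro a _ ha; simp [ha]
  · simp

theorem sum_trace_mul_trace
    (hρ : ∀ X, (∀ m, X * ρ m = ρ m * X) → ∃ c : ℂ, X = c • (1 : Matrix n n ℂ))
    (X Y : Matrix n n ℂ) :
    ∑ m, (X * ρ m).trace * (ρ m⁻¹ * Y).trace =
      (Fintype.card M : ℂ) / Fintype.card n * (X * Y).trace := by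
  have h := congrArg (fun W => (W * Y).trace) (sum_trace_smul_eq hρ X)
  simpa [Finset.sum_mul, Matrix.trace_sum] using h

theorem sum_trace_mul_trace_of_mul_eq_one
    (hρ : ∀ X, (∀ m, X * ρ m = ρ m * X) → ∃ c : ℂ, X = c • (1 : Matrix n n ℂ))
    {X Y : Matrix n n ℂ} (h : X * Y = 1) :
    ∑ m, (X * ρ m).trace * (ρ m⁻¹ * Y).trace = Fintype.card M := by
  have hd : (Fintype.card n : ℂ) ≠ 0 := Nat.cast_ne_zero.2 Fintype.card_ne_zero
  rw [sum_trace_mul_trace hρ, h, Matrix.trace_one]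
  field_simp

/-- Two matrix representations with the same character, one of which satisfies Schur's lemma, are
intertwined by an invertible matrix. -/
theorem exists_intertwiner
    (hρ : ∀ X, (∀ m, X * ρ m = ρ m * X) → ∃ c : ℂ, X = c • (1 : Matrix n n ℂ))
    (ρ' : M →* Matrix n n ℂ) (htr : ∀ m, (ρ' m).trace = (ρ m).trace) :
    ∃ U : (Matrix n n ℂ)ˣ, ∀ m, (U : Matrix n n ℂ) * ρ m = ρ' m * U := by
  let T : Matrix n n ℂ → Matrix n n ℂ := fun Y => ∑ m, ρ' m * Y * ρ m⁻¹
  have hT : ∀ Y x, T Y * ρ x = ρ' x * T Y := fun Y x => by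
    simp only [T]
    rw [Finset.sum_mul, Finset.mul_sum, ← Equiv.sum_comp (Equiv.mulLeft x)]
    refine Finset.sum_congr rfl fun m _ => ?_
    simp only [Equiv.coe_mulLeft, mul_inv_rev, map_mul, mul_assoc, ← map_mul ρ x⁻¹ x,
      inv_mul_cancel, map_one, mul_one]
  obtain ⟨Y, hY⟩ : ∃ Y, T Y ≠ 0 := by
    by_contra! h
    have h1 : ∑ j, ∑ k, T (Matrix.single j k 1) j k = Fintype.card M := by
      have h2 : ∀ j k, T (Matrix.single j k 1) j k = ∑ m, ρ' m j j * ρ m⁻¹ k k := fun j k => by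
        simp only [T, Matrix.sum_apply]
        refine Finset.sum_congr rfl fun m _ => ?_
        rw [Matrix.mul_apply, Finset.sum_eq_single k]
        · rw [Matrix.mul_single_apply_same]; simp
        · intro i _ hi
          rw [Matrix.mul_single_apply_of_ne _ _ _ _ _ hi, zero_mul]
        · simp
      simp only [h2]
      have h3 := sum_trace_mul_trace_of_mul_eq_one hρ (one_mul (1 : Matrix n n ℂ))
      simp only [one_mul, mul_one, ← htr] at h3
      rw [← h3]
      simp only [htr]
      rw [Finset.sum_congr rfl fun j _ => Finset.sum_comm, Finset.sum_comm]
      refine Finset.sum_congr rfl fun m _ => ?_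
      rw [← htr m]
      simp only [Matrix.trace, Matrix.diag_apply, Finset.sum_mul_sum]
    simp only [h, Matrix.zero_apply, Finset.sum_const_zero] at h1
    exact Nat.cast_ne_zero.2 Fintype.card_ne_zero h1.symm
  obtain ⟨a, b, hab⟩ : ∃ a b, T Y a b ≠ 0 := by
    by_contra! h
    exact hY (Matrix.ext h)
  let T' : Matrix n n ℂ := ∑ m, ρ m * Matrix.single b a 1 * ρ' m⁻¹
  have hprod : T' * T Y = ((Fintype.card M : ℂ) / Fintype.card n * T Y a b) •
      (1 : Matrix n n ℂ) := by
    have h1 : T' * T Y = ∑ m, ρ m * (Matrix.single b a 1 * T Y) * ρ m⁻¹ := by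
      simp only [T', Finset.sum_mul]
      refine Finset.sum_congr rfl fun m _ => ?_
      rw [mul_assoc, ← hT, ← mul_assoc, mul_assoc (ρ m)]
    rw [h1, sum_conj_eq_smul_one hρ]
    congr 2
    rw [Matrix.trace, Finset.sum_eq_single b]
    · simp
    · intro i _ hi
      simp [Matrix.single_mul_apply_of_ne _ _ _ _ _ hi]
    · simp
  have hd : (Fintype.card n : ℂ) ≠ 0 := Nat.cast_ne_zero.2 Fintype.card_ne_zero
  have hM : (Fintype.card M : ℂ) ≠ 0 := Nat.cast_ne_zero.2 Fintype.card_ne_zero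
  set c := (Fintype.card M : ℂ) / Fintype.card n * T Y a b with hc
  have hc0 : c ≠ 0 := mul_ne_zero (div_ne_zero hM hd) hab
  have hl : (c⁻¹ • T') * T Y = 1 := by
    rw [smul_mul_assoc, hprod, smul_smul, inv_mul_cancel₀ hc0, one_smul]
  exact ⟨⟨T Y, c⁻¹ • T', mul_eq_one_comm.1 hl, hl⟩, hT Y⟩

theorem FullyRamified.card_mul_sq {A : Subgroup M} {μ : A →* ℂˣ} (h : FullyRamified A μ ρ) :
    Fintype.card A * Fintype.card n ^ 2 = Fintype.card M := by
  have h1 := sum_trace_mul_trace_of_mul_eq_one h.schur (one_mul (1 : Matrix n n ℂ))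
  simp only [one_mul, mul_one] at h1
  have h2 : ∑ m, (ρ m).trace * (ρ m⁻¹).trace = ∑ m : A, (ρ m).trace * (ρ (m : M)⁻¹).trace := by
    rw [← Finset.sum_subtype (Finset.univ.filter (· ∈ A)) (by simp)
      (fun m => (ρ m).trace * (ρ m⁻¹).trace), Finset.sum_filter]
    refine Finset.sum_congr rfl fun m _ => ?_
    split_ifs with hm
    · rfl
    · rw [h.trace_zero m hm, zero_mul]
  have h3 : ∀ a : A, (ρ a).trace * (ρ (a : M)⁻¹).trace = (Fintype.card n : ℂ) ^ 2 := fun a => by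
    rw [← Subgroup.coe_inv, h.scalar, h.scalar, Matrix.trace_smul, Matrix.trace_smul,
      Matrix.trace_one, map_inv]
    simp only [smul_eq_mul, Units.val_inv_eq_inv_val]
    field_simp
  rw [h2] at h1
  simp only [h3, Finset.sum_const, Finset.card_univ, nsmul_eq_mul] at h1
  exact_mod_cast h1

end

/-- A central extension `q : E →* G`, with kernel the group `κ.range` of scalars, carrying an
extension `σ` of the representation `ρ` of the normal subgroup `M`. -/
structure CliffordLift {G : Type} [Group G] [Fintype G] (M : Subgroup G) [M.Normal] {n : Type}
    [Fintype n] (ρ : M →* Matrix n n ℂ) {E C : Type} [Group E] [Group C] (q : E →* G)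
    (σ : E →* Matrix n n ℂ) (j : M →* E) (κ : C →* E) (ν : C →* ℂˣ) : Prop where
  surj : Function.Surjective q
  q_j : ∀ m, q (j m) = m
  σ_j : ∀ m, σ (j m) = ρ m
  conj : ∀ x m, x * j m * x⁻¹ = j (MulAut.conjNormal (q x) m)
  ker : ∀ x, q x = 1 ↔ ∃ c, κ c = x
  σ_κ : ∀ c, σ (κ c) = (ν c : ℂ) • (1 : Matrix n n ℂ)
  inj : ∀ c, ν c = 1 → c = 1
  central : ∀ c x, κ c * x = x * κ c
  det : ∀ x, (σ x).det ^ Nat.card M = 1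

theorem exists_cliffordLift {G : Type} [Group G] [Fintype G] (M : Subgroup G) [M.Normal]
    {n : Type} [Fintype n] [Nonempty n] (ρ : M →* Matrix n n ℂ)
    (hρ : ∀ X, (∀ m, X * ρ m = ρ m * X) → ∃ c : ℂ, X = c • (1 : Matrix n n ℂ))
    (htr : ∀ g m, (ρ (MulAut.conjNormal g m)).trace = (ρ m).trace) :
    ∃ (E C : Type) (_ : Group E) (_ : Group C) (_ : Fintype E) (q : E →* G)
      (σ : E →* Matrix n n ℂ) (j : M →* E) (κ : C →* E) (ν : C →* ℂˣ),
      CliffordLift M ρ q σ j κ ν := by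
  have hn : Fintype.card n ≠ 0 := Fintype.card_ne_zero
  let E : Subgroup (G × (Matrix n n ℂ)ˣ) :=
    { carrier := {x | (∀ m, (x.2 : Matrix n n ℂ) * ρ m = ρ (MulAut.conjNormal x.1 m) * x.2) ∧
        (x.2 : Matrix n n ℂ).det ^ Nat.card M = 1}
      mul_mem' := fun {x y} hx hy => ⟨fun m => by
        rw [Prod.snd_mul, Prod.fst_mul, Units.val_mul, mul_assoc, hy.1, ← mul_assoc, hx.1,
          mul_assoc, map_mul]
        rfl, by
        rw [Prod.snd_mul, Units.val_mul, Matrix.det_mul, mul_pow, hx.2, hy.2, one_mul]⟩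
      one_mem' := ⟨fun m => by simp, by simp⟩
      inv_mem' := fun {x} hx => ⟨fun m => by
        have h := hx.1 (MulAut.conjNormal x.1⁻¹ m)
        rw [← MulAut.mul_apply, ← map_mul, mul_inv_cancel, map_one, MulAut.one_apply] at h
        rw [Prod.snd_inv, Prod.fst_inv, Units.inv_mul_eq_iff_eq_mul, ← mul_assoc, h, mul_assoc,
          Units.mul_inv, mul_one], by
        have h : ((x⁻¹).2 : Matrix n n ℂ).det * (x.2 : Matrix n n ℂ).det = 1 := by
          rw [← Matrix.det_mul, Prod.snd_inv, Units.inv_mul, Matrix.det_one]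
        have h2 := congrArg (· ^ Nat.card M) h
        simp only [mul_pow, one_pow] at h2
        rwa [show (x.2 : Matrix n n ℂ).det ^ Nat.card M = 1 from hx.2, mul_one] at h2⟩ }
  have hEext : ∀ x y : E, x.1.1 = y.1.1 → (x.1.2 : Matrix n n ℂ) = y.1.2 → x = y :=
    fun x y h1 h2 => Subtype.ext (Prod.ext h1 (Units.ext h2))
  let q : E →* G := (MonoidHom.fst _ _).comp E.subtype
  let σ : E →* Matrix n n ℂ := (Units.coeHom _).comp ((MonoidHom.snd _ _).comp E.subtype)
  have hC0 : NeZero (Fintype.card n * Nat.card M) := ⟨mul_ne_zero hn Nat.card_pos.ne'⟩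
  let C := rootsOfUnity (Fintype.card n * Nat.card M) ℂ
  let κ0 : C →* (Matrix n n ℂ)ˣ :=
    (Units.map ((Matrix.scalar n : ℂ →+* Matrix n n ℂ) : ℂ →* Matrix n n ℂ)).comp C.subtype
  have hκ0 : ∀ c : C, (κ0 c : Matrix n n ℂ) = ((c : ℂˣ) : ℂ) • (1 : Matrix n n ℂ) := fun c => by
    rw [Matrix.smul_one_eq_diagonal]; rfl
  let κ : C →* E := MonoidHom.codRestrict ((MonoidHom.inr G _).comp κ0) E fun c => by
    refine ⟨fun m => ?_, ?_⟩
    · simp [hκ0]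
    · have : ((c : ℂˣ) : ℂ) ^ (Fintype.card n * Nat.card M) = 1 := by
        rw [← Units.val_pow_eq_pow_val, (mem_rootsOfUnity _ _).1 c.2, Units.val_one]
      change (κ0 c : Matrix n n ℂ).det ^ Nat.card M = 1
      rw [hκ0, Matrix.det_smul, Matrix.det_one, mul_one, ← pow_mul, this]
  have hρdet : ∀ m, (ρ m).det ^ Nat.card M = 1 := fun m => by
    rw [← Matrix.det_pow, ← map_pow, pow_card_eq_one', map_one, Matrix.det_one]
  let j : M →* E := MonoidHom.codRestrict (M.subtype.prod ρ.toHomUnits) E fun m => by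
    refine ⟨fun x => ?_, hρdet m⟩
    change ρ m * ρ x = ρ _ * ρ m
    rw [← map_mul, ← map_mul]
    congr 1
    refine Subtype.ext ?_
    simp
  have hker : ∀ x, q x = 1 ↔ ∃ c, κ c = x := fun x => by
    constructor
    · intro hx
      have hx' : x.1.1 = 1 := hx
      obtain ⟨c, hc⟩ := hρ x.1.2 fun m => by
        have := x.2.1 m
        rwa [hx', map_one, MulAut.one_apply] at this
      have hdet := x.2.2
      rw [hc, Matrix.det_smul, Matrix.det_one, mul_one, ← pow_mul] at hdet
      have hc0 : IsUnit c := IsUnit.of_pow_eq_one hdet hC0.out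
      obtain ⟨u, rfl⟩ := hc0
      refine ⟨⟨u, (mem_rootsOfUnity _ _).2 (Units.ext (by push_cast; exact hdet))⟩,
        hEext _ _ hx'.symm ?_⟩
      rw [hc]
      exact hκ0 _
    · rintro ⟨c, rfl⟩
      rfl
  have hsurj : Function.Surjective q := fun g => by
    obtain ⟨U, hU⟩ := exists_intertwiner hρ
      (ρ.comp (MulAut.conjNormal g : M ≃* M).toMonoidHom) (htr g)
    have hdet : (U : Matrix n n ℂ).det ≠ 0 := (Matrix.isUnit_iff_isUnit_det _).1 U.isUnit |>.ne_zero
    obtain ⟨t, ht⟩ := IsAlgClosed.exists_pow_nat_eq (U : Matrix n n ℂ).det⁻¹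
      (Nat.pos_of_ne_zero hn)
    have ht0 : t ≠ 0 := by
      rintro rfl
      rw [zero_pow hn] at ht
      exact inv_ne_zero hdet ht.symm
    refine ⟨⟨(g, Units.map ((Matrix.scalar n : ℂ →+* Matrix n n ℂ) : ℂ →* Matrix n n ℂ)
      (Units.mk0 t ht0) * U), ?_⟩, rfl⟩
    have hval : ((Units.map ((Matrix.scalar n : ℂ →+* Matrix n n ℂ) : ℂ →* Matrix n n ℂ)
      (Units.mk0 t ht0) * U : (Matrix n n ℂ)ˣ) : Matrix n n ℂ) = t • (U : Matrix n n ℂ) := by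
      rw [Units.val_mul, Matrix.smul_eq_diagonal_mul]; rfl
    refine ⟨fun m => ?_, ?_⟩
    · simp only [hval, smul_mul_assoc, mul_smul_comm, hU]
      rfl
    · simp only [hval, Matrix.det_smul, ht, inv_mul_cancel₀ hdet, one_pow]
  have hfin : Finite E := by
    have : Finite C := inferInstance
    refine Set.finite_univ_iff.1 (Set.Finite.of_finite_fibers q (Set.toFinite _) fun g _ => ?_)
    rw [Set.univ_inter]
    rcases (q ⁻¹' {g}).eq_empty_or_nonempty with h | ⟨x, hx⟩
    · rw [h]; exact Set.finite_empty
    · refine (Set.finite_range fun c => x * κ c).subset fun y hy => ?_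
      obtain ⟨c, hc⟩ := (hker (x⁻¹ * y)).1 (by
        rw [map_mul, map_inv, Set.mem_singleton_iff.1 hx, Set.mem_singleton_iff.1 hy,
          inv_mul_cancel])
      exact ⟨c, by simp only [hc, mul_inv_cancel_left]⟩
  refine ⟨E, C, inferInstance, inferInstance, Fintype.ofFinite E, q, σ, j, κ, C.subtype,
    hsurj, fun m => rfl, fun m => rfl, fun x m => ?_, hker, hκ0, fun c hc => Subtype.ext hc,
    fun c x => ?_, fun x => x.2.2⟩
  · rw [mul_inv_eq_iff_eq_mul]
    exact hEext _ _ (by simp [j, q]) (x.2.1 m)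
  · refine hEext _ _ ?_ ?_
    · change (1 : G) * x.1.1 = x.1.1 * 1
      simp
    · change (κ0 c : Matrix n n ℂ) * x.1.2 = x.1.2 * κ0 c
      simp [hκ0]

namespace CliffordLift
variable {G : Type} [Group G] [Fintype G] {M : Subgroup G} [M.Normal] {n : Type}
    [Fintype n] {ρ : M →* Matrix n n ℂ} {E C : Type} [Group E] [Group C] {q : E →* G}
    {σ : E →* Matrix n n ℂ} {j : M →* E} {κ : C →* E} {ν : C →* ℂˣ}

theorem normal_range (L : CliffordLift M ρ q σ j κ ν) : j.range.Normal :=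
  ⟨by rintro _ ⟨m, rfl⟩ x; exact ⟨_, (L.conj x m).symm⟩⟩

theorem σ_mul_ρ (L : CliffordLift M ρ q σ j κ ν) (x : E) (m : M) :
    σ x * ρ m = ρ (MulAut.conjNormal (q x) m) * σ x := by
  rw [← L.σ_j, ← L.σ_j, ← map_mul, ← map_mul, ← L.conj, inv_mul_cancel_right]

theorem isPEl_mul_j (L : CliffordLift M ρ q σ j κ ν) {p : ℕ} (hM : ∀ m : M, IsPEl p m) (x : E)
    (m : M) : IsPEl p (x * j m) ↔ IsPEl p x := by
  have := L.normal_range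
  refine isPEl_mul_iff (Y := j.range) ?_ ⟨m, rfl⟩
  rintro _ ⟨m, rfl⟩
  exact (hM m).map j

theorem map_trace_eq [Nonempty n] (L : CliffordLift M ρ q σ j κ ν) {p : ℕ} [Finite E]
    (hp : p.Prime) (hM : ∀ m : M, IsPEl p m)
    (hρ : ∀ X, (∀ m, X * ρ m = ρ m * X) → ∃ c : ℂ, X = c • (1 : Matrix n n ℂ))
    (hd : Fintype.card n ∣ Nat.card M) {s : ℂ ≃+* ℂ} (hs : FixesPRoots p s) (x : E) :
    s (σ x).trace = (σ x).trace := by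
  have : Fact p.Prime := ⟨hp⟩
  obtain ⟨k, hk⟩ := (IsPGroup.iff_card (p := p) (G := M)).1 hM
  let ms : Matrix n n ℂ →* Matrix n n ℂ :=
    ((s : ℂ →+* ℂ).mapMatrix : Matrix n n ℂ →+* Matrix n n ℂ).toMonoidHom
  have hms : ∀ X : Matrix n n ℂ, (ms X).trace = s X.trace := fun X =>
    (AddMonoidHom.map_trace (s : ℂ →+* ℂ) X).symm
  have htr : ∀ x : E, IsPEl p x → s (σ x).trace = (σ x).trace := fun x hx => by
    obtain ⟨k, hk⟩ := hx
    exact map_trace_eq_of_pow_eq_one (k := k) hs (by rw [← map_pow, hk, map_one])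
  obtain ⟨U, hU⟩ := exists_intertwiner hρ (ms.comp ρ) fun m => by
    rw [MonoidHom.comp_apply, hms, ← L.σ_j]
    exact htr _ ((hM m).map j)
  have hU' : ∀ m, (U : Matrix n n ℂ) * ρ m = ms (ρ m) * U := hU
  have key : ∀ x, ∃ c : ℂ, ms (σ x) * U = c • (U * σ x) := fun x => by
    have hinv : σ x * σ x⁻¹ = 1 := by rw [← map_mul, mul_inv_cancel, map_one]
    have h1 : ∀ m, σ x⁻¹ * ρ (MulAut.conjNormal (q x) m) = ρ m * σ x⁻¹ := fun m => by
      rw [L.σ_mul_ρ, ← MulAut.mul_apply, ← map_mul, ← map_mul, inv_mul_cancel, map_one, map_one,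
        MulAut.one_apply]
    obtain ⟨c, hc⟩ := hρ (σ x⁻¹ * (((U⁻¹ : (Matrix n n ℂ)ˣ) : Matrix n n ℂ) * (ms (σ x) * U)))
      fun m => by
        simp only [mul_assoc]
        rw [hU', ← mul_assoc (ms (σ x)), ← map_mul, L.σ_mul_ρ, map_mul, ← mul_assoc (ρ m), ← h1]
        simp only [mul_assoc]
        rw [← mul_assoc (U⁻¹ : (Matrix n n ℂ)ˣ).1 (ms (ρ _)), ← mul_assoc (ρ _) (U⁻¹ : _).1]
        congr 2
        rw [Units.inv_mul_eq_iff_eq_mul, ← mul_assoc, hU', mul_assoc, Units.mul_inv,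
          mul_one]
    refine ⟨c, ?_⟩
    have h2 := congrArg (fun X => (U : Matrix n n ℂ) * (σ x * X)) hc
    simp only [mul_smul_comm, mul_one] at h2
    rw [← h2, ← mul_assoc (σ x), hinv, one_mul, ← mul_assoc, Units.mul_inv, one_mul]
  obtain ⟨c, hc⟩ := key x
  have hdet0 : ∀ x, (σ x).det ≠ 0 := fun x h => by
    have := L.det x
    rw [h, zero_pow Nat.card_pos.ne'] at this
    exact zero_ne_one this
  have hUdet : (U : Matrix n n ℂ).det ≠ 0 := (Matrix.isUnit_iff_isUnit_det _).1 U.isUnit |>.ne_zero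
  have hcd : c ^ Fintype.card n = 1 := by
    have h1 := congrArg Matrix.det hc
    have h2 : (ms (σ x)).det = (σ x).det := by
      have h3 : (ms (σ x)).det = s (σ x).det := ((s : ℂ →+* ℂ).map_det (σ x)).symm
      rw [h3]
      exact hs _ k (by rw [← hk, L.det])
    rw [Matrix.det_smul, Matrix.det_mul, Matrix.det_mul, h2, mul_comm (σ x).det] at h1
    exact (mul_eq_right₀ (mul_ne_zero hUdet (hdet0 x))).1 h1.symm
  have hck : c ^ p ^ k = 1 := by
    obtain ⟨e, he⟩ := hd
    rw [← hk, he, pow_mul, hcd, one_pow]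
  have hpow : ∀ r : ℕ, ms (σ (x ^ r)) * U = c ^ r • (U * σ (x ^ r)) := fun r => by
    induction r with
    | zero => simp
    | succ r ih =>
      rw [pow_succ, map_mul, map_mul, mul_assoc, hc, mul_smul_comm, ← mul_assoc, ih,
        smul_mul_assoc, smul_smul, ← mul_assoc, pow_succ']
  have htrace : ∀ (X : Matrix n n ℂ) (b : ℂ), ms X * U = b • (U * X) → s X.trace = b * X.trace :=
    fun X b h => by
    have h1 := congrArg (fun Y => (Y * ((U⁻¹ : (Matrix n n ℂ)ˣ) : Matrix n n ℂ)).trace) h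
    simp only [smul_mul_assoc, mul_assoc, Units.mul_inv, mul_one, Matrix.trace_smul] at h1
    rw [hms, Matrix.trace_mul_comm, mul_assoc, Units.inv_mul, mul_one, smul_eq_mul] at h1
    exact h1
  obtain ⟨a, r, hr, har⟩ := exists_pow_mul_coprime hp x
  have hxr : IsPEl p (x ^ r) := ⟨a, by rw [← pow_mul, mul_comm, har]⟩
  have hcr : c ^ r = 1 := by
    obtain ⟨m, hm⟩ : ∃ m, (σ (x ^ r) * ρ m).trace ≠ 0 := by
      by_contra! h
      have h1 := sum_trace_mul_trace_of_mul_eq_one hρ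
        (show σ (x ^ r) * σ (x ^ r)⁻¹ = 1 by rw [← map_mul, mul_inv_cancel, map_one])
      simp only [h, zero_mul, Finset.sum_const_zero] at h1
      exact Nat.cast_ne_zero.2 Fintype.card_ne_zero h1.symm
    have h1 := htr _ ((L.isPEl_mul_j hM _ m).2 hxr)
    rw [map_mul, L.σ_j] at h1
    have h2 := htrace (σ (x ^ r) * ρ m) (c ^ r) (by
      rw [map_mul, mul_assoc, ← hU', ← mul_assoc, hpow, smul_mul_assoc, mul_assoc])
    rw [h1] at h2
    exact (mul_eq_right₀ hm).1 h2.symm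
  have hc1 : c = 1 := by
    have h := pow_gcd_eq_one.2 ⟨hck, hcr⟩
    rwa [(Nat.Coprime.pow_left k hr.symm : Nat.gcd (p ^ k) r = 1), pow_one] at h
  have := htrace (σ x) c hc
  rwa [hc1, one_mul] at this

end CliffordLift

theorem eq_one_of_trace_pow_eq {n : Type} [Fintype n] {X : Matrix n n ℂ} {k : ℕ} (hk : k ≠ 0)
    (hX : X ^ k = 1) (htr : ∀ i : ℕ, (X ^ i).trace = Fintype.card n) : X = 1 := by
  have hk' : (k : ℂ) ≠ 0 := Nat.cast_ne_zero.2 hk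
  let P : Matrix n n ℂ := (k : ℂ)⁻¹ • ∑ i ∈ Finset.range k, X ^ i
  have hXP : X * P = P := by
    simp only [P, mul_smul_comm, Finset.mul_sum, ← pow_succ']
    congr 1
    have h1 := Finset.sum_range_succ (fun i => X ^ i) k
    rw [Finset.sum_range_succ', hX, pow_zero] at h1
    exact add_right_cancel h1
  have hXiP : ∀ i : ℕ, X ^ i * P = P := fun i => by
    induction i with
    | zero => simp
    | succ i ih => rw [pow_succ, mul_assoc, hXP, ih]
  have hPP : IsIdempotentElem P := by
    change P * P = P
    conv_lhs => enter [1]; simp only [P]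
    rw [smul_mul_assoc, Finset.sum_mul]
    simp only [hXiP, Finset.sum_const, Finset.card_range]
    rw [← Nat.cast_smul_eq_nsmul ℂ, smul_smul, inv_mul_cancel₀ hk', one_smul]
  have hP : 1 - P = 0 := by
    apply Matrix.toLin'.injective
    rw [map_zero]
    refine LinearMap.IsIdempotentElem.eq_zero_of_trace_eq_zero ?_ ?_
    · exact hPP.one_sub.map (Matrix.toLinAlgEquiv' : Matrix n n ℂ ≃ₐ[ℂ] _)
    · rw [Matrix.trace_toLin'_eq, Matrix.trace_sub, Matrix.trace_one]
      simp only [P, Matrix.trace_smul, Matrix.trace_sum, htr]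
      simp [hk']
  have hP1 : P = 1 := (sub_eq_zero.1 hP).symm
  rw [← mul_one X, ← hP1, hXP]

theorem exists_tensorRep {E n n' : Type} [Group E] [Fintype n] [Fintype n']
    (σ : E →* Matrix n n ℂ) (τ : E →* Matrix n' n' ℂ) :
    ∃ (N : Type) (_ : Fintype N) (R : E →* Matrix N N ℂ),
      Fintype.card N = Fintype.card n * Fintype.card n' ∧
      ∀ x, (R x).trace = (σ x).trace * (τ x).trace := by
  obtain ⟨N, ⟨e⟩⟩ : ∃ N : Type, Nonempty (N ≃ n × n') := ⟨_, ⟨Equiv.refl _⟩⟩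
  have iN : Fintype N := Fintype.ofEquiv _ e.symm
  refine ⟨N, iN, ⟨⟨fun x => (Matrix.kronecker (σ x) (τ x)).submatrix e e, ?_⟩, fun x y => ?_⟩,
    by rw [Fintype.card_congr e, Fintype.card_prod], fun x => ?_⟩
  · rw [map_one, map_one]
    refine Matrix.ext fun a b => ?_
    rw [Matrix.submatrix_apply, Matrix.kronecker, Matrix.kroneckerMap_apply, Matrix.one_apply,
      Matrix.one_apply,
      Matrix.one_apply, ← e.injective.eq_iff, Prod.ext_iff]
    split_ifs <;> simp_all
  · change (Matrix.kronecker (σ (x * y)) (τ (x * y))).submatrix e e = _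
    rw [map_mul, map_mul, Matrix.submatrix_mul_equiv]
    congr 1
    exact Matrix.mul_kronecker_mul _ _ _ _
  · rw [← Matrix.trace_kronecker]
    exact e.sum_comp fun a => Matrix.kronecker (σ x) (τ x) a a

namespace CliffordLift
variable {G : Type} [Group G] [Fintype G] {M : Subgroup G} [M.Normal] {n : Type}
    [Fintype n] [Nonempty n] {ρ : M →* Matrix n n ℂ} {E C : Type} [Group E] [Group C] {q : E →* G}
    {σ : E →* Matrix n n ℂ} {j : M →* E} {κ : C →* E} {ν : C →* ℂˣ}

theorem isQpIrr_mul (L : CliffordLift M ρ q σ j κ ν) {p : ℕ} [Fintype E]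
    (hp : p.Prime) (hM : ∀ m : M, IsPEl p m)
    (hρ : ∀ X, (∀ m, X * ρ m = ρ m * X) → ∃ c : ℂ, X = c • (1 : Matrix n n ℂ))
    (hd : Fintype.card n ∣ Nat.card M) {Q : Type} [Group Q] [Fintype Q] (r : E →* Q)
    (hr : Function.Surjective r) (hrj : ∀ m, r (j m) = 1) {ψ : Q → ℂ} (hψ : IsQpIrr p ψ)
    (hψκ : ∀ c y, ψ (r (κ c) * y) = (ν c : ℂ)⁻¹ * ψ y) {χ : G → ℂ}
    (hχ : ∀ x, χ (q x) = (σ x).trace * ψ (r x)) : IsQpIrr p χ := by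
  obtain ⟨n', i', τ, h1, h2, h3⟩ := hψ
  obtain ⟨N, iN, R, hN, hR'⟩ := exists_tensorRep σ (τ.comp r)
  have hR : ∀ x, (R x).trace = (σ x).trace * ψ (r x) := fun x => by
    rw [h1]
    exact hR' x
  have hRκ : ∀ c, (R (κ c)).trace = Fintype.card N := fun c => by
    have h4 := hψκ c 1
    rw [mul_one, h1 1, map_one, Matrix.trace_one] at h4
    rw [hR, h4, L.σ_κ, Matrix.trace_smul, Matrix.trace_one, hN]
    have := (ν c).ne_zero
    push_cast
    simp only [smul_eq_mul]
    field_simp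
  refine IsQpIrr.descend q L.surj R (fun x hx => ?_) ?_ (fun s hs x => ?_) fun x => ?_
  · obtain ⟨c, rfl⟩ := (L.ker x).1 hx
    refine eq_one_of_trace_pow_eq (k := Fintype.card E) Fintype.card_ne_zero ?_ fun i => ?_
    · rw [← map_pow, pow_card_eq_one, map_one]
    · rw [← map_pow, ← map_pow, hRκ]
  · have hM0 : (Fintype.card M : ℂ) ≠ 0 := Nat.cast_ne_zero.2 Fintype.card_ne_zero
    obtain ⟨e, he, hcard, hsum⟩ := exists_sum_comp r hr
    have h4 : ∀ m, ∑ x, (R x).trace * (R x⁻¹).trace =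
        ∑ x, (R (x * j m)).trace * (R (x * j m)⁻¹).trace := fun m =>
      (Equiv.sum_comp (Equiv.mulRight (j m)) fun x => (R x).trace * (R x⁻¹).trace).symm
    refine mul_left_cancel₀ hM0 ?_
    calc (Fintype.card M : ℂ) * ∑ x, (R x).trace * (R x⁻¹).trace
        = ∑ m : M, ∑ x, (R (x * j m)).trace * (R (x * j m)⁻¹).trace := by
          rw [Finset.sum_congr rfl fun m _ => (h4 m).symm]
          simp
      _ = ∑ x, (ψ (r x) * ψ (r x)⁻¹) *
            ∑ m : M, (σ x * ρ m).trace * (ρ m⁻¹ * σ x⁻¹).trace := by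
          rw [Finset.sum_comm]
          refine Finset.sum_congr rfl fun x _ => ?_
          rw [Finset.mul_sum]
          refine Finset.sum_congr rfl fun m _ => ?_
          rw [hR, hR, map_inv r, map_mul r, hrj, mul_one, mul_inv_rev, map_mul, map_mul,
            ← map_inv j, L.σ_j, L.σ_j]
          ring
      _ = ∑ x, (ψ (r x) * ψ (r x)⁻¹) * Fintype.card M := by
          refine Finset.sum_congr rfl fun x _ => ?_
          rw [sum_trace_mul_trace_of_mul_eq_one hρ (by rw [← map_mul, mul_inv_cancel, map_one])]
      _ = Fintype.card M * Fintype.card E := by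
          rw [← Finset.sum_mul, hsum fun y => ψ y * ψ y⁻¹, h2, hcard]
          ring
  · rw [hR, map_mul, L.map_trace_eq hp hM hρ hd hs, h3 s hs]
  · rw [hχ, hR]

end CliffordLift

/-- The twist by `σ⁻¹` of a class function `f` on `G`, averaged over the normal subgroup `M`. -/
def twistAvg {G : Type} [Group G] [Fintype G] {M : Subgroup G} {n : Type} [Fintype n] {E : Type}
    [Group E] (q : E →* G) (σ : E →* Matrix n n ℂ) (j : M →* E) (f : G → ℂ) (x : E) : ℂ :=
  (Fintype.card M : ℂ)⁻¹ * ∑ m : M, f (q x * m) * (σ (x * j m)⁻¹).trace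

namespace CliffordLift
variable {G : Type} [Group G] [Fintype G] {M : Subgroup G} [M.Normal] {n : Type}
    [Fintype n] {ρ : M →* Matrix n n ℂ} {E C : Type} [Group E] [Group C] {q : E →* G}
    {σ : E →* Matrix n n ℂ} {j : M →* E} {κ : C →* E} {ν : C →* ℂˣ}

theorem twistAvg_mul_j (L : CliffordLift M ρ q σ j κ ν) (f : G → ℂ) (x : E) (m : M) :
    twistAvg q σ j f (x * j m) = twistAvg q σ j f x := by
  unfold twistAvg
  rw [← Equiv.sum_comp (Equiv.mulLeft m) fun m' => f (q x * m') * (σ (x * j m')⁻¹).trace]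
  simp only [Equiv.coe_mulLeft, map_mul q, L.q_j, Subgroup.coe_mul, map_mul j, mul_assoc]

theorem twistAvg_conj (L : CliffordLift M ρ q σ j κ ν) {f : G → ℂ}
    (hf : ∀ x g, f (x * g * x⁻¹) = f g) (y x : E) :
    twistAvg q σ j f (y * x * y⁻¹) = twistAvg q σ j f x := by
  unfold twistAvg
  rw [← Equiv.sum_comp (MulAut.conjNormal (q y)).toEquiv]
  congr 1
  refine Finset.sum_congr rfl fun m _ => ?_
  simp only [MulEquiv.toEquiv_eq_coe, EquivLike.coe_coe, ← L.conj, MulAut.conjNormal_apply]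
  congr 1
  · rw [← hf (q y) (q x * m)]
    simp only [map_mul, map_inv]
    congr 1
    group
  · have : (y * x * y⁻¹ * (y * j m * y⁻¹))⁻¹ = y * ((x * j m)⁻¹ * y⁻¹) := by group
    rw [this, map_mul, Matrix.trace_mul_comm, ← map_mul, mul_assoc, inv_mul_cancel, mul_one]

theorem twistAvg_κ_mul (L : CliffordLift M ρ q σ j κ ν) (f : G → ℂ) (c : C) (x : E) :
    twistAvg q σ j f (κ c * x) = (ν c : ℂ)⁻¹ * twistAvg q σ j f x := by
  unfold twistAvg
  have h1 : q (κ c) = 1 := (L.ker _).2 ⟨c, rfl⟩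
  rw [mul_left_comm (ν c : ℂ)⁻¹]
  congr 1
  rw [Finset.mul_sum]
  refine Finset.sum_congr rfl fun m _ => ?_
  rw [map_mul, h1, one_mul, mul_assoc, mul_inv_rev, ← map_inv κ, map_mul, L.σ_κ, map_inv ν,
    mul_smul_comm, mul_one, Matrix.trace_smul, Units.val_inv_eq_inv_val, smul_eq_mul]
  ring

theorem trace_mul_twistAvg [Nonempty n] (L : CliffordLift M ρ q σ j κ ν) {A : Subgroup M}
    {μ : A →* ℂˣ} (F : FullyRamified A μ ρ) {f : G → ℂ} (hf : ∀ x g, f (x * g * x⁻¹) = f g)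
    (hfA : ∀ g (a : A), f (g * (a : M)) = μ a * f g) (x : E) :
    (σ x).trace * twistAvg q σ j f x = f (q x) := by
  have hM0 : (Fintype.card M : ℂ) ≠ 0 := Nat.cast_ne_zero.2 Fintype.card_ne_zero
  let B : Matrix n n ℂ := ∑ m : M, f (q x * m) • ρ m⁻¹
  have hB : ∀ y : M, ρ y * B = B * ρ (MulAut.conjNormal (q x⁻¹) y) := fun y => by
    simp only [B]
    rw [Finset.mul_sum, Finset.sum_mul, ← Equiv.sum_comp
      ((Equiv.mulLeft (MulAut.conjNormal (q x⁻¹) y)).trans (Equiv.mulRight y⁻¹))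
      fun m => f (q x * m) • ρ m⁻¹ * ρ (MulAut.conjNormal (q x⁻¹) y)]
    refine Finset.sum_congr rfl fun m _ => ?_
    simp only [Equiv.trans_apply, Equiv.coe_mulLeft, Equiv.coe_mulRight, mul_smul_comm,
      smul_mul_assoc, ← map_mul]
    have h1 : f (q x * ((MulAut.conjNormal (q x⁻¹) y * m * y⁻¹ : M) : G)) = f (q x * m) := by
      rw [← hf y (q x * m)]
      congr 1
      simp only [Subgroup.coe_mul, MulAut.conjNormal_apply, map_inv q, Subgroup.coe_inv]
      group
    rw [h1]
    congr 2
    group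
  have hx : σ x⁻¹ * σ x = 1 := by rw [← map_mul, inv_mul_cancel, map_one]
  obtain ⟨c, hc⟩ := F.schur (B * σ x⁻¹) fun y => by
    rw [mul_assoc, L.σ_mul_ρ, ← mul_assoc, ← hB, mul_assoc]
  have hBc : B = c • σ x := by
    have := congrArg (· * σ x) hc
    simpa only [mul_assoc, hx, mul_one, smul_mul_assoc, one_mul] using this
  have h1 : twistAvg q σ j f x = (Fintype.card M : ℂ)⁻¹ * (c * Fintype.card n) := by
    have h2 := congrArg Matrix.trace hc
    rw [Matrix.trace_smul, Matrix.trace_one, smul_eq_mul] at h2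
    rw [← h2]
    simp only [B, twistAvg, Finset.sum_mul, Matrix.trace_sum, smul_mul_assoc, Matrix.trace_smul,
      mul_inv_rev, map_mul, ← map_inv j, L.σ_j, smul_eq_mul]
  have h3 : c * (σ x).trace = Fintype.card A * Fintype.card n * f (q x) := by
    have h4 := congrArg Matrix.trace hBc
    rw [Matrix.trace_smul, smul_eq_mul] at h4
    rw [← h4]
    simp only [B, Matrix.trace_sum, Matrix.trace_smul, smul_eq_mul]
    have h5 : ∑ m : M, f (q x * m) * (ρ m⁻¹).trace =
        ∑ a : A, f (q x * (a : M)) * (ρ (a : M)⁻¹).trace := by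
      rw [← Finset.sum_subtype (Finset.univ.filter (· ∈ A)) (by simp)
        (fun m : M => f (q x * m) * (ρ m⁻¹).trace), Finset.sum_filter]
      refine Finset.sum_congr rfl fun m _ => ?_
      split_ifs with hm
      · rfl
      · rw [F.trace_zero m⁻¹ (by rwa [A.inv_mem_iff]), mul_zero]
    have h6 : ∀ a : A, f (q x * (a : M)) * (ρ (a : M)⁻¹).trace = Fintype.card n * f (q x) :=
      fun a => by
      rw [hfA, ← Subgroup.coe_inv, F.scalar, Matrix.trace_smul, Matrix.trace_one, map_inv,
        Units.val_inv_eq_inv_val, smul_eq_mul]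
      have := (μ a).ne_zero
      field_simp
    rw [h5]
    simp only [h6, Finset.sum_const, Finset.card_univ, nsmul_eq_mul]
    ring
  have h7 : (Fintype.card M : ℂ) = Fintype.card A * (Fintype.card n : ℂ) ^ 2 := by
    exact_mod_cast F.card_mul_sq.symm
  rw [h1]
  calc (σ x).trace * ((Fintype.card M : ℂ)⁻¹ * (c * Fintype.card n))
      = (Fintype.card M : ℂ)⁻¹ * (c * (σ x).trace * Fintype.card n) := by ring
    _ = (Fintype.card M : ℂ)⁻¹ * (Fintype.card A * (Fintype.card n : ℂ) ^ 2) * f (q x) := by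
      rw [h3]; ring
    _ = f (q x) := by rw [← h7, inv_mul_cancel₀ hM0, one_mul]

end CliffordLift

theorem CliffordLift.isPEl_κ {G : Type} [Group G] [Fintype G] {M : Subgroup G} [M.Normal]
    {n : Type} [Fintype n] {ρ : M →* Matrix n n ℂ} {E C : Type} [Group E] [Group C] {q : E →* G}
    {σ : E →* Matrix n n ℂ} {j : M →* E} {κ : C →* E} {ν : C →* ℂˣ}
    (L : CliffordLift M ρ q σ j κ ν) {p : ℕ} (hp : p.Prime) (hM : ∀ m : M, IsPEl p m)
    (hd : Fintype.card n ∣ Nat.card M) (c : C) : IsPEl p (κ c) := by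
  have : Fact p.Prime := ⟨hp⟩
  obtain ⟨k, hk⟩ := (IsPGroup.iff_card (p := p) (G := M)).1 hM
  obtain ⟨e, he⟩ := hd
  have h1 := L.det (κ c)
  rw [L.σ_κ, Matrix.det_smul, Matrix.det_one, mul_one, ← pow_mul] at h1
  refine ⟨k + k, ?_⟩
  rw [← map_pow, L.inj (c ^ _) (Units.ext ?_), map_one]
  rw [map_pow, Units.val_pow_eq_pow_val, Units.val_one, pow_add, ← hk]
  conv_lhs => rw [he, mul_right_comm, ← he, pow_mul, h1, one_pow]

theorem CentralSetup.mem_span_of_cliffordLift {p : ℕ} (hp : p.Prime) {G H Z : Type} [Group G]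
    [Group H] [Group Z] [Fintype G] {π : G →* H} {ι : Z →* G} {l : Z →* ℂˣ}
    (S : CentralSetup p π ι l) (IH : SpanBelow p (Nat.card H)) (N : Subgroup H) [N.Normal]
    (hN : N ≠ ⊥) (M : Subgroup G) [M.Normal] (hMN : M = N.comap π) (hM : ∀ m : M, IsPEl p m)
    (A : Subgroup M) (hA : ∀ m : M, m ∈ A ↔ ∃ z, ι z = m) (μ : A →* ℂˣ)
    (hμ : ∀ z (a : A), ι z = (a : M) → μ a = l z) {n : Type} [Fintype n] [Nonempty n]
    {ρ : M →* Matrix n n ℂ} (F : FullyRamified A μ ρ) {E C : Type} [Group E] [Group C] [Fintype E]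
    {q : E →* G} {σ : E →* Matrix n n ℂ} {j : M →* E} {κ : C →* E} {ν : C →* ℂˣ}
    (L : CliffordLift M ρ q σ j κ ν) {f : G → ℂ} (hf : IsCoverFun p ι l f) :
    f ∈ Submodule.span ℂ (coverRestr p ι l) := by
  have hd : Fintype.card n ∣ Nat.card M := by
    rw [Nat.card_eq_fintype_card, ← F.card_mul_sq, pow_two]
    exact ⟨Fintype.card A * Fintype.card n, by ring⟩
  have hJ := L.normal_range
  have : Finite H := Finite.of_surjective π S.surj
  let r : E →* E ⧸ j.range := QuotientGroup.mk' j.range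
  have hr : Function.Surjective r := QuotientGroup.mk'_surjective _
  have hr1 : ∀ x, r x = 1 ↔ ∃ m, j m = x := fun x => QuotientGroup.eq_one_iff x
  have hrj : ∀ m, r (j m) = 1 := fun m => (hr1 _).2 ⟨m, rfl⟩
  have hqκ : ∀ c, q (κ c) = 1 := fun c => (L.ker _).2 ⟨c, rfl⟩
  have hπM : ∀ g, π g ∈ N ↔ g ∈ M := fun g => by rw [hMN]; rfl
  let π' : E ⧸ j.range →* H ⧸ N := QuotientGroup.lift j.range
    ((QuotientGroup.mk' N).comp (π.comp q)) (by
      rintro _ ⟨m, rfl⟩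
      refine (QuotientGroup.eq_one_iff _).2 ((hπM _).2 ?_)
      rw [L.q_j]
      exact m.2)
  have hπ' : ∀ x, π' (r x) = QuotientGroup.mk' N (π (q x)) := fun x => rfl
  have S' : CentralSetup p π' (r.comp κ) ν⁻¹ := by
    refine ⟨fun h => ?_, fun y => ?_, fun c y => ?_, fun c => ?_, fun c => ?_, ?_⟩
    · obtain ⟨h, rfl⟩ := QuotientGroup.mk'_surjective _ h
      obtain ⟨g, rfl⟩ := S.surj h
      obtain ⟨x, rfl⟩ := L.surj g
      exact ⟨r x, rfl⟩
    · obtain ⟨x, rfl⟩ := hr y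
      rw [hπ', QuotientGroup.mk'_apply, QuotientGroup.eq_one_iff, hπM]
      constructor
      · intro hx
        obtain ⟨c, hc⟩ := (L.ker (x * (j ⟨q x, hx⟩)⁻¹)).1 (by
          rw [map_mul, map_inv, L.q_j, mul_inv_cancel])
        refine ⟨c, ?_⟩
        rw [MonoidHom.comp_apply, hc, map_mul, map_inv, hrj, inv_one, mul_one]
      · rintro ⟨c, hc⟩
        obtain ⟨m, hm⟩ := (hr1 ((κ c)⁻¹ * x)).1 (by
          rw [map_mul, map_inv, ← hc, MonoidHom.comp_apply, inv_mul_cancel])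
        have h1 := congrArg q hm
        rw [map_mul, map_inv, hqκ, inv_one, one_mul, L.q_j] at h1
        rw [← h1]
        exact m.2
    · obtain ⟨x, rfl⟩ := hr y
      rw [MonoidHom.comp_apply, ← map_mul, L.central, map_mul]
    · rw [MonoidHom.comp_apply, hr1, MonoidHom.inv_apply, inv_eq_one]
      constructor
      · rintro ⟨m, hm⟩
        have h1 := congrArg q hm
        rw [L.q_j, hqκ, OneMemClass.coe_eq_one] at h1
        rw [h1, map_one] at hm
        have h2 := L.σ_κ c
        rw [← hm, map_one] at h2
        obtain ⟨i⟩ := ‹Nonempty n›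
        have h3 := congrFun (congrFun h2 i) i
        simp only [Matrix.smul_apply, Matrix.one_apply_eq, smul_eq_mul, mul_one] at h3
        exact Units.ext h3.symm
      · intro hc
        exact ⟨1, by rw [L.inj c hc, map_one, map_one]⟩
    · exact (L.isPEl_κ hp hM hd c).map r
    · exact S.psep.section (MonoidHom.id H) (QuotientGroup.mk' N)
        (QuotientGroup.mk'_surjective _) fun h hh => by
          rw [show h = 1 from hh]; exact Subgroup.one_mem _
  have hcard : Nat.card (H ⧸ N) < Nat.card H := by
    rw [Subgroup.card_eq_card_quotient_mul_card_subgroup N]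
    have h1 : 1 < Nat.card N := (Subgroup.one_lt_card_iff_ne_bot N).2 hN
    exact lt_mul_of_one_lt_right Nat.card_pos h1
  have hpel : ∀ x, IsPEl p (r x) ↔ IsPEl p (q x) := fun x => by
    rw [isPEl_map_iff r fun x hx => ?_, isPEl_map_iff q fun x hx => ?_]
    · obtain ⟨c, rfl⟩ := (L.ker x).1 hx
      exact L.isPEl_κ hp hM hd c
    · obtain ⟨m, rfl⟩ := (hr1 x).1 hx
      exact (hM m).map j
  let f' : E ⧸ j.range → ℂ := fun y => twistAvg q σ j f (Function.surjInv hr y)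
  have hf' : ∀ x, f' (r x) = twistAvg q σ j f x := fun x => by
    obtain ⟨m, hm⟩ := (hr1 (x⁻¹ * Function.surjInv hr (r x))).1 (by
      rw [map_mul, map_inv, Function.surjInv_eq hr, inv_mul_cancel])
    rw [← L.twistAvg_mul_j f x m, hm, mul_inv_cancel_left]
  have hcf : IsCoverFun p (r.comp κ) ν⁻¹ f' := by
    refine ⟨fun y hy => ?_, fun z y => ?_, fun c y => ?_⟩
    · obtain ⟨x, rfl⟩ := hr y
      rw [hf', twistAvg, Finset.sum_eq_zero, mul_zero]
      intro m _
      rw [hf.supp, zero_mul]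
      rwa [← L.q_j m, ← map_mul, ← hpel, map_mul, hrj, mul_one]
    · obtain ⟨x, rfl⟩ := hr y
      obtain ⟨z, rfl⟩ := hr z
      rw [← map_inv, ← map_mul, ← map_mul, hf', hf', L.twistAvg_conj hf.conj]
    · obtain ⟨x, rfl⟩ := hr y
      rw [MonoidHom.comp_apply, ← map_mul, hf', hf', L.twistAvg_κ_mul, MonoidHom.inv_apply,
        Units.val_inv_eq_inv_val]
  have hspan := IH _ _ _ π' (r.comp κ) ν⁻¹ S' hcard f' hcf
  let t : G → E := Function.surjInv L.surj
  have ht : ∀ g, q (t g) = g := Function.surjInv_eq L.surj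
  let T : (E ⧸ j.range → ℂ) →ₗ[ℂ] (G → ℂ) :=
    { toFun := fun Φ g => (σ (t g)).trace * Φ (r (t g))
      map_add' := fun Φ Ψ => funext fun g => mul_add _ _ _
      map_smul' := fun c Φ => funext fun g => mul_left_comm _ _ _ }
  have hT : ∀ Φ g, T Φ g = (σ (t g)).trace * Φ (r (t g)) := fun Φ g => rfl
  have hfA : ∀ g (a : A), f (g * (a : M)) = μ a * f g := fun g a => by
    obtain ⟨z, hz⟩ := (hA a).1 a.2
    rw [hμ z a hz, ← hz, ← S.central, hf.cov]
  have hTf : T f' = f := funext fun g => by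
    rw [hT, hf', L.trace_mul_twistAvg F hf.conj hfA, ht]
  rw [← hTf]
  refine span_transfer T ?_ hspan
  rintro _ ⟨ψ, h1, h2, rfl⟩
  have h2' : ∀ c y, ψ (r (κ c) * y) = (ν c : ℂ)⁻¹ * ψ y := fun c y => by
    rw [← Units.val_inv_eq_inv_val]; exact h2 c y
  have hχ : ∀ x, (σ (t (q x))).trace * ψ (r (t (q x))) = (σ x).trace * ψ (r x) := fun x => by
    obtain ⟨c, hc⟩ := (L.ker (t (q x) * x⁻¹)).1 (by rw [map_mul, ht, map_inv, mul_inv_cancel])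
    rw [← inv_mul_cancel_right (t (q x)) x, ← hc, map_mul, map_mul, h2', L.σ_κ, smul_mul_assoc,
      one_mul, Matrix.trace_smul, smul_eq_mul]
    have := (ν c).ne_zero
    field_simp
  refine Submodule.subset_span ⟨fun g => (σ (t g)).trace * ψ (r (t g)),
    L.isQpIrr_mul hp hM F.schur hd r hr hrj h1 h2' hχ, fun z g => ?_, funext fun g => ?_⟩
  · have hzM : ι z ∈ M := by
      rw [← hπM, (S.ker _).2 ⟨z, rfl⟩]; exact N.one_mem
    have hzA : (⟨ι z, hzM⟩ : M) ∈ A := (hA _).2 ⟨z, rfl⟩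
    have h3 : ι z * g = q (j ⟨ι z, hzM⟩ * t g) := by rw [map_mul, L.q_j, ht]
    have h4 := F.scalar ⟨⟨ι z, hzM⟩, hzA⟩
    rw [hμ z _ rfl] at h4
    simp only [h3, hχ]
    rw [map_mul, map_mul, hrj, one_mul, L.σ_j, h4, smul_mul_assoc, one_mul, Matrix.trace_smul,
      smul_eq_mul, mul_assoc]
  · rw [hT, hpel, ht]
    split_ifs <;> simp

theorem CentralSetup.mem_span_of_nonabelian {p : ℕ} (hp : p.Prime) {G H Z : Type} [Group G]
    [Group H] [Group Z] [Fintype G] {π : G →* H} {ι : Z →* G} {l : Z →* ℂˣ}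
    (S : CentralSetup p π ι l) (IH : SpanBelow p (Nat.card H)) (N : Subgroup H) [N.Normal]
    (hN : N ≠ ⊥) (hmin : ∀ K : Subgroup H, K.Normal → K ≤ N → K = ⊥ ∨ K = N)
    (hNp : ∀ x ∈ N, IsPEl p x)
    (hnc : ¬ ∀ x ∈ N.comap π, ∀ y ∈ N.comap π, x * y = y * x) {f : G → ℂ}
    (hf : IsCoverFun p ι l f) : f ∈ Submodule.span ℂ (coverRestr p ι l) := by
  have : Fact p.Prime := ⟨hp⟩
  have : Finite H := Finite.of_surjective π S.surj
  have hker : ∀ x, π x = 1 → IsPEl p x := fun x hx => by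
    obtain ⟨z, rfl⟩ := (S.ker x).1 hx
    exact S.pel z
  have hM : ∀ m : N.comap π, IsPEl p m := fun m => by
    obtain ⟨k, hk⟩ := (isPEl_map_iff π hker m).1 (hNp _ m.2)
    exact ⟨k, Subtype.ext hk⟩
  have hNcomm : ∀ x ∈ N, ∀ y ∈ N, x * y = y * x := by
    have hNg : IsPGroup p N := fun x => by
      obtain ⟨k, hk⟩ := hNp x x.2
      exact ⟨k, Subtype.ext hk⟩
    have : Nontrivial N := (Subgroup.nontrivial_iff_ne_bot N).2 hN
    have hc := hNg.center_nontrivial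
    rcases hmin ((Subgroup.center N).map N.subtype) inferInstance (Subgroup.map_subtype_le _)
      with h | h
    · rw [Subgroup.map_eq_bot_iff_of_injective _ N.subtype_injective] at h
      exact absurd h ((Subgroup.nontrivial_iff_ne_bot _).1 hc)
    · intro x hx y hy
      rw [← h] at hx
      obtain ⟨x, hx, rfl⟩ := hx
      exact congrArg Subtype.val (Subgroup.mem_center_iff.1 hx ⟨y, hy⟩).symm
  have hcenter : ∀ m ∈ Subgroup.center (N.comap π), ∃ z, ι z = m := by
    have h1 : (((Subgroup.center (N.comap π)).map (N.comap π).subtype).map π).Normal :=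
      Subgroup.Normal.map inferInstance π S.surj
    rcases hmin _ h1 (Subgroup.map_le_iff_le_comap.2 (Subgroup.map_subtype_le _)) with h | h
    · intro m hm
      refine (S.ker _).1 ((Subgroup.mem_bot (G := H)).1 ?_)
      rw [← h]
      exact ⟨m, ⟨m, hm, rfl⟩, rfl⟩
    · refine absurd (fun x hx y hy => ?_) hnc
      have hx' : π x ∈ N := hx
      rw [← h] at hx'
      obtain ⟨_, ⟨m, hm, rfl⟩, hmx⟩ := hx'
      obtain ⟨z, hz⟩ := (S.ker (x * (m : G)⁻¹)).1 (by
        rw [map_mul, map_inv, ← hmx]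
        exact mul_inv_cancel _)
      have h2 : (y : G) * m = m * y := congrArg Subtype.val (Subgroup.mem_center_iff.1 hm ⟨y, hy⟩)
      rw [← inv_mul_cancel_right x (m : G), ← hz, mul_assoc, ← h2, ← mul_assoc, S.central,
        mul_assoc]
  let A : Subgroup (N.comap π) := ι.range.subgroupOf (N.comap π)
  have hA : ∀ m : N.comap π, m ∈ A ↔ ∃ z, ι z = m := fun m => Iff.rfl
  choose w hw using fun a : A => (hA a).1 a.2
  have hl : ∀ z (a : A), ι z = (a : N.comap π) → l (w a) = l z := fun z a h =>
    S.eq_of_eq ((hw a).trans h.symm)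
  let μ : A →* ℂˣ :=
    { toFun := fun a => l (w a)
      map_one' := by rw [hl 1 1 (map_one ι), map_one]
      map_mul' := fun a b => by rw [hl (w a * w b) (a * b) (by simp [hw]), map_mul] }
  have hμ : ∀ z (a : A), ι z = (a : N.comap π) → μ a = l z := hl
  have hAc : ∀ a ∈ A, ∀ m, a * m = m * a := fun a ha m => by
    obtain ⟨z, hz⟩ := (hA a).1 ha
    refine Subtype.ext ?_
    rw [Subgroup.coe_mul, Subgroup.coe_mul, ← hz, S.central]
  obtain ⟨n, _, ρ, _, hscal, hschur⟩ := exists_schur_rep A hAc μ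
  have htr0 : ∀ m, m ∉ A → (ρ m).trace = 0 := fun m hm => by
    have hmc : m ∉ Subgroup.center (N.comap π) := fun h => hm ((hA m).2 (hcenter m h))
    rw [Subgroup.mem_center_iff] at hmc
    push Not at hmc
    obtain ⟨y, hy⟩ := hmc
    obtain ⟨z, hz⟩ := (S.ker ((y * m * y⁻¹ * m⁻¹ : N.comap π) : G)).1 (by
      simp only [Subgroup.coe_mul, Subgroup.coe_inv, map_mul, map_inv]
      rw [hNcomm _ y.2 _ m.2, mul_inv_cancel_right, mul_inv_cancel])
    have ha : y * m * y⁻¹ * m⁻¹ ∈ A := (hA _).2 ⟨z, hz⟩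
    have hlz : (l z : ℂ) ≠ 1 := fun h => by
      rw [Units.val_eq_one, ← S.inj, hz, OneMemClass.coe_eq_one, mul_inv_eq_one,
        mul_inv_eq_iff_eq_mul] at h
      exact hy h
    have h1 : (ρ (y * m * y⁻¹)).trace = (ρ m).trace := by
      rw [map_mul, Matrix.trace_mul_comm, ← map_mul, ← mul_assoc, inv_mul_cancel, one_mul]
    rw [← inv_mul_cancel_right (y * m * y⁻¹) m, map_mul, hscal ⟨_, ha⟩, hμ z _ hz, smul_mul_assoc,
      one_mul, Matrix.trace_smul, smul_eq_mul] at h1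
    by_contra h
    exact hlz ((mul_eq_right₀ h).1 h1)
  have htr : ∀ g m, (ρ (MulAut.conjNormal g m)).trace = (ρ m).trace := fun g m => by
    by_cases hm : m ∈ A
    · obtain ⟨z, hz⟩ := (hA m).1 hm
      congr 2
      refine Subtype.ext ?_
      rw [MulAut.conjNormal_apply, ← hz, ← S.central, mul_inv_cancel_right]
    · rw [htr0 m hm, htr0]
      intro h
      obtain ⟨z, hz⟩ := (hA _).1 h
      refine hm ((hA m).2 ⟨z, ?_⟩)
      rw [MulAut.conjNormal_apply, eq_mul_inv_iff_mul_eq, S.central] at hz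
      exact mul_left_cancel hz
  obtain ⟨E, C, _, _, _, q, σ, j, κ, ν, L⟩ := exists_cliffordLift (N.comap π) ρ hschur htr
  exact S.mem_span_of_cliffordLift hp IH N hN (N.comap π) rfl hM A hA μ hμ
    ⟨hscal, hschur, htr0⟩ L hf

theorem spanBelow {p : ℕ} (hp : p.Prime) (n : ℕ) : SpanBelow p n := by
  induction n with
  | zero => exact fun G H Z _ _ _ _ π ι l S h => absurd h (Nat.not_lt_zero _)
  | succ n ih =>
    intro G H Z _ _ _ _ π ι l S hlt f hf
    have IH : SpanBelow p (Nat.card H) := fun G' H' Z' _ _ _ _ π' ι' l' S' h =>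
      ih G' H' Z' π' ι' l' S' (h.trans_le (Nat.lt_succ_iff.1 hlt))
    have : Finite H := Finite.of_surjective π S.surj
    rcases subsingleton_or_nontrivial H with hs | hs
    · exact S.mem_span_of_trivial (fun h => Subsingleton.elim _ _) hf
    obtain ⟨N, hNn, hN, hmin, hNp | hNc⟩ := S.psep.exists_minimal_normal hp
    · by_cases hc : ∀ x ∈ N.comap π, ∀ y ∈ N.comap π, x * y = y * x
      · refine S.mem_span_of_abelian IH (N.comap π) ?_ (fun y hy => ?_) hc hf
        · refine lt_of_le_of_ne (fun x hx => ?_) fun h => hN ?_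
          · rw [Subgroup.mem_comap, MonoidHom.mem_ker.1 hx]
            exact N.one_mem
          · rw [eq_bot_iff]
            intro x hx
            obtain ⟨g, rfl⟩ := S.surj x
            have : g ∈ π.ker := by rw [h]; exact hx
            exact this
        · refine (isPEl_map_iff π (fun x hx => ?_) y).1 (hNp _ hy)
          obtain ⟨z, rfl⟩ := (S.ker x).1 hx
          exact S.pel z
      · exact S.mem_span_of_nonabelian hp IH N hN hmin hNp hc hf
    · obtain ⟨K, hK, hKc, hK1⟩ := S.exists_coprime_normal hp N hN hNc
      exact S.mem_span_of_coprime hp IH K hKc hK1 hf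

theorem mem_span_restr {p : ℕ} (hp : p.Prime) {G : Type} [Group G] [Fintype G]
    (hG : IsPSolvable p G) {f : G → ℂ} (supp : ∀ g, ¬ IsPEl p g → f g = 0)
    (conj : ∀ x g, f (x * g * x⁻¹) = f g) :
    f ∈ Submodule.span ℂ {F : G → ℂ | ∃ χ, IsQpIrr p χ ∧
      F = fun g => if IsPEl p g then χ g else 0} := by
  have S : CentralSetup p (MonoidHom.id G) (1 : PUnit →* G) (1 : PUnit →* ℂˣ) :=
    ⟨Function.surjective_id, fun g => by simp [eq_comm], fun z g => by simp, fun z => by simp,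
      fun z => ⟨0, by simp⟩, hG.pSep⟩
  refine Submodule.span_mono ?_ (spanBelow hp (Nat.card G + 1) G G PUnit _ _ _ S
    (Nat.lt_succ_self _) f ⟨supp, conj, fun z g => by simp⟩)
  rintro F ⟨χ, h1, -, h2⟩
  exact ⟨χ, h1, h2⟩

/-- If `p` is a prime and `G` is a finite `p`-solvable group, then the number of
conjugacy classes of `p`-elements is at most the number of `Q_p`-valued irreducible
characters. -/
theorem pElementClasses_le_QpValuedIrrChars (p : ℕ) (hp : p.Prime)
    (G : Type) [Group G] [Fintype G] (hG : IsPSolvable p G) :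
    (PElementClasses p G).ncard ≤ (QpValuedIrrChars p G).ncard :=
  ncard_pElementClasses_le_of_span fun _ supp conj => mem_span_restr hp hG supp conj
end
end
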